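/- Let M be a von Neumann algebra and p ∈ M a projection. Then the unitary orbit U_M(p) = {u p u* : u ∈ M unitary}, equipped with the operator-norm topology, is simply connected (it is path-connected and has trivial fundamental group). -/

import Mathlib

set_option linter.all false

namespace UO

/-- The algebraic axioms of von Neumann algebras that we use. -/
class VNR (A : Type*) [Ring A] [StarRing A] : Prop where
  proper : ∀ x : A, star x * x = 0 → x = 0
  baer : ∀ S : Set A, ∃ e : A, e * e = e ∧ star e = e ∧ ∀ a, e * a = 0 ↔ ∀ s ∈ S, s * a = 0
  sqrt : ∀ x : A, ∃ h : A, star h = h ∧ h * h = star x * x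
  polar : ∀ x h : A, star h = h → h * h = star x * x → ∃ v, v * h = x ∧ ∀ a, h * a = 0 → v * a = 0
  chain : ∀ S : Set A, S.Nonempty → (∀ v ∈ S, v * star v * v = v) →
    (∀ v ∈ S, ∀ w ∈ S, w * (star v * v) = v ∨ v * (star w * w) = w) →
    ∃ v : A, v * star v * v = v ∧ (∀ w ∈ S, v * (star w * w) = w) ∧
      (∀ a, (∀ w ∈ S, a * w = 0) → a * v = 0) ∧ (∀ a, (∀ w ∈ S, w * a = 0) → v * a = 0)

section alg
variable {A : Type*} [Ring A] [StarRing A]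

/-- projections -/
structure Pj (e : A) : Prop where
  idem : e * e = e
  sa : star e = e

theorem st {a b c : A} (h : a * b = c) : star b * star a = star c := by
  rw [← h, star_mul]

theorem sandwich {a x y b : A} (h : x * y = 0) (h1 : a * x = a) (h2 : y * b = b) : a * b = 0 := by
  rw [← h1, ← h2, mul_assoc, ← mul_assoc x, h, zero_mul, mul_zero]

theorem Pj.zero : Pj (0 : A) := ⟨by simp, by simp⟩
theorem Pj.one : Pj (1 : A) := ⟨by simp, by simp⟩

theorem Pj.swap {e f : A} (he : Pj e) (hf : Pj f) (h : f * e = e) : e * f = e := by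
  have := st h
  rwa [he.sa, hf.sa] at this

theorem Pj.swap' {e f : A} (he : Pj e) (hf : Pj f) (h : e * f = e) : f * e = e := by
  have := st h
  rwa [he.sa, hf.sa] at this

theorem Pj.swap0 {e f : A} (he : Pj e) (hf : Pj f) (h : f * e = 0) : e * f = 0 := by
  have := st h
  rwa [he.sa, hf.sa, star_zero] at this

theorem Pj.sub {e f : A} (he : Pj e) (hf : Pj f) (h : f * e = e) : Pj (f - e) := by
  have h' := he.swap hf h
  refine ⟨?_, by simp [he.sa, hf.sa]⟩
  simp [mul_sub, sub_mul, he.idem, hf.idem, h, h']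

theorem Pj.compl {e : A} (he : Pj e) : Pj (1 - e) := he.sub .one (by simp)

theorem Pj.add {e f : A} (he : Pj e) (hf : Pj f) (h : f * e = 0) : Pj (e + f) := by
  have h' := he.swap0 hf h
  refine ⟨?_, by simp [he.sa, hf.sa]⟩
  simp [mul_add, add_mul, he.idem, hf.idem, h, h']

theorem Pj.mulc {e z : A} (he : Pj e) (hz : Pj z) (h : z * e = e * z) : Pj (z * e) := by
  have h1 := he.idem
  have h2 := hz.idem
  refine ⟨by grind, by simp [he.sa, hz.sa, h]⟩

theorem Pj.ks {e a : A} (he : Pj e) : (1 - e) * a = 0 ↔ e * a = a := by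
  rw [sub_mul, one_mul, sub_eq_zero, eq_comm]

theorem Pj.ks' {e a : A} (he : Pj e) : a * (1 - e) = 0 ↔ a * e = a := by
  rw [mul_sub, mul_one, sub_eq_zero, eq_comm]

variable [VNR A]

theorem proper' {x : A} (h : x * star x = 0) : x = 0 := by
  have := VNR.proper (star x) (by simpa using h)
  simpa using this

theorem pi_right {v e : A} (h : star v * v = e) (he : e * e = e) : v * e = v := by
  have hs : star e = e := by rw [← h]; simp
  have : v * (1 - e) = 0 := by
    apply VNR.proper
    simp only [star_mul, star_sub, star_one, hs]
    simp only [mul_sub, sub_mul, one_mul, mul_one]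
    grind
  rw [mul_sub, mul_one, sub_eq_zero] at this
  exact this.symm

theorem pi_left {v f : A} (h : v * star v = f) (hf : f * f = f) : f * v = v := by
  have hs : star f = f := by rw [← h]; simp
  have := st (pi_right (v := star v) (e := f) (by simpa using h) hf)
  rwa [star_star, hs] at this

/-- a partial isometry with source e and target f -/
structure PI (v e f : A) : Prop where
  src : star v * v = e
  tgt : v * star v = f
  pe : Pj e
  pf : Pj f
  vr : v * e = v
  vl : f * v = v
  sr : star v * f = star v
  sl : e * star v = star v

theorem PI.mk' {v e : A} (h : star v * v = e) (he : e * e = e) : PI v e (v * star v) := by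
  have h1 := pi_right h he
  have hs : star e = e := by rw [← h]; simp
  have h2 := st h1
  rw [hs] at h2
  refine ⟨h, rfl, ⟨he, hs⟩, ⟨?_, by simp⟩, h1, ?_, ?_, h2⟩ <;> grind

theorem PI.mk2 {v e f : A} (h : star v * v = e) (he : e * e = e) (hf : v * star v = f) :
    PI v e f := hf ▸ PI.mk' h he

theorem PI.of {v : A} (h : v * star v * v = v) : PI v (star v * v) (v * star v) :=
  PI.mk' rfl (by grind)

theorem PI.symm {v e f : A} (h : PI v e f) : PI (star v) f e :=
  ⟨by simpa using h.tgt, by simpa using h.src, h.pf, h.pe, by simpa using h.sr,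
    by simpa using h.sl, by simpa using h.vr, by simpa using h.vl⟩

theorem PI.trans {v w e f g : A} (h : PI v e f) (k : PI w f g) : PI (w * v) e g := by
  obtain ⟨a1, a2, a3, a4, a5, a6, a7, a8⟩ := h
  obtain ⟨b1, b2, b3, b4, b5, b6, b7, b8⟩ := k
  have := a3.idem
  apply PI.mk2 <;> (try simp only [star_mul]) <;> grind

theorem PI.refl {e : A} (he : Pj e) : PI e e e := by
  have := he.idem
  have := he.sa
  apply PI.mk2 <;> grind

/-- restriction to a subprojection -/
theorem PI.restr {v e f g : A} (h : PI v e f) (hg : Pj g) (hge : e * g = g) :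
    PI (v * g) g (v * g * star v) := by
  obtain ⟨a1, a2, a3, a4, a5, a6, a7, a8⟩ := h
  have := hg.idem
  have := hg.sa
  apply PI.mk2 <;> (try simp only [star_mul]) <;> grind

theorem PI.add {v e f v' e' f' : A} (h : PI v e f) (k : PI v' e' f') (he : e' * e = 0)
    (hf : f' * f = 0) : PI (v + v') (e + e') (f + f') := by
  have hp := h.pe.add k.pe he
  have he2 := h.pe.swap0 k.pe he
  have hf2 := h.pf.swap0 k.pf hf
  obtain ⟨a1, a2, a3, a4, a5, a6, a7, a8⟩ := h
  obtain ⟨b1, b2, b3, b4, b5, b6, b7, b8⟩ := k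
  have c1 : star v * v' = 0 := sandwich hf2 a7 b6
  have c2 : star v' * v = 0 := sandwich hf b7 a6
  have c3 : v * star v' = 0 := sandwich he2 a5 b8
  have c4 : v' * star v = 0 := sandwich he b5 a8
  refine PI.mk2 ?_ hp.idem ?_
  · simp only [star_add, mul_add, add_mul, c1, c2, a1, b1]; simp
  · simp only [star_add, mul_add, add_mul, c3, c4, a2, b2]; simp

/-- central projections -/
structure Cn (z : A) : Prop where
  pj : Pj z
  c : ∀ a, z * a = a * z

theorem Cn.compl {z : A} (hz : Cn z) : Cn (1 - z) :=
  ⟨hz.pj.compl, fun a => by simp [sub_mul, mul_sub, hz.c a]⟩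
theorem Cn.one : Cn (1 : A) := ⟨.one, by simp⟩
theorem Cn.mul {z w : A} (hz : Cn z) (hw : Cn w) : Cn (z * w) :=
  ⟨hw.pj.mulc hz.pj (hz.c w), fun a => by have := hz.c a; have := hw.c a; grind⟩

theorem Cn.pjm {z e : A} (hz : Cn z) (he : Pj e) : Pj (z * e) := he.mulc hz.pj (hz.c e)

theorem PI.cut {v e f z : A} (h : PI v e f) (hz : Cn z) : PI (z * v) (z * e) (z * f) := by
  have h1 := hz.pj.idem
  have h2 := hz.pj.sa
  have h3 := hz.c v
  have h4 := hz.c (star v)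
  have a1 := h.src
  have a2 := h.tgt
  have h6 := hz.c e
  have h7 := hz.c f
  refine PI.mk2 ?_ (hz.pjm h.pe).idem ?_ <;> simp only [star_mul] <;> grind

def Eqv (e f : A) : Prop := ∃ v, PI v e f
theorem Eqv.symm {e f : A} : Eqv e f → Eqv f e := fun ⟨v, h⟩ => ⟨_, h.symm⟩
theorem Eqv.trans {e f g : A} : Eqv e f → Eqv f g → Eqv e g := fun ⟨v, h⟩ ⟨w, k⟩ => ⟨_, h.trans k⟩
theorem Eqv.refl {e : A} (h : Pj e) : Eqv e e := ⟨_, .refl h⟩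
theorem Eqv.cut {e f z : A} (hz : Cn z) : Eqv e f → Eqv (z * e) (z * f) :=
  fun ⟨v, h⟩ => ⟨_, h.cut hz⟩
theorem Eqv.add {e f e' f' : A} (h : Eqv e f) (k : Eqv e' f') (he : e' * e = 0)
    (hf : f' * f = 0) : Eqv (e + e') (f + f') := by
  obtain ⟨v, h⟩ := h
  obtain ⟨w, k⟩ := k
  exact ⟨_, h.add k he hf⟩

/-- subequivalence -/
def Le (e f : A) : Prop := Pj f ∧ ∃ g, Eqv e g ∧ f * g = g

theorem Eqv.pl {e f : A} : Eqv e f → Pj e := fun ⟨v, h⟩ => h.pe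
theorem Eqv.pr {e f : A} : Eqv e f → Pj f := fun ⟨v, h⟩ => h.pf
theorem Eqv.le {e f : A} (h : Eqv e f) : Le e f := ⟨h.pr, f, h, h.pr.idem⟩
theorem Le.of_le {e f : A} (he : Pj e) (hf : Pj f) (h : f * e = e) : Le e f := ⟨hf, e, .refl he, h⟩

theorem Le.trans {e f g : A} (h : Le e f) (k : Le f g) : Le e g := by
  obtain ⟨pf, e', h1, h2⟩ := h
  obtain ⟨pg, f', ⟨v, h3⟩, h4⟩ := k
  refine ⟨pg, _, h1.trans ⟨_, h3.restr h1.pr h2⟩, ?_⟩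
  have := h3.vl
  grind

theorem Le.cut {e f z : A} (hz : Cn z) (h : Le e f) : Le (z * e) (z * f) := by
  obtain ⟨pf, e', h1, h2⟩ := h
  refine ⟨hz.pjm pf, _, h1.cut hz, ?_⟩
  have := hz.c f
  have := hz.c e'
  have := hz.pj.idem
  grind

theorem Le.add {e f e' f' : A} (h : Le e f) (k : Le e' f') (he : e' * e = 0)
    (hf : f' * f = 0) : Le (e + e') (f + f') := by
  obtain ⟨pf, g, h1, h2⟩ := h
  obtain ⟨pf', g', h1', h2'⟩ := k
  have hff := pf.swap0 pf' hf
  have q1 : f * g' = 0 := sandwich hff pf.idem h2'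
  have q2 : f' * g = 0 := sandwich hf pf'.idem h2
  refine ⟨pf.add pf' hf, g + g', h1.add h1' he ?_, ?_⟩
  · have := (h1'.pr).swap pf' h2'
    exact sandwich hf this h2
  · simp only [mul_add, add_mul, q1, q2, h2, h2']; simp

/-- support -/
structure Supp (x e : A) : Prop where
  pj : Pj e
  op : ∀ a, e * a = 0 ↔ x * a = 0

theorem exists_supp (x : A) : ∃ e, Supp x e := by
  obtain ⟨e, h1, h2, h3⟩ := VNR.baer ({x} : Set A)
  exact ⟨e, ⟨h1, h2⟩, by simpa using h3⟩

theorem Supp.mul_self {x e : A} (h : Supp x e) : x * e = x := by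
  have := (h.op (1 - e)).1 (by simp [mul_sub, h.pj.idem])
  rwa [h.pj.ks'] at this

theorem Supp.le {x e f : A} (h : Supp x e) (hf : Pj f) (hx : x * f = x) : f * e = e := by
  have := (h.op (1 - f)).2 (by rw [mul_sub, mul_one, hx, sub_self])
  rw [hf.ks'] at this
  exact h.pj.swap' hf this

/-- polar decomposition -/
theorem polar {x h e f : A} (he : Supp x e) (hf : Supp (star x) f) (hs : star h = h)
    (hh : h * h = star x * x) : ∃ v, PI v e f ∧ v * h = x ∧ e * h = h ∧ h * e = h := by
  obtain ⟨v, h1, h2⟩ := VNR.polar x h hs hh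
  have k : ∀ a, h * a = 0 ↔ x * a = 0 := by
    intro a
    constructor
    · intro ha
      rw [← h1, mul_assoc, ha, mul_zero]
    · intro ha
      apply VNR.proper
      rw [star_mul, hs, mul_assoc, ← mul_assoc h, hh, mul_assoc, ha]
      simp
  have hE : Supp h e := ⟨he.pj, fun a => (he.op a).trans (k a).symm⟩
  have he1 := hE.mul_self
  have he2 : e * h = h := by have := st he1; rwa [hs, he.pj.sa] at this
  have hve : v * e = v := by
    have := h2 (1 - e) (by rw [mul_sub, he1]; simp)
    rwa [he.pj.ks'] at this
  have hve' : e * star v = star v := by have := st hve; rwa [he.pj.sa] at this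
  have T : star v * v = e := by
    have t1 : h * ((star v * v - e) * h) = 0 := by
      have : h * (star v * v) * h = star x * x := by rw [← h1]; simp [mul_assoc, hs]
      rw [sub_mul, mul_sub, he2, hh]
      rw [← mul_assoc, this, sub_self]
    have t2 := (hE.op _).2 t1
    have t3 : (star v * v - e) * h = 0 := by
      rw [← t2]
      have := he.pj.idem
      simp only [mul_sub, sub_mul]
      grind
    have t4 : h * (star v * v - e) = 0 := by
      have := st t3
      simpa [hs, he.pj.sa] using this
    have t5 := (hE.op _).2 t4
    rw [mul_sub, he.pj.idem, ← mul_assoc, hve', sub_eq_zero] at t5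
    exact t5
  refine ⟨v, PI.mk2 T he.pj.idem ?_, h1, he2, he1⟩
  have P := PI.mk' T he.pj.idem
  -- range projection
  have R : Supp (star x) (v * star v) := by
    refine ⟨P.pf, fun a => ?_⟩
    have hx : star x = h * star v := by rw [← h1, star_mul, hs]
    rw [hx]
    constructor
    · intro ha
      calc h * star v * a = h * (star v * (v * star v)) * a := by rw [P.sr]
        _ = h * star v * (v * star v * a) := by simp only [mul_assoc]
        _ = 0 := by rw [ha, mul_zero]
    · intro ha
      rw [mul_assoc] at ha
      have := (hE.op _).2 ha
      rw [← mul_assoc, hve'] at this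
      rw [mul_assoc, this, mul_zero]
  have a1 := R.mul_self
  have a2 := hf.mul_self
  have b1 := hf.le R.pj a1
  have b2 := R.le hf.pj a2
  have b3 := hf.pj.swap R.pj b1
  rw [← b2, b3]

theorem polar_eqv {x e f : A} (he : Supp x e) (hf : Supp (star x) f) : Eqv e f := by
  obtain ⟨h, h1, h2⟩ := VNR.sqrt x
  obtain ⟨v, h3, _⟩ := polar he hf h1 h2
  exact ⟨v, h3⟩

/-- meet of g with the complement of h -/
structure Mt (g h m : A) : Prop where
  pj : Pj m
  gm : g * m = m
  hm : h * m = 0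
  univ : ∀ a, g * a = a → h * a = 0 → m * a = a

theorem exists_mt {g : A} (h : A) (hg : Pj g) : ∃ m, Mt g h m := by
  obtain ⟨e, h1, h2, h3⟩ := VNR.baer ({1 - g, h} : Set A)
  have he : Pj e := ⟨h1, h2⟩
  have h4 := (h3 (1 - e)).1 (by rw [mul_sub, h1]; simp)
  have h5 := h4 (1 - g) (by simp)
  have h6 := h4 h (by simp)
  rw [hg.ks] at h5
  refine ⟨1 - e, he.compl, h5, h6, fun a ha hb => ?_⟩
  have := (h3 a).2 (by simp [sub_mul, ha, hb])
  rw [sub_mul, this]; simp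

theorem Mt.supp {g h m : A} (hg : Pj g) (H : Mt g h m) : Supp (h * g) (g - m) := by
  have hmg := H.pj.swap hg H.gm
  refine ⟨H.pj.sub hg H.gm, fun a => ?_⟩
  rw [sub_mul, sub_eq_zero]
  constructor
  · intro ha
    rw [mul_assoc, ha, ← mul_assoc, H.hm, zero_mul]
  · intro ha
    have := H.univ (g * a) (by rw [← mul_assoc, hg.idem]) (by rw [← mul_assoc, ha])
    rw [← mul_assoc, hmg] at this
    exact this.symm

theorem parallelogram {g h m n : A} (hg : Pj g) (hh : Pj h) (H : Mt g h m) (K : Mt h g n) :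
    Eqv (g - m) (h - n) := by
  apply polar_eqv (H.supp hg)
  have := K.supp hh
  rwa [star_mul, hg.sa, hh.sa]

end alg
end UO

namespace UO
section alg2
variable {A : Type*} [Ring A] [StarRing A] [VNR A]

theorem le_of_sandwich {e g : A} (he : Pj e) (hg : Pj g) (h : e * g * e = e) : g * e = e := by
  have : (1 - g) * e = 0 := by
    apply VNR.proper
    have h1 := he.idem
    have h2 := hg.idem
    simp only [star_mul, star_sub, star_one, he.sa, hg.sa]
    simp only [mul_sub, sub_mul, mul_one, one_mul]
    grind
  rwa [hg.ks] at this

/-- extension order for partial isometries -/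
def Ext (v w : A) : Prop := w * (star v * v) = v

theorem Ext.le {v w : A} (hv : v * star v * v = v) (hw : w * star w * w = w) (h : Ext v w) :
    (star w * w) * (star v * v) = star v * v := by
  have pv := (PI.of hv).pe
  have pw := (PI.of hw).pe
  unfold Ext at h
  apply le_of_sandwich pv pw
  have := st h
  rw [pv.sa] at this
  calc star v * v * (star w * w) * (star v * v)
      = (star v * v * star w) * (w * (star v * v)) := by simp only [mul_assoc]
    _ = star v * v := by rw [h, this]

theorem Ext.trans {u v w : A} (hu : u * star u * u = u) (hv : v * star v * v = v)
    (hw : w * star w * w = w) (h : Ext u v) (k : Ext v w) : Ext u w := by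
  have h1 := h.le hu hv
  unfold Ext at *
  calc w * (star u * u) = w * (star v * v * (star u * u)) := by rw [h1]
    _ = (w * (star v * v)) * (star u * u) := by simp only [mul_assoc]
    _ = u := by rw [k, h]

theorem exists_max (e f : A) : ∃ v : A, v * star v * v = v ∧ f * v = v ∧ v * e = v ∧
    ∀ w, w * star w * w = w → f * w = w → w * e = w → Ext v w → Ext w v := by
  obtain ⟨⟨v, h1, h2, h3⟩, h⟩ := exists_maximal_of_chains_bounded
    (α := {v : A // v * star v * v = v ∧ f * v = v ∧ v * e = v}) (r := fun v w => Ext v.1 w.1)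
    (by
      intro c hc
      rcases c.eq_empty_or_nonempty with rfl | hne
      · exact ⟨⟨0, by simp⟩, by simp⟩
      obtain ⟨v, a1, a2, a3, a4⟩ := VNR.chain (Subtype.val '' c) (hne.image _)
        (by rintro _ ⟨w, hw, rfl⟩; exact w.2.1)
        (by
          rintro _ ⟨v, hv, rfl⟩ _ ⟨w, hw, rfl⟩
          by_cases hvw : v = w
          · left; subst hvw; rw [← mul_assoc]; exact v.2.1
          · exact hc hv hw hvw)
      refine ⟨⟨v, a1, ?_, ?_⟩, fun w hw => a2 _ ⟨w, hw, rfl⟩⟩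
      · have := a3 (f - 1) (by rintro _ ⟨w, hw, rfl⟩; rw [sub_mul, w.2.2.1, one_mul, sub_self])
        rwa [sub_mul, one_mul, sub_eq_zero] at this
      · have := a4 (e - 1) (by rintro _ ⟨w, hw, rfl⟩; rw [mul_sub, w.2.2.2, mul_one, sub_self])
        rwa [mul_sub, mul_one, sub_eq_zero] at this)
    (by rintro ⟨a, ha⟩ ⟨b, hb⟩ ⟨c, hc⟩ h1 h2; exact h1.trans ha.1 hb.1 hc.1 h2)
  exact ⟨v, h1, h2, h3, fun w k1 k2 k3 => h ⟨w, k1, k2, k3⟩⟩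

theorem PI.out {v e f : A} (h : PI v e f) : v * star v * v = v := by rw [h.tgt, h.vl]

theorem Cn.of_left {z : A} (hz : Pj z) (h : ∀ b, z * b * (1 - z) = 0) : Cn z := by
  refine ⟨hz, fun b => ?_⟩
  have h1 : ∀ b, z * b = z * b * z := fun b => by
    have := h b
    rwa [mul_sub, mul_one, sub_eq_zero] at this
  have h2 := st (h1 (star b)).symm
  have h3 := h1 b
  simp only [star_mul, star_star, hz.sa] at h2
  rw [h3, ← h2, mul_assoc]

theorem gc {e f : A} (he : Pj e) (hf : Pj f) :
    ∃ z, Cn z ∧ Le (z * e) (z * f) ∧ Le ((1 - z) * f) ((1 - z) * e) := by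
  obtain ⟨v, h1, h2, h3, hmax⟩ := exists_max e f
  have P := PI.of h1
  set e1 := star v * v with he1
  set f1 := v * star v with hf1
  have le1 : e * e1 = e1 := by
    have := st h3; rw [he.sa] at this; rw [he1, ← mul_assoc, this]
  have le2 : f * f1 = f1 := by rw [hf1, ← mul_assoc, h2]
  have pe' : Pj (e - e1) := P.pe.sub he le1
  have pf' : Pj (f - f1) := P.pf.sub hf le2
  have key : ∀ m, (f - f1) * m * (e - e1) = 0 := by
    intro m
    set x := (f - f1) * m * (e - e1) with hx
    obtain ⟨a, ha⟩ := exists_supp x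
    obtain ⟨b, hb⟩ := exists_supp (star x)
    obtain ⟨w, hw⟩ := polar_eqv ha hb
    have la : (e - e1) * a = a := ha.le pe' (by rw [hx, mul_assoc, pe'.idem])
    have lb : (f - f1) * b = b := hb.le pf' (by
      rw [hx]; simp only [star_mul, pf'.sa, mul_assoc, pf'.idem])
    have o1 : a * e1 = 0 := by
      have := ha.pj.swap pe' la
      rw [← this, mul_assoc, sub_mul, le1, P.pe.idem, sub_self, mul_zero]
    have o2 : b * f1 = 0 := by
      have := hb.pj.swap pf' lb
      rw [← this, mul_assoc, sub_mul, le2, P.pf.idem, sub_self, mul_zero]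
    have Q := P.add hw o1 o2
    have e3 : e * a = a := by rw [← la, ← mul_assoc, mul_sub, he.idem, le1]
    have f3 : f * b = b := by rw [← lb, ← mul_assoc, mul_sub, hf.idem, le2]
    have := hmax (v + w) Q.out (by rw [mul_add, h2, ← hw.vl, ← mul_assoc, f3])
      (by rw [add_mul, h3]; rw [← hw.vr, mul_assoc, ha.pj.swap he e3])
      (by unfold Ext; rw [add_mul, ← he1, P.vr, ← hw.vr, mul_assoc, o1]; simp)
    unfold Ext at this
    rw [Q.src, mul_add, P.vr] at this
    have c : v * a = 0 := by
      rw [← P.vr, mul_assoc, P.pe.swap0 ha.pj o1, mul_zero]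
    rw [c, add_zero] at this
    have w0 : w = 0 := by simpa using this
    have a0 : a = 0 := by rw [← hw.src, w0]; simp
    have := ha.mul_self
    rw [a0, mul_zero] at this
    exact this.symm
  obtain ⟨s, s1, s2, s3⟩ := VNR.baer (Set.range fun m : A => (f - f1) * m)
  have ps : Pj s := ⟨s1, s2⟩
  have s4 : ∀ m, (f - f1) * m * (1 - s) = 0 := fun m =>
    (s3 (1 - s)).1 (by rw [mul_sub, s1]; simp) _ ⟨m, rfl⟩
  have s5 : s * (e - e1) = 0 := (s3 _).2 (by rintro _ ⟨m, rfl⟩; exact key m)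
  have hs : Cn s := Cn.of_left ps (fun b => by
    rw [mul_assoc, s3]
    rintro _ ⟨m, rfl⟩
    have := s4 (m * b)
    simpa only [mul_assoc] using this)
  have s6 : (1 - s) * (f - f1) = 0 := by
    have := s4 1
    rw [mul_one] at this
    rw [hs.compl.c, this]
  refine ⟨s, hs, ?_, ?_⟩
  · rw [mul_sub, sub_eq_zero] at s5
    rw [s5]
    exact (Eqv.cut hs ⟨v, P⟩).le.trans (Le.cut hs (Le.of_le P.pf hf le2))
  · rw [mul_sub, sub_eq_zero] at s6
    rw [s6]
    exact (Eqv.cut hs.compl ⟨_, P.symm⟩).le.trans (Le.cut hs.compl (Le.of_le P.pe he le1))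

/-- Schröder–Bernstein -/
theorem sb {e f : A} (h : Le e f) (k : Le f e) : Eqv e f := by
  obtain ⟨pf, f0, ⟨v, hv⟩, hf0⟩ := h
  obtain ⟨pe, e0, ⟨w, hw⟩, he0⟩ := k
  have fv : f * v = v := by rw [← hv.vl, ← mul_assoc, hf0]
  have ew : e * w = w := by rw [← hw.vl, ← mul_assoc, he0]
  have fv' := st fv
  have ew' := st ew
  rw [pf.sa] at fv'
  rw [pe.sa] at ew'
  set φ : A → A := fun x => e - w * (f - v * x * star v) * star w with hφ
  have ple : ∀ x y : A, Pj x → Pj y → e * x = x → y * x = x → e * y = y →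
      Pj (v * x * star v) ∧ f * (v * x * star v) = v * x * star v ∧
      (v * y * star v) * (v * x * star v) = v * x * star v := by
    intro x y hx hy h1 h2 h3
    have := (hv.restr hx h1).pf
    refine ⟨this, ?_, ?_⟩
    · simp only [← mul_assoc]; rw [fv]
    · have := hv.src
      have := hx.swap pe h1
      have := hy.swap pe h3
      grind
  have psub : ∀ x, Pj x → e * x = x → Pj (f - v * x * star v) ∧ Pj (φ x) ∧ e * φ x = φ x := by
    intro x hx h1
    obtain ⟨a1, a2, -⟩ := ple x x hx hx h1 hx.idem h1
    have p1 := a1.sub pf a2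
    have p2 := (hw.restr p1 (by rw [mul_sub, pf.idem, a2])).pf
    have p3 : e * (w * (f - v * x * star v) * star w) = w * (f - v * x * star v) * star w := by
      simp only [← mul_assoc]; rw [ew]
    exact ⟨p1, p2.sub pe p3, by simp only [hφ]; rw [mul_sub, pe.idem, p3]⟩
  have mono : ∀ x y : A, Pj x → Pj y → e * x = x → e * y = y → y * x = x → φ y * φ x = φ x := by
    intro x y hx hy h1 h2 h3
    obtain ⟨a1, a2, a3⟩ := ple x y hx hy h1 h3 h2
    obtain ⟨b1, b2, -⟩ := ple y y hy hy h2 hy.idem h2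
    obtain ⟨c1, c2, c3⟩ := psub x hx h1
    obtain ⟨d1, d2, d3⟩ := psub y hy h2
    simp only [hφ] at c3 d3 ⊢
    generalize v * x * star v = X at *
    generalize v * y * star v = Y at *
    have t1 := hw.src
    have a4 := a1.swap b1 a3
    have b4 := b1.swap pf b2
    have a5 := a1.swap pf a2
    have i1 := pf.idem
    have i2 := pe.idem
    have i3 := a1.idem
    have i4 := b1.idem
    have q1 : (f - Y) * (f - X) = f - Y := by
      simp only [mul_sub, sub_mul]
      have := b1.swap' a1
      rw [i1, a2, b4, a3]; abel
    have q2 : w * (f - Y) * star w * (w * (f - X) * star w) = w * (f - Y) * star w := by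
      have : star w * w * (f - X) = f - X := by rw [t1, mul_sub, i1, a2]
      calc w * (f - Y) * star w * (w * (f - X) * star w)
          = w * (f - Y) * (star w * w * (f - X)) * star w := by simp only [mul_assoc]
        _ = w * ((f - Y) * (f - X)) * star w := by rw [this]; simp only [mul_assoc]
        _ = _ := by rw [q1]
    have q3 : w * (f - Y) * star w * e = w * (f - Y) * star w := by
      rw [mul_assoc, ew']
    rw [sub_mul (e) _ (e - _), c3, mul_sub _ e, q2, q3, sub_self, sub_zero]
  obtain ⟨x0, r1, r2, r3⟩ := VNR.baer {x : A | Pj x ∧ e * x = x ∧ φ x * x = x}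
  have px : Pj x0 := ⟨r1, r2⟩
  have r4 : ∀ x, Pj x → e * x = x → φ x * x = x → x0 * x = x := fun x h1 h2 h3 => by
    have := (r3 (1 - x0)).1 (by rw [mul_sub, r1]; simp) x ⟨h1, h2, h3⟩
    rw [px.ks'] at this
    exact h1.swap' px this
  have r5 : ∀ y, Pj y → (∀ x, Pj x → e * x = x → φ x * x = x → y * x = x) → y * x0 = x0 := by
    intro y hy H
    have := (r3 (1 - y)).2 (by
      rintro x ⟨h1, h2, h3⟩
      rw [hy.ks']
      exact h1.swap hy (H x h1 h2 h3))
    rw [hy.ks'] at this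
    exact px.swap' hy this
  have ex0 : e * x0 = x0 := r5 e pe (fun x _ h _ => h)
  obtain ⟨g1, g2, g3⟩ := psub x0 px ex0
  have l1 : φ x0 * x0 = x0 := r5 _ g2 (fun x h1 h2 h3 => by
    have := mono x x0 h1 px h2 ex0 (r4 x h1 h2 h3)
    rw [← h3, ← mul_assoc, this])
  have l2 : x0 * φ x0 = φ x0 := r4 _ g2 g3 (mono _ _ px g2 ex0 g3 l1)
  have l3 : φ x0 = x0 := by rw [← l2]; exact px.swap g2 l1
  obtain ⟨a1, a2, -⟩ := ple x0 x0 px px ex0 px.idem ex0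
  have P1 := hv.restr px ex0
  have P2 := hw.restr g1 (by rw [mul_sub, pf.idem, a2])
  have eq1 : x0 + w * (f - v * x0 * star v) * star w = e := by
    have : e - w * (f - v * x0 * star v) * star w = x0 := l3
    rw [sub_eq_iff_eq_add] at this
    exact this.symm
  have o1 : (w * (f - v * x0 * star v) * star w) * x0 = 0 := by
    have : e * x0 = x0 := ex0
    rw [← eq1, add_mul, px.idem] at this
    simpa using this
  have o2 : (f - v * x0 * star v) * (v * x0 * star v) = 0 := by
    rw [sub_mul, a2, a1.idem, sub_self]
  have P3 := P1.add P2.symm o1 o2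
  rw [eq1] at P3
  exact ⟨_, by simpa using P3⟩

end alg2
end UO

namespace UO
section alg3
variable {A : Type*} [Ring A] [StarRing A] [VNR A]

def Halv (e : A) : Prop := ∃ f, e * f = f ∧ Eqv e f ∧ Eqv e (e - f)
def Fin' (e : A) : Prop := Pj e ∧ ∀ f, Eqv e f → e * f = f → f = e

theorem Halv.pj {e : A} : Halv e → Pj e := fun ⟨_, _, h, _⟩ => h.pl

theorem Halv.zero : Halv (0 : A) := ⟨0, by simp, .refl .zero, by simpa using Eqv.refl .zero⟩

theorem Halv.cut {e z : A} (hz : Cn z) (h : Halv e) : Halv (z * e) := by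
  obtain ⟨f, h1, h2, h3⟩ := h
  refine ⟨z * f, ?_, h2.cut hz, ?_⟩
  · have := hz.c f
    have := hz.c e
    have := hz.pj.idem
    grind
  · rw [← mul_sub]; exact h3.cut hz

theorem PI.conj {v e f g : A} (h : PI v e f) (hg : Pj g) (hge : e * g = g) :
    Eqv g (v * g * star v) := ⟨_, h.restr hg hge⟩

theorem Halv.eqv {e e' : A} (h : Halv e) (k : Eqv e e') : Halv e' := by
  obtain ⟨f, h1, h2, h3⟩ := h
  obtain ⟨v, hv⟩ := k
  refine ⟨v * f * star v, ?_, ?_, ?_⟩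
  · simp only [← mul_assoc]; rw [hv.vl]
  · exact (Eqv.symm ⟨v, hv⟩).trans (h2.trans (hv.conj h2.pr h1))
  · have := hv.conj h3.pr (by rw [mul_sub, h3.pl.idem, h1])
    rw [mul_sub, sub_mul, hv.vr, hv.tgt] at this
    exact (Eqv.symm ⟨v, hv⟩).trans (h3.trans this)

theorem Halv.le_add {e a b : A} (h : Halv e) (ha : Le a e) (hb : Le b e) (hab : b * a = 0) :
    Le (a + b) e := by
  obtain ⟨f, h1, h2, h3⟩ := h
  have := (ha.trans h2.le).add (hb.trans h3.le) hab (by rw [sub_mul, h1, h2.pr.idem, sub_self])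
  rwa [add_sub_cancel] at this

theorem Halv.add {e e' : A} (h : Halv e) (k : Halv e') (ho : e' * e = 0) : Halv (e + e') := by
  obtain ⟨f, h1, h2, h3⟩ := h
  obtain ⟨f', k1, k2, k3⟩ := k
  have ho' := h2.pl.swap0 k2.pl ho
  have a1 : e * f' = 0 := sandwich ho' h2.pl.idem k1
  have a2 : e' * f = 0 := sandwich ho k2.pl.idem h1
  have a3 : f' * f = 0 := sandwich ho (k2.pr.swap k2.pl k1) h1
  have a4 : f' * e = 0 := k2.pr.swap0 h2.pl a1
  refine ⟨f + f', ?_, h2.add k2 ho a3, ?_⟩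
  · simp only [mul_add, add_mul, a1, a2, h1, k1]; simp
  · rw [add_sub_add_comm]
    apply h3.add k3 ho
    simp only [mul_sub, sub_mul, ho, a2, a3, a4]; simp

section inf
variable (v g : A)
def yy (n : ℕ) : A := v ^ n * g
def WW (φ : ℕ → ℕ) (N : ℕ) : A := ∑ n ∈ Finset.range N, yy v g (φ n) * star (yy v g n)

variable {v g}

theorem yy_orth {e : A} (hv : star v * v = e) (hev : e * v = v) (he : Pj e) (hg : g = e - v * star v)
    (m n : ℕ) : star (yy v g m) * yy v g n = if m = n then g else 0 := by
  have P := PI.mk' hv he.idem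
  have pg : Pj g := by
    rw [hg]; exact P.pf.sub he (by rw [← mul_assoc, hev])
  have eg : e * g = g := by rw [hg, mul_sub, he.idem, ← mul_assoc, hev]
  have hev' := st hev
  rw [he.sa] at hev'
  have vg : star v * g = 0 := by rw [hg, mul_sub, hev', ← mul_assoc, hv, P.sl, sub_self]
  have gv : g * v = 0 := by have := st vg; rwa [pg.sa, star_star, star_zero] at this
  have ey : ∀ n, e * yy v g n = yy v g n := by
    intro n
    unfold yy
    cases n with
    | zero => simpa using eg
    | succ n => rw [pow_succ']; simp only [← mul_assoc]; rw [hev]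
  have ys : ∀ n, yy v g (n + 1) = v * yy v g n := fun n => by
    unfold yy; rw [pow_succ', mul_assoc]
  have y0 : yy v g 0 = g := by simp [yy]
  induction m generalizing n with
  | zero =>
    rw [y0, pg.sa]
    cases n with
    | zero => rw [y0, pg.idem]; simp
    | succ n => rw [ys, ← mul_assoc, gv]; simp
  | succ m ih =>
    rw [ys, star_mul]
    cases n with
    | zero => rw [y0, mul_assoc, vg]; simp
    | succ n =>
      rw [ys, mul_assoc, ← mul_assoc (star v), hv, ey, ih]; simp

theorem exists_halv_aux {e : A} (hv : star v * v = e) (hev : e * v = v) (he : Pj e)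
    (hg : g = e - v * star v) (φ : ℕ → ℕ) (hφ : Function.Injective φ) :
    ∃ V : A, V * star V * V = V ∧ (∀ k, V * yy v g k = yy v g (φ k)) ∧
      (∀ k, star V * V * yy v g k = yy v g k) ∧
      (∀ a, (∀ k, a * yy v g (φ k) = 0) → a * V = 0) ∧
      (∀ a, (∀ k, star (yy v g k) * a = 0) → V * a = 0) := by
  have O := yy_orth hv hev he hg
  have P := PI.mk' hv he.idem
  have pg : Pj g := by
    rw [hg]; exact P.pf.sub he (by rw [← mul_assoc, hev])
  have yg : ∀ k, yy v g k * g = yy v g k := fun k => by rw [yy, mul_assoc, pg.idem]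
  have a1 : ∀ N k, k < N → WW v g φ N * yy v g k = yy v g (φ k) := by
    intro N k hk
    unfold WW
    rw [Finset.sum_mul, Finset.sum_eq_single k]
    · rw [mul_assoc, O, if_pos rfl, yg]
    · intro b _ hb; rw [mul_assoc, O, if_neg hb, mul_zero]
    · intro h; simp at h; omega
  have a2 : ∀ N k, k < N → star (WW v g φ N) * yy v g (φ k) = yy v g k := by
    intro N k hk
    unfold WW
    rw [star_sum, Finset.sum_mul, Finset.sum_eq_single k]
    · rw [star_mul, star_star, mul_assoc, O, if_pos rfl, yg]
    · intro b _ hb; rw [star_mul, star_star, mul_assoc, O, if_neg (fun h => hb (hφ h)), mul_zero]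
    · intro h; simp at h; omega
  have a3 : ∀ N, star (WW v g φ N) * WW v g φ N =
      ∑ n ∈ Finset.range N, yy v g n * star (yy v g n) := by
    intro N
    conv_lhs => rw [WW]
    rw [← WW, WW.eq_def v g φ N, Finset.mul_sum]
    apply Finset.sum_congr rfl
    intro n hn
    rw [← mul_assoc, ← WW, a2 N n (by simpa using hn)]
  have a4 : ∀ N N', N ≤ N' → Ext (WW v g φ N) (WW v g φ N') := by
    intro N N' h
    unfold Ext
    rw [a3, Finset.mul_sum]
    conv_rhs => rw [WW]
    apply Finset.sum_congr rfl
    intro n hn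
    rw [← mul_assoc, a1 N' n (by simp at hn; omega)]
  have a5 : ∀ N k, k < N → star (WW v g φ N) * WW v g φ N * yy v g k = yy v g k := by
    intro N k hk
    rw [mul_assoc, a1 N k hk, a2 N k hk]
  have api : ∀ N, WW v g φ N * star (WW v g φ N) * WW v g φ N = WW v g φ N := fun N => by
    have := a4 N N le_rfl
    rw [mul_assoc]; exact this
  obtain ⟨V, b1, b2, b3, b4⟩ := VNR.chain (Set.range (WW v g φ)) (Set.range_nonempty _)
    (by rintro _ ⟨N, rfl⟩; exact api N)
    (by
      rintro _ ⟨N, rfl⟩ _ ⟨N', rfl⟩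
      rcases le_total N N' with h | h
      · left; exact a4 _ _ h
      · right; exact a4 _ _ h)
  refine ⟨V, b1, ?_, ?_, ?_, ?_⟩
  · intro k
    have := b2 _ ⟨k + 1, rfl⟩
    calc V * yy v g k = V * (star (WW v g φ (k+1)) * WW v g φ (k+1)) * yy v g k := by
          rw [mul_assoc, a5 _ k (by omega)]
      _ = yy v g (φ k) := by rw [this, a1 _ k (by omega)]
  · intro k
    have h1 : Ext (WW v g φ (k+1)) V := b2 _ ⟨k + 1, rfl⟩
    have := h1.le (api _) b1
    rw [← a5 (k+1) k (by omega), ← mul_assoc, this]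
  · intro a ha
    apply b3
    rintro _ ⟨N, rfl⟩
    unfold WW
    rw [Finset.mul_sum]
    exact Finset.sum_eq_zero fun n _ => by rw [← mul_assoc, ha, zero_mul]
  · intro a ha
    apply b4
    rintro _ ⟨N, rfl⟩
    unfold WW
    rw [Finset.sum_mul]
    exact Finset.sum_eq_zero fun n _ => by rw [mul_assoc, ha, mul_zero]

theorem exists_halv_of_inf {e : A} (he : Pj e) (h : ¬ Fin' e) :
    ∃ q : A, Halv q ∧ e * q = q ∧ q ≠ 0 := by
  unfold Fin' at h
  push Not at h
  obtain ⟨f, ⟨v, hvf⟩, hef, hne⟩ := h he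
  have hv := hvf.src
  have hev : e * v = v := by rw [← hvf.vl, ← mul_assoc, hef]
  obtain ⟨g, hg⟩ : ∃ g, g = e - v * star v := ⟨_, rfl⟩
  have O := yy_orth hv hev he hg
  have g0 : g ≠ 0 := by
    rw [hg, hvf.tgt]
    exact fun h => hne (sub_eq_zero.1 h).symm
  have eg : e * g = g := by rw [hg, mul_sub, he.idem, ← mul_assoc, hev]
  have ey : ∀ n, e * yy v g n = yy v g n := by
    intro n
    unfold yy
    cases n with
    | zero => simpa using eg
    | succ n => rw [pow_succ']; simp only [← mul_assoc]; rw [hev]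
  obtain ⟨V, a1, a2, a3, a4, a5⟩ := exists_halv_aux hv hev he hg (fun n => 2 * n)
    (fun a b h => by simpa using h)
  obtain ⟨W, b1, b2, b3, b4, b5⟩ := exists_halv_aux hv hev he hg (fun n => 2 * n + 1)
    (fun a b h => by simpa using h)
  have PV := PI.of a1
  have PW := PI.of b1
  have c1 : W * (star V * V) = W := by
    have := b5 (1 - star V * V) (fun k => by
      rw [PV.pe.ks']; have := st (a3 k); rwa [PV.pe.sa] at this)
    rwa [PV.pe.ks'] at this
  have c2 : V * (star W * W) = V := by
    have := a5 (1 - star W * W) (fun k => by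
      rw [PW.pe.ks']; have := st (b3 k); rwa [PW.pe.sa] at this)
    rwa [PW.pe.ks'] at this
  have c3 : star V * V = star W * W := by
    have d1 : star V * V * (star W * W) = star V * V := by rw [mul_assoc, c2]
    have d2 : star W * W * (star V * V) = star W * W := by rw [mul_assoc, c1]
    have := PW.pe.swap' PV.pe d2
    rw [← d1, this]
  have c4 : star V * W = 0 := by
    apply b4
    intro k
    have : star (yy v g (2 * k + 1)) * V = 0 := by
      apply a4
      intro l
      rw [O, if_neg (by omega)]
    have := st this
    simpa using this
  have c5 : star W * V = 0 := by have := st c4; simpa using this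
  have f1 : ∀ k, V * star V * yy v g (2 * k) = yy v g (2 * k) := fun k => by
    have h := a2 k
    rw [← h, ← mul_assoc, a1]
  have f2 : ∀ k, W * star W * yy v g (2 * k + 1) = yy v g (2 * k + 1) := fun k => by
    have h := b2 k
    rw [← h, ← mul_assoc, b1]
  have f3 : ∀ k, (V * star V + W * star W) * yy v g k = yy v g k := by
    intro k
    rcases Nat.even_or_odd' k with ⟨l, rfl | rfl⟩
    · have : star W * yy v g (2 * l) = 0 := by
        rw [← f1, mul_assoc V, ← mul_assoc (star W), c5, zero_mul]
      rw [add_mul, f1, mul_assoc W, this, mul_zero, add_zero]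
    · have : star V * yy v g (2 * l + 1) = 0 := by
        rw [← f2, mul_assoc W, ← mul_assoc (star V), c4, zero_mul]
      rw [add_mul, f2, mul_assoc V, this, mul_zero, zero_add]
  have c6 : star V * V * V = V := by
    have := a4 (1 - star V * V) (fun k => by rw [PV.pe.ks]; exact a3 _)
    rwa [PV.pe.ks] at this
  have c7 : star V * V * W = W := by
    have := b4 (1 - star V * V) (fun k => by rw [PV.pe.ks]; exact a3 _)
    rwa [PV.pe.ks] at this
  have o : W * star W * (V * star V) = 0 := by
    rw [mul_assoc, ← mul_assoc (star W), c5]; simp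
  have ps := PV.pf.add PW.pf o
  have c8 : V * (V * star V + W * star W) = V := by
    have := a5 (1 - (V * star V + W * star W)) (fun k => by
      rw [ps.ks']; have := st (f3 k); rwa [ps.sa] at this)
    rwa [ps.ks'] at this
  have c9 : V * star V + W * star W = star V * V := by
    have d1 : star V * V * (V * star V + W * star W) = V * star V + W * star W := by
      rw [mul_add, ← mul_assoc, c6, ← mul_assoc, c7]
    have d2 : star V * V * (V * star V + W * star W) = star V * V := by rw [mul_assoc, c8]
    rw [← d1, d2]
  refine ⟨star V * V, ⟨V * star V, ?_, ⟨V, PV⟩, ⟨W, ?_⟩⟩, ?_, ?_⟩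
  · rw [← mul_assoc, c6]
  · rw [← c9, add_sub_cancel_left, c9, c3]; exact PW
  · have : V * (1 - e) = 0 := a5 _ (fun k => by
      rw [he.ks']; have := st (ey k); rwa [he.sa] at this)
    rw [he.ks'] at this
    have := st this
    rw [he.sa] at this
    rw [← mul_assoc, this]
  · intro h
    have := a3 0
    rw [h, zero_mul] at this
    simp [yy] at this
    exact g0 this.symm
end inf

/-- pairs witnessing halvability -/
structure HP (e : A) (w : A × A) : Prop where
  p1 : w.1 * star w.1 * w.1 = w.1
  p2 : w.2 * star w.2 * w.2 = w.2
  s : star w.1 * w.1 = star w.2 * w.2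
  o : star w.1 * w.2 = 0
  t : w.1 * star w.1 + w.2 * star w.2 = star w.1 * w.1
  l : e * w.1 = w.1
  r : e * w.2 = w.2

theorem HP.halv {e : A} {w : A × A} (h : HP e w) : Halv (star w.1 * w.1) := by
  have P1 := PI.of h.p1
  have P2 := PI.of h.p2
  have o := h.o
  refine ⟨w.1 * star w.1, ?_, ⟨_, P1⟩, ⟨w.2, ?_⟩⟩
  · rw [← h.t, add_mul, P1.pf.idem]
    have : star w.2 * w.1 = 0 := by have := st o; simpa using this
    rw [mul_assoc w.2, ← mul_assoc (star w.2), this]; simp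
  · rw [← h.t, add_sub_cancel_left, h.t, h.s]; exact P2

theorem HP.of_halv {e q : A} (h : Halv q) (hq : e * q = q) : ∃ w, HP e w ∧ star w.1 * w.1 = q := by
  obtain ⟨f, h1, ⟨a, ha⟩, ⟨b, hb⟩⟩ := h
  refine ⟨(a, b), ⟨ha.out, hb.out, by simp [ha.src, hb.src], ?_, by simp [ha.tgt, hb.tgt, ha.src], ?_, ?_⟩, ha.src⟩
  · refine sandwich (x := f) (y := q - f) ?_ ha.sr hb.vl
    have := ha.pf.swap ha.pe h1
    rw [mul_sub, this, ha.pf.idem, sub_self]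
  · show e * a = a
    rw [← ha.vl, ← h1, ← mul_assoc, ← mul_assoc, hq]
  · show e * b = b
    rw [← hb.vl, ← mul_assoc, mul_sub, hq, ← h1, ← mul_assoc, hq]

theorem HP.add {e : A} {v w : A × A} (h : HP e v) (k : HP e w)
    (ho : star w.1 * w.1 * (star v.1 * v.1) = 0) : HP e (v + w) ∧ Ext v.1 (v.1 + w.1) ∧
      Ext v.2 (v.2 + w.2) ∧ star (v.1 + w.1) * (v.1 + w.1) = star v.1 * v.1 + star w.1 * w.1 := by
  have P1 := PI.of h.p1
  have P2 := PI.of h.p2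
  have Q1 := PI.of k.p1
  have Q2 := PI.of k.p2
  have hs := h.s
  have ks := k.s
  set q := star v.1 * v.1 with hq
  set r := star w.1 * w.1 with hr
  have l1 : q * v.1 = v.1 := by
    rw [hq, ← h.t, add_mul, P1.vl, mul_assoc]
    have : star v.2 * v.1 = 0 := by have := st h.o; simpa using this
    rw [this]; simp
  have l2 : q * v.2 = v.2 := by
    rw [hq, ← h.t, add_mul, P2.vl, mul_assoc, h.o]; simp
  have m1 : r * w.1 = w.1 := by
    rw [hr, ← k.t, add_mul, Q1.vl, mul_assoc]
    have : star w.2 * w.1 = 0 := by have := st k.o; simpa using this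
    rw [this]; simp
  have m2 : r * w.2 = w.2 := by
    rw [hr, ← k.t, add_mul, Q2.vl, mul_assoc, k.o]; simp
  have l1' := st l1
  have l2' := st l2
  have m1' := st m1
  have m2' := st m2
  rw [P1.pe.sa] at l1' l2'
  rw [Q1.pe.sa] at m1' m2'
  have ho' := P1.pe.swap0 Q1.pe ho
  have R1 := P1.add Q1 ho (by
    rw [mul_assoc, ← mul_assoc (star w.1), sandwich ho m1' l1]; simp)
  rw [← hs] at P2
  rw [← ks] at Q2
  have R2 := P2.add Q2 ho (by
    rw [mul_assoc, ← mul_assoc (star w.2), sandwich ho m2' l2]; simp)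
  refine ⟨⟨R1.out, R2.out, ?_, ?_, ?_, ?_, ?_⟩, ?_, ?_, R1.src⟩
  · exact R1.src.trans R2.src.symm
  · show star (v.1 + w.1) * (v.2 + w.2) = 0
    rw [star_add, add_mul, mul_add, mul_add, h.o, k.o, sandwich ho' l1' m2, sandwich ho m1' l2]
    simp
  · show (v.1 + w.1) * star (v.1 + w.1) + (v.2 + w.2) * star (v.2 + w.2) = star (v.1 + w.1) * (v.1 + w.1)
    rw [R1.src, R1.tgt, R2.tgt, hq, hr, ← h.t, ← k.t]; abel
  · show e * (v.1 + w.1) = v.1 + w.1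
    rw [mul_add, h.l, k.l]
  · show e * (v.2 + w.2) = v.2 + w.2
    rw [mul_add, h.r, k.r]
  · unfold Ext; rw [← hq, add_mul, P1.vr, sandwich ho Q1.vr P1.pe.idem, add_zero]
  · unfold Ext; rw [← hs, add_mul, P2.vr, sandwich ho Q2.vr P1.pe.idem, add_zero]

theorem HP.chain {e : A} (c : Set (A × A)) (hne : c.Nonempty) (hc : ∀ w ∈ c, HP e w)
    (hch : ∀ v ∈ c, ∀ w ∈ c, (Ext v.1 w.1 ∧ Ext v.2 w.2) ∨ (Ext w.1 v.1 ∧ Ext w.2 v.2)) :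
    ∃ v, HP e v ∧ ∀ w ∈ c, Ext w.1 v.1 ∧ Ext w.2 v.2 := by
  obtain ⟨V, a1, a2, a3, a4⟩ := VNR.chain (Prod.fst '' c) (hne.image _)
    (by rintro _ ⟨w, hw, rfl⟩; exact (hc w hw).p1)
    (by
      rintro _ ⟨v, hv, rfl⟩ _ ⟨w, hw, rfl⟩
      exact (hch v hv w hw).imp And.left And.left)
  obtain ⟨W, b1, b2, b3, b4⟩ := VNR.chain (Prod.snd '' c) (hne.image _)
    (by rintro _ ⟨w, hw, rfl⟩; exact (hc w hw).p2)
    (by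
      rintro _ ⟨v, hv, rfl⟩ _ ⟨w, hw, rfl⟩
      exact (hch v hv w hw).imp And.right And.right)
  have A2 : ∀ w ∈ c, Ext w.1 V := fun w hw => a2 _ ⟨w, hw, rfl⟩
  have B2 : ∀ w ∈ c, Ext w.2 W := fun w hw => b2 _ ⟨w, hw, rfl⟩
  have A3 : ∀ a, (∀ w ∈ c, a * w.1 = 0) → a * V = 0 := fun a h => a3 a (by
    rintro _ ⟨w, hw, rfl⟩; exact h w hw)
  have A4 : ∀ a, (∀ w ∈ c, w.1 * a = 0) → V * a = 0 := fun a h => a4 a (by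
    rintro _ ⟨w, hw, rfl⟩; exact h w hw)
  have B3 : ∀ a, (∀ w ∈ c, a * w.2 = 0) → a * W = 0 := fun a h => b3 a (by
    rintro _ ⟨w, hw, rfl⟩; exact h w hw)
  have B4 : ∀ a, (∀ w ∈ c, w.2 * a = 0) → W * a = 0 := fun a h => b4 a (by
    rintro _ ⟨w, hw, rfl⟩; exact h w hw)
  have PV := PI.of a1
  have PW := PI.of b1
  have L1 : ∀ w ∈ c, star V * V * (star w.1 * w.1) = star w.1 * w.1 :=
    fun w hw => (A2 w hw).le (hc w hw).p1 a1
  have L2 : ∀ w ∈ c, star W * W * (star w.1 * w.1) = star w.1 * w.1 :=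
    fun w hw => by rw [(hc w hw).s]; exact (B2 w hw).le (hc w hw).p2 b1
  have c1 : W * (star V * V) = W := by
    have := B4 (1 - star V * V) (fun w hw => by
      have P := PI.of (hc w hw).p2
      have h := L1 w hw
      have h' := (PI.of (hc w hw).p1).pe.swap PV.pe h
      rw [PV.pe.ks', ← P.vr, mul_assoc, ← (hc w hw).s, h'])
    rwa [PV.pe.ks'] at this
  have c2 : V * (star W * W) = V := by
    have := A4 (1 - star W * W) (fun w hw => by
      have P := PI.of (hc w hw).p1
      have h := L2 w hw
      have h' := (PI.of (hc w hw).p1).pe.swap PW.pe h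
      rw [PW.pe.ks', ← P.vr, mul_assoc, h'])
    rwa [PW.pe.ks'] at this
  have c3 : star V * V = star W * W := by
    have d1 : star V * V * (star W * W) = star V * V := by rw [mul_assoc, c2]
    have d2 : star W * W * (star V * V) = star W * W := by rw [mul_assoc, c1]
    have := PW.pe.swap' PV.pe d2
    rw [← d1, this]
  have ort : ∀ v ∈ c, ∀ w ∈ c, star v.1 * w.2 = 0 := by
    intro v hv w hw
    rcases hch v hv w hw with ⟨h, k⟩ | ⟨h, k⟩
    · have := st h
      rw [(PI.of (hc v hv).p1).pe.sa] at this
      rw [← this, mul_assoc, (hc w hw).o, mul_zero]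
    · rw [← k, ← mul_assoc, (hc v hv).o, zero_mul]
  have c4 : star V * W = 0 := by
    apply B3
    intro w hw
    have : star w.2 * V = 0 := by
      apply A3
      intro u hu
      have := st (ort u hu w hw)
      simpa using this
    have := st this
    simpa using this
  have c5 : star W * V = 0 := by have := st c4; simpa using this
  have o : W * star W * (V * star V) = 0 := by
    rw [mul_assoc, ← mul_assoc (star W), c5]; simp
  have ps := PV.pf.add PW.pf o
  have rl : ∀ w ∈ c, V * star V * w.1 = w.1 := fun w hw => by
    rw [← A2 w hw, ← mul_assoc, a1]
  have rr : ∀ w ∈ c, W * star W * w.2 = w.2 := fun w hw => by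
    rw [← B2 w hw, ← mul_assoc, b1]
  have f1 : ∀ w ∈ c, (V * star V + W * star W) * w.1 = w.1 := fun w hw => by
    rw [add_mul, rl w hw, ← rl w hw, mul_assoc V, ← mul_assoc (W * star W), mul_assoc W, c5]; simp
  have f2 : ∀ w ∈ c, (V * star V + W * star W) * w.2 = w.2 := fun w hw => by
    rw [add_mul, rr w hw, ← rr w hw, mul_assoc W, ← mul_assoc (V * star V), mul_assoc V, c4]; simp
  have q1 : ∀ w ∈ c, star V * V * w.1 = w.1 ∧ star V * V * w.2 = w.2 := fun w hw => by
    have h := L1 w hw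
    rw [← (hc w hw).t, mul_add] at h
    have o1 := (hc w hw).o
    have o2 := st o1
    simp only [star_star, star_zero] at o2
    have P1 := PI.of (hc w hw).p1
    have P2 := PI.of (hc w hw).p2
    constructor
    · have := congrArg (fun x => x * w.1) h
      simp only [add_mul, mul_assoc, o2, mul_zero, add_zero] at this
      simp only [← mul_assoc] at this
      rw [mul_assoc, mul_assoc, ← mul_assoc w.1, P1.vl] at this
      simpa [mul_assoc] using this
    · have := congrArg (fun x => x * w.2) h
      simp only [add_mul, mul_assoc, o1, mul_zero, zero_add] at this
      rw [← mul_assoc w.2, P2.vl] at this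
      simpa [mul_assoc] using this
  have c6 : star V * V * V = V := by
    have := A3 (1 - star V * V) (fun w hw => by rw [PV.pe.ks]; exact (q1 w hw).1)
    rwa [PV.pe.ks] at this
  have c7 : star V * V * W = W := by
    have := B3 (1 - star V * V) (fun w hw => by rw [PV.pe.ks]; exact (q1 w hw).2)
    rwa [PV.pe.ks] at this
  have c8 : V * (V * star V + W * star W) = V := by
    have := A4 (1 - (V * star V + W * star W)) (fun w hw => by
      have h1 := f1 w hw
      have h2 := f2 w hw
      generalize hF : V * star V + W * star W = F at *
      have P := PI.of (hc w hw).p1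
      have : F * (star w.1 * w.1) = star w.1 * w.1 := by
        rw [← (hc w hw).t, mul_add, ← mul_assoc, h1, ← mul_assoc, h2]
      have := P.pe.swap ps this
      rw [ps.ks', ← P.vr, mul_assoc, this])
    rwa [ps.ks'] at this
  have c9 : V * star V + W * star W = star V * V := by
    have d1 : star V * V * (V * star V + W * star W) = V * star V + W * star W := by
      rw [mul_add, ← mul_assoc, c6, ← mul_assoc, c7]
    have d2 : star V * V * (V * star V + W * star W) = star V * V := by rw [mul_assoc, c8]
    rw [← d1, d2]
  refine ⟨(V, W), ⟨a1, b1, c3, c4, c9, ?_, ?_⟩, fun w hw => ⟨A2 w hw, B2 w hw⟩⟩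
  · have := A3 (e - 1) (fun w hw => by rw [sub_mul, (hc w hw).l, one_mul, sub_self])
    rwa [sub_mul, one_mul, sub_eq_zero] at this
  · have := B3 (e - 1) (fun w hw => by rw [sub_mul, (hc w hw).r, one_mul, sub_self])
    rwa [sub_mul, one_mul, sub_eq_zero] at this

theorem exists_halv_fin {p : A} (hp : Pj p) : ∃ e, Halv e ∧ p * e = e ∧ Fin' (p - e) := by
  obtain ⟨⟨v, hv⟩, hmax⟩ := exists_maximal_of_chains_bounded
    (α := {v : A × A // HP p v}) (r := fun v w => Ext v.1.1 w.1.1 ∧ Ext v.1.2 w.1.2)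
    (by
      intro c hc
      rcases c.eq_empty_or_nonempty with rfl | hne
      · exact ⟨⟨0, by constructor <;> simp⟩, by simp⟩
      obtain ⟨v, a1, a2⟩ := HP.chain (e := p) (Subtype.val '' c) (hne.image _)
        (by rintro _ ⟨w, hw, rfl⟩; exact w.2)
        (by
          rintro _ ⟨v, hv, rfl⟩ _ ⟨w, hw, rfl⟩
          by_cases hvw : v = w
          · left; subst hvw; unfold Ext; rw [← mul_assoc, ← mul_assoc]; exact ⟨v.2.p1, v.2.p2⟩
          · exact hc hv hw hvw)
      exact ⟨⟨v, a1⟩, fun w hw => a2 _ ⟨w, hw, rfl⟩⟩)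
    (by
      rintro ⟨a, ha⟩ ⟨b, hb⟩ ⟨c, hc⟩ h1 h2
      exact ⟨h1.1.trans ha.p1 hb.p1 hc.p1 h2.1, h1.2.trans ha.p2 hb.p2 hc.p2 h2.2⟩)
  have hH := hv.halv
  have hle : p * (star v.1 * v.1) = star v.1 * v.1 := by
    rw [← hv.t, mul_add, ← mul_assoc, hv.l, ← mul_assoc, hv.r]
  refine ⟨_, hH, hle, ?_⟩
  by_contra hfin
  have pq := hH.pj.sub hp hle
  obtain ⟨q, q1, q2, q3⟩ := exists_halv_of_inf pq hfin
  have q4 : p * q = q := by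
    rw [← q2, ← mul_assoc, mul_sub, hp.idem, hle]
  obtain ⟨w, w1, w2⟩ := HP.of_halv q1 q4
  have ho : q * (star v.1 * v.1) = 0 := by
    rw [← q1.pj.swap pq q2, mul_assoc, sub_mul, hle, hH.pj.idem, sub_self, mul_zero]
  obtain ⟨k1, k2, k3, k4⟩ := hv.add w1 (by rw [w2]; exact ho)
  have := (hmax ⟨v + w, k1⟩ ⟨k2, k3⟩).1
  have h5 : v.1 * (star (v.1 + w.1) * (v.1 + w.1)) = v.1 + w.1 := this
  rw [k4, mul_add, (PI.of hv.p1).vr, w2, sandwich (hH.pj.swap0 q1.pj ho) (PI.of hv.p1).vr q1.pj.idem] at h5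
  have w0 : w.1 = 0 := by simpa using h5
  apply q3
  rw [← w2, w0]; simp

theorem Fin'.sub {e f : A} (hf : Fin' f) (he : Pj e) (h : f * e = e) : Fin' e := by
  refine ⟨he, fun g hg hge => ?_⟩
  have h' := he.swap hf.1 h
  have p := he.sub hf.1 h
  have E := hg.add (.refl p) (by rw [sub_mul, h, he.idem, sub_self])
    (by rw [← hge, ← mul_assoc, sub_mul, h, he.idem, sub_self, zero_mul])
  rw [add_sub_cancel] at E
  have := hf.2 _ E (by
    have : f * g = g := by rw [← hge, ← mul_assoc, h]
    rw [mul_add, this, mul_sub, hf.1.idem, h])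
  have h3 : g + (f - e) = f := this
  have h4 : g = f - (f - e) := eq_sub_of_add_eq h3
  rw [h4]; abel

theorem Fin'.eqv {e e' : A} (h : Fin' e) (k : Eqv e e') : Fin' e' := by
  refine ⟨k.pr, fun g hg hge => ?_⟩
  obtain ⟨v, hv⟩ := k
  have h1 := hv.symm.conj hg.pr hge
  rw [star_star] at h1
  have h2 := h.2 (star v * g * v) ((Eqv.trans ⟨v, hv⟩ hg).trans h1) (by
    simp only [← mul_assoc]; rw [hv.sl])
  have h3 := hg.pr.swap hv.pf hge
  calc g = (v * star v) * g * (v * star v) := by rw [hv.tgt, hge, h3]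
    _ = v * (star v * g * v) * star v := by simp only [mul_assoc]
    _ = e' := by rw [h2, hv.vr, hv.tgt]

theorem Fin'.halv {e : A} (h : Fin' e) (k : Halv e) : e = 0 := by
  obtain ⟨f, h1, h2, h3⟩ := k
  have a1 := h.2 _ h2 h1
  have a2 := h.2 _ h3 (by rw [mul_sub, h.1.idem, h1])
  rw [a1, sub_self] at a2
  exact a2.symm

/-- split into halvable and finite parts -/
theorem halv_fin_split {p : A} (hp : Pj p) : ∃ z, Cn z ∧ Halv (z * p) ∧ Fin' ((1 - z) * p) := by
  obtain ⟨e, h1, h2, h3⟩ := exists_halv_fin hp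
  obtain ⟨z, hz, k1, k2⟩ := gc h3.1 h1.pj
  have hep := h1.pj.swap hp h2
  refine ⟨z, hz, ?_, ?_⟩
  · have h4 := h1.cut hz
    have o : z * (p - e) * (z * e) = 0 := by
      rw [mul_assoc, ← mul_assoc (p - e), ← hz.c, mul_assoc, sub_mul, h2, h1.pj.idem]; simp
    have := h4.le_add (Le.of_le h4.pj h4.pj h4.pj.idem) k1 o
    rw [← mul_add, add_sub_cancel] at this
    have l2 : Le (z * e) (z * p) := Le.cut hz (Le.of_le h1.pj hp h2)
    exact h4.eqv (sb l2 this)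
  · have z' := hz.compl
    have h5 := h1.cut z'
    obtain ⟨pf, g, g1, g2⟩ := k2
    have f1 : Fin' ((1 - z) * (p - e)) := h3.sub (z'.pjm h3.1) (by
      rw [z'.c, ← mul_assoc, h3.1.idem])
    have f2 := (f1.sub g1.pr g2).eqv g1.symm
    have := f2.halv h5
    rw [mul_sub, this, sub_zero] at f1
    exact f1

theorem fin_cancel {p e f : A} (hp : Fin' p) (he : p * e = e) (hf : p * f = f) (h : Eqv e f) :
    Eqv (p - e) (p - f) := by
  have pe := h.pl.sub hp.1 he
  have pf := h.pr.sub hp.1 hf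
  have main : ∀ (z e f : A), Cn z → p * e = e → p * f = f → Eqv e f →
      Le (z * (p - e)) (z * (p - f)) → Eqv (z * (p - e)) (z * (p - f)) := by
    intro z e f hz he hf h hl
    obtain ⟨_, g, g1, g2⟩ := hl
    have fz : Fin' (z * p) := hp.sub (hz.pjm hp.1) (by rw [hz.c, ← mul_assoc, hp.1.idem])
    have hz' := hz.pj.idem
    have c1 := hz.c p
    have of : (z * f) * (z * (p - f)) = 0 := by
      have := h.pr.swap hp.1 hf
      rw [hz.c f, mul_assoc, ← mul_assoc z, hz', hz.c, ← mul_assoc, mul_sub, this, h.pr.idem]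
      simp
    have oe : z * (p - e) * (z * e) = 0 := by
      rw [mul_assoc, ← mul_assoc (p - e), ← hz.c, mul_assoc, sub_mul, he, h.pl.idem]; simp
    have og : g * (z * f) = 0 := by
      have : (z * f) * g = 0 := sandwich of (hz.pjm h.pr).idem g2
      exact g1.pr.swap0 (hz.pjm h.pr) this
    have E := (h.cut hz).add g1 oe og
    rw [← mul_add, add_sub_cancel] at E
    have zf : z * p * (z * f) = z * f := by
      have := hz.c f
      rw [mul_assoc, ← mul_assoc p, ← c1, mul_assoc, hf, ← mul_assoc, hz']
    have := fz.2 _ E (by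
      have : z * p * g = g := by
        rw [← g2, ← mul_assoc, mul_sub, mul_sub, fz.1.idem, zf]
      rw [mul_add, this, zf])
    have h3 : g = z * (p - f) := by rw [mul_sub, ← this]; abel
    rw [← h3]; exact g1
  obtain ⟨z, hz, k1, k2⟩ := gc pe pf
  have E1 := main z e f hz he hf h k1
  have E2 := (main (1 - z) f e hz.compl hf he h.symm k2).symm
  have oo : ∀ a b : A, (1 - z) * a * (z * b) = 0 := fun a b => by
    rw [mul_assoc, ← mul_assoc a, ← hz.c, ← mul_assoc, ← mul_assoc, sub_mul, hz.pj.idem]; simp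
  have := E1.add E2 (oo _ _) (oo _ _)
  simpa [sub_mul] using this

end alg3
end UO

namespace UO

section ord
variable {A : Type*} [CStarAlgebra A] [PartialOrder A] [StarOrderedRing A]

theorem sq_le_of_norm {x : A} {c : ℝ} (hx : ‖x‖ ≤ c) : star x * x ≤ algebraMap ℝ A (c ^ 2) := by
  have h := CStarAlgebra.star_mul_le_algebraMap_norm_sq (a := x)
  refine h.trans ?_
  have : (0:A) ≤ algebraMap ℝ A (c^2 - ‖x‖^2) := by
    rw [Algebra.algebraMap_eq_smul_one]
    exact smul_nonneg (by nlinarith [norm_nonneg x]) zero_le_one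
  rw [map_sub] at this
  exact sub_nonneg.mp this

theorem norm_of_sq_le {x : A} {c : ℝ} (hc : 0 ≤ c) (h : star x * x ≤ algebraMap ℝ A (c ^ 2)) : ‖x‖ ≤ c := by
  rw [← CStarAlgebra.norm_le_iff_le_algebraMap _ (by positivity) (star_mul_self_nonneg x)] at h
  rw [CStarRing.norm_star_mul_self] at h
  nlinarith [norm_nonneg x]

theorem algebraMap_mono_ord {c d : ℝ} (h : c ≤ d) : algebraMap ℝ A c ≤ algebraMap ℝ A d := by
  have : (0:A) ≤ algebraMap ℝ A (d - c) := by
    rw [Algebra.algebraMap_eq_smul_one]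
    exact smul_nonneg (by linarith) zero_le_one
  rw [map_sub] at this
  exact sub_nonneg.mp this

theorem Pj.nonneg {e : A} (he : Pj e) : 0 ≤ e := by
  have := star_mul_self_nonneg e
  rwa [he.sa, he.idem] at this

theorem Pj.le_one {e : A} (he : Pj e) : e ≤ 1 := by
  have := he.compl.nonneg
  exact sub_nonneg.mp this

theorem unit_of_ge {k : A} {c : ℝ} (hc : 0 < c) (h : algebraMap ℝ A c ≤ k) : IsUnit k := by
  refine CStarAlgebra.isUnit_of_le (algebraMap ℝ A c) h ?_
  rw [IsStrictlyPositive.iff_of_unital]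
  constructor
  · rw [Algebra.algebraMap_eq_smul_one]; exact smul_nonneg hc.le zero_le_one
  · exact (isUnit_iff_ne_zero.mpr hc.ne').map (algebraMap ℝ A)

end ord

section rng
variable {A : Type*} [Ring A]
theorem rid1 {P t : A} (i1 : P * P = P) (i2 : t * t = t) :
    P * (1 - t) * ((1 - t) * P) = P - P * t * P := by
  simp only [mul_sub, sub_mul, one_mul, mul_one]; grind
theorem rid2 {q r : A} (i1 : q * q = q) (i2 : r * r = r) :
    q * (1 - (r - q) * (r - q)) = q * r * q := by
  simp only [mul_sub, sub_mul, one_mul, mul_one]; grind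
theorem rid3 {q r : A} (i1 : q * q = q) (i2 : r * r = r) :
    (1 - (r - q) * (r - q)) * q = q * r * q := by
  simp only [mul_sub, sub_mul, one_mul, mul_one]; grind
theorem rid4 {q r : A} : 1 - (r - q) * (r - q) = 1 - (q - r) * (q - r) := by
  simp only [mul_sub, sub_mul, one_mul, mul_one]; abel
end rng

section cst
variable {A : Type*} [CStarAlgebra A]

theorem Pj.norm_le {e : A} (he : Pj e) : ‖e‖ ≤ 1 := by
  have := CStarRing.norm_star_mul_self (x := e)
  rw [he.sa, he.idem] at this
  nlinarith [norm_nonneg e]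

theorem norm_split {x e : A} {c : ℝ} (hc : 0 ≤ c) (he : Pj e) (h : e * (star x * x) = star x * x * e)
    (h1 : ‖x * e‖ ≤ c) (h2 : ‖x * (1 - e)‖ ≤ c) : ‖x‖ ≤ c := by
  letI := CStarAlgebra.spectralOrder A
  letI := CStarAlgebra.spectralOrderedRing A
  apply norm_of_sq_le hc
  have k1 := star_left_conjugate_le_conjugate (sq_le_of_norm h1) e
  have k2 := star_left_conjugate_le_conjugate (sq_le_of_norm h2) (1 - e)
  have k3 := add_le_add k1 k2
  have e1 : star e * (star (x * e) * (x * e)) * e + star (1 - e) * (star (x * (1 - e)) * (x * (1 - e))) * (1 - e)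
     = star x * x := by
    simp only [star_mul, star_sub, star_one, he.sa]
    have i1 := he.idem
    have i2 := he.compl.idem
    have : (1 - e) * (star x * x) = star x * x * (1 - e) := by rw [sub_mul, mul_sub, h]; simp
    have j1 : e * (e * star x * (x * e)) * e = star x * x * e := by
      calc _ = (e * e) * (star x * x) * (e * e) := by simp only [mul_assoc]
        _ = _ := by rw [i1, h, mul_assoc, i1]
    have j2 : (1 - e) * ((1 - e) * star x * (x * (1 - e))) * (1 - e) = star x * x * (1 - e) := by
      calc _ = ((1 - e) * (1 - e)) * (star x * x) * ((1 - e) * (1 - e)) := by simp only [mul_assoc]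
        _ = _ := by rw [i2, this, mul_assoc, i2]
    rw [j1, j2, ← mul_add]; simp
  have e2 : star e * algebraMap ℝ A (c ^ 2) * e + star (1 - e) * algebraMap ℝ A (c ^ 2) * (1 - e)
     = algebraMap ℝ A (c ^ 2) := by
    rw [star_sub, star_one, he.sa, Algebra.algebraMap_eq_smul_one]
    simp only [mul_smul_comm, smul_mul_assoc, mul_one, he.idem, he.compl.idem, ← smul_add]
    simp
  rwa [e1, e2] at k3

theorem norm_diff {P q : A} {c : ℝ} (hc : 0 ≤ c) (hP : Pj P) (hq : Pj q)
    (h1 : ‖(1 - q) * P‖ ≤ c) (h2 : ‖(1 - P) * q‖ ≤ c) : ‖P - q‖ ≤ c := by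
  have i1 := hP.idem
  have i2 := hq.idem
  apply norm_split hc hP
  · simp only [star_sub, hP.sa, hq.sa, mul_sub, sub_mul]
    grind
  · convert h1 using 2
    simp only [mul_sub, sub_mul, one_mul]; grind
  · rw [← norm_star] at h2
    rw [← norm_neg]
    have e : -((P - q) * (1 - P)) = star ((1 - P) * q) := by
      simp only [star_mul, star_sub, star_one, hP.sa, hq.sa, mul_sub, sub_mul, one_mul, mul_one]; grind
    rwa [e]

theorem lt_one {P t Y : A} (hP : Pj P) (ht : Pj t) (h : Y * t * P = P) : ‖(1 - t) * P‖ < 1 := by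
  letI := CStarAlgebra.spectralOrder A
  letI := CStarAlgebra.spectralOrderedRing A
  set C : ℝ := ‖Y‖ ^ 2 + 1 with hC
  have hC1 : 1 ≤ C := by nlinarith [sq_nonneg ‖Y‖]
  have i1 := hP.idem
  have i2 := ht.idem
  have k1 := star_left_conjugate_le_conjugate (sq_le_of_norm (le_refl ‖Y‖)) (t * P)
  have e1 : star (t * P) * (star Y * Y) * (t * P) = P := by
    have := st h
    simp only [star_mul, hP.sa, ht.sa] at this ⊢
    calc _ = (P * (t * star Y)) * (Y * t * P) := by simp only [mul_assoc]
      _ = _ := by rw [h, this, i1]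
  have e3 : star (t * P) * algebraMap ℝ A (‖Y‖ ^ 2) * (t * P) = (‖Y‖^2) • (P * t * P) := by
    rw [Algebra.algebraMap_eq_smul_one]
    simp only [star_mul, hP.sa, ht.sa, mul_smul_comm, smul_mul_assoc, mul_one]
    congr 1; grind
  have p0 : 0 ≤ P * t * P := by
    have := star_mul_self_nonneg (t * P)
    simp only [star_mul, hP.sa, ht.sa] at this
    convert this using 1; grind
  have k2 : P ≤ C • (P * t * P) := by
    rw [e1, e3] at k1
    rw [hC, add_smul, one_smul]
    exact k1.trans (le_add_of_nonneg_right p0)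
  have k3 : C⁻¹ • P ≤ P * t * P := by
    have := smul_le_smul_of_nonneg_left k2 (by positivity : 0 ≤ C⁻¹)
    rwa [smul_smul, inv_mul_cancel₀ (by positivity), one_smul] at this
  have k4 : star ((1 - t) * P) * ((1 - t) * P) ≤ algebraMap ℝ A ((Real.sqrt (1 - C⁻¹)) ^ 2) := by
    have : 0 ≤ 1 - C⁻¹ := by
      have := inv_le_one_of_one_le₀ hC1; linarith
    rw [Real.sq_sqrt this]
    calc star ((1 - t) * P) * ((1 - t) * P) = P - P * t * P := by
          simp only [star_mul, star_sub, star_one, hP.sa, ht.sa]; exact rid1 i1 i2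
      _ ≤ P - C⁻¹ • P := sub_le_sub_left k3 _
      _ = (1 - C⁻¹) • P := by rw [sub_smul, one_smul]
      _ ≤ (1 - C⁻¹) • (1 : A) := smul_le_smul_of_nonneg_left hP.le_one this
      _ = _ := by rw [Algebra.algebraMap_eq_smul_one]
  have k5 := norm_of_sq_le (Real.sqrt_nonneg _) k4
  refine k5.trans_lt ?_
  rw [Real.sqrt_lt' one_pos]
  have : 0 < C⁻¹ := by positivity
  linarith

/-- mutually inverse elements between corners -/
structure Iv (q r x y : A) : Prop where
  pq : Pj q
  pr : Pj r
  rx : r * x = x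
  xq : x * q = x
  qy : q * y = y
  yr : y * r = y
  yx : y * x = q
  xy : x * y = r

theorem Iv.symm {q r x y : A} (h : Iv q r x y) : Iv r q y x :=
  ⟨h.pr, h.pq, h.qy, h.yr, h.rx, h.xq, h.xy, h.yx⟩

theorem Iv.trans {q r s x y x' y' : A} (h : Iv q r x y) (k : Iv r s x' y') : Iv q s (x' * x) (y * y') := by
  obtain ⟨a1, a2, a3, a4, a5, a6, a7, a8⟩ := h
  obtain ⟨b1, b2, b3, b4, b5, b6, b7, b8⟩ := k
  constructor <;> first | assumption | grind

theorem Iv.uniq {q P P' x y y' : A} (h : Iv q P x y) (k : Iv q P' x y') : P = P' := by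
  have h1 : P * P' = P' := by rw [← k.xy, ← mul_assoc, h.rx]
  have h2 : P' * P = P := by rw [← h.xy, ← mul_assoc, k.rx]
  have := st h1
  rw [h.pr.sa, k.pr.sa, h2] at this
  exact this

theorem near_iff {q r : A} (hq : Pj q) (hr : Pj r) : ‖r - q‖ < 1 ↔ ∃ y, Iv q r (r * q) y := by
  have i1 := hq.idem
  have i2 := hr.idem
  constructor
  · intro h
    have hd : ‖(r - q) * (r - q)‖ < 1 := by
      refine (norm_mul_le _ _).trans_lt ?_
      nlinarith [norm_nonneg (r - q)]
    obtain ⟨u, hu⟩ := isUnit_one_sub_of_norm_lt_one hd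
    have q1 : q * u = q * r * q := by rw [hu, rid2 i1 i2]
    have q2 : u * q = q * r * q := by rw [hu, rid3 i1 i2]
    have q3 : r * u = r * q * r := by rw [hu, rid4, rid2 i2 i1]
    have q4 : u * r = r * q * r := by rw [hu, rid4, rid3 i2 i1]
    have c1 : (↑u⁻¹ : A) * q = q * ↑u⁻¹ := by
      rw [Units.inv_mul_eq_iff_eq_mul, ← mul_assoc, ← sub_eq_zero]
      rw [q2, ← q1, mul_assoc, Units.mul_inv, mul_one, sub_self]
    have c2 : (↑u⁻¹ : A) * r = r * ↑u⁻¹ := by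
      rw [Units.inv_mul_eq_iff_eq_mul, ← mul_assoc, ← sub_eq_zero]
      rw [q4, ← q3, mul_assoc, Units.mul_inv, mul_one, sub_self]
    have w1 := u.inv_mul
    have w2 := u.mul_inv
    generalize (↑u⁻¹ : A) = k at *
    generalize (↑u : A) = v at *
    refine ⟨k * q * r, hq, hr, ?_, ?_, ?_, ?_, ?_, ?_⟩
    · grind
    · grind
    · grind
    · grind
    · calc k * q * r * (r * q) = k * (q * r * q) := by grind
        _ = k * v * q := by rw [← q2, mul_assoc]
        _ = q := by rw [w1, one_mul]
    · calc r * q * (k * q * r) = k * (r * q * r) := by grind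
        _ = k * v * r := by rw [← q4, mul_assoc]
        _ = r := by rw [w1, one_mul]
  · rintro ⟨y, -, -, a3, a4, a5, a6, a7, a8⟩
    have l1 := lt_one (Y := y) hq hr (by rw [mul_assoc, a7])
    have l2 := lt_one (Y := star y) hr hq (by
      have := st a8
      simpa [hr.sa, hq.sa, mul_assoc] using this)
    have := norm_diff (c := max ‖(1 - r) * q‖ ‖(1 - q) * r‖) (by positivity) hr hq (le_max_right _ _) (le_max_left _ _)
    exact this.trans_lt (max_lt l1 l2)

theorem near_of {q r P ξ B y : A} (h : Iv q P ξ B) (k : Iv q r (r * ξ) y) : ‖r - P‖ < 1 := by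
  rw [near_iff h.pr k.pr]
  have := h.symm.trans k
  rw [mul_assoc, h.xy] at this
  exact ⟨_, this⟩

/-- Gram element -/
noncomputable def KK (q ξ : A) : A := star ξ * ξ + (1 - q)
/-- range projection of an element bounded below on q -/
noncomputable def PP (q ξ : A) : A := ξ * (Ring.inverse (KK q ξ) * star ξ)

theorem KK_unit {q ξ L : A} (hq : Pj q) (h1 : ξ * q = ξ) (h2 : L * ξ = q) : IsUnit (KK q ξ) := by
  letI := CStarAlgebra.spectralOrder A
  letI := CStarAlgebra.spectralOrderedRing A
  set C : ℝ := ‖L‖ ^ 2 + 1 with hC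
  have hC1 : 1 ≤ C := by nlinarith [sq_nonneg ‖L‖]
  have k1 := star_left_conjugate_le_conjugate (sq_le_of_norm (le_refl ‖L‖)) ξ
  have e1 : star ξ * (star L * L) * ξ = q := by
    have := st h2
    rw [hq.sa] at this
    calc _ = (star ξ * star L) * (L * ξ) := by simp only [mul_assoc]
      _ = q := by rw [this, h2, hq.idem]
  have e2 : star ξ * algebraMap ℝ A (‖L‖ ^ 2) * ξ = (‖L‖^2) • (star ξ * ξ) := by
    rw [Algebra.algebraMap_eq_smul_one]; simp
  rw [e1, e2] at k1
  have p0 : 0 ≤ star ξ * ξ := star_mul_self_nonneg ξ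
  have k2 : q ≤ C • (star ξ * ξ) := by
    rw [hC, add_smul, one_smul]
    exact k1.trans (le_add_of_nonneg_right p0)
  have k3 : 1 - q ≤ C • (1 - q) := by
    rw [hC, add_smul, one_smul]
    exact le_add_of_nonneg_left (smul_nonneg (by positivity) hq.compl.nonneg)
  have k4 : (1:A) ≤ C • KK q ξ := by
    have := add_le_add k2 k3
    rw [← smul_add] at this
    simpa [KK] using this
  apply unit_of_ge (c := C⁻¹) (by positivity)
  have := smul_le_smul_of_nonneg_left k4 (by positivity : 0 ≤ C⁻¹)
  rwa [smul_smul, inv_mul_cancel₀ (by positivity), one_smul, ← Algebra.algebraMap_eq_smul_one] at this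

theorem PP_spec {q ξ L : A} (hq : Pj q) (h1 : ξ * q = ξ) (h2 : L * ξ = q) :
    ∃ B, Iv q (PP q ξ) ξ B := by
  obtain ⟨u, hu⟩ := KK_unit hq h1 h2
  have h1' := st h1
  rw [hq.sa] at h1'
  have i1 := hq.idem
  have q1 : q * u = star ξ * ξ := by
    rw [hu, KK]; simp only [mul_sub, mul_add, mul_one]; grind
  have q2 : u * q = star ξ * ξ := by
    rw [hu, KK, add_mul, sub_mul, one_mul, i1, mul_assoc, h1, sub_self, add_zero]
  have su : star (u : A) = u := by
    rw [hu, KK]; simp [hq.sa]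
  have c1 : (↑u⁻¹ : A) * q = q * ↑u⁻¹ := by
    rw [Units.inv_mul_eq_iff_eq_mul, ← mul_assoc, ← sub_eq_zero]
    rw [q2, ← q1, mul_assoc, Units.mul_inv, mul_one, sub_self]
  have w1 := u.inv_mul
  have w2 := u.mul_inv
  have sk : star (↑u⁻¹ : A) = ↑u⁻¹ := by
    have := st w2
    rw [star_one, su] at this
    rw [← Units.mul_eq_one_iff_eq_inv]; exact this
  have hP : PP q ξ = ξ * (↑u⁻¹ * star ξ) := by
    rw [PP, ← hu, Ring.inverse_unit]
  generalize (↑u⁻¹ : A) = k at *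
  generalize (↑u : A) = v at *
  clear hu
  have e : k * (star ξ * ξ) = q := by rw [← q2, ← mul_assoc, w1, one_mul]
  refine ⟨k * star ξ, hq, ⟨?_, ?_⟩, ?_, h1, ?_, ?_, ?_, ?_⟩
  · rw [hP]; grind
  · rw [hP]; simp [sk, mul_assoc]
  · rw [hP]; grind
  · rw [← mul_assoc, ← c1, mul_assoc, h1']
  · rw [hP]
    calc k * star ξ * (ξ * (k * star ξ)) = (k * (star ξ * ξ)) * k * star ξ := by simp only [mul_assoc]
      _ = _ := by rw [e, ← c1, mul_assoc, h1']
  · rw [mul_assoc, e]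
  · rw [hP]

theorem PP_eq {q ξ P B : A} (h : Iv q P ξ B) : PP q ξ = P := by
  obtain ⟨B', h'⟩ := PP_spec h.pq h.xq h.yx
  exact h'.uniq h

theorem PP_cont {T : Type*} [TopologicalSpace T] {q ξ : T → A} (cq : Continuous q) (cx : Continuous ξ)
    (h : ∀ t, ∃ L, Pj (q t) ∧ ξ t * q t = ξ t ∧ L * ξ t = q t) : Continuous fun t => PP (q t) (ξ t) := by
  unfold PP
  have : Continuous fun t => Ring.inverse (KK (q t) (ξ t)) := by
    rw [continuous_iff_continuousAt]
    intro t
    obtain ⟨L, h0, h1, h2⟩ := h t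
    obtain ⟨u, hu⟩ := KK_unit h0 h1 h2
    have k := NormedRing.inverse_continuousAt u
    rw [hu] at k
    have c : Continuous fun t => KK (q t) (ξ t) := by unfold KK; fun_prop
    exact ContinuousAt.comp (g := Ring.inverse) (f := fun t => KK (q t) (ξ t)) k c.continuousAt
  fun_prop

theorem left_inv_of_close {q ξ : A} (hq : Pj q) (h1 : ξ * q = ξ) (h : ‖ξ - q‖ < 1) : ∃ L, L * ξ = q := by
  obtain ⟨u, hu⟩ := isUnit_one_sub_of_norm_lt_one (x := q - ξ) (by rwa [norm_sub_rev])
  refine ⟨↑u⁻¹, ?_⟩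
  rw [Units.inv_mul_eq_iff_eq_mul, hu]
  simp only [sub_mul, one_mul, hq.idem, h1]; abel

theorem Iv.close {q P ξ B : A} (h : Iv q P ξ B) {δ : ℝ} (hδ : δ ≤ 1/2) (hx : ‖ξ - q‖ ≤ δ) : ‖P - q‖ ≤ 2 * δ := by
  have h0 : 0 ≤ δ := (norm_nonneg _).trans hx
  have hB : ‖B‖ ≤ 2 := by
    have e : B = P + (q - ξ) * B := by rw [sub_mul, h.qy, h.xy]; abel
    have : ‖B‖ ≤ 1 + δ * ‖B‖ := by
      calc ‖B‖ = ‖P + (q - ξ) * B‖ := by rw [← e]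
        _ ≤ ‖P‖ + ‖(q - ξ)‖ * ‖B‖ := (norm_add_le _ _).trans (by gcongr; exact norm_mul_le _ _)
        _ ≤ _ := by rw [norm_sub_rev]; gcongr; exact h.pr.norm_le
    nlinarith [norm_nonneg B]
  apply norm_diff (by linarith) h.pr h.pq
  · have : (1 - q) * P = (1 - q) * (ξ - q) * B := by
      have := h.pq.idem
      have := h.xy; have := h.qy
      simp only [mul_sub, sub_mul, one_mul]; grind
    rw [this]
    calc _ ≤ ‖1 - q‖ * ‖ξ - q‖ * ‖B‖ := by
            refine (norm_mul_le _ _).trans ?_; gcongr; exact norm_mul_le _ _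
      _ ≤ 1 * δ * 2 := by gcongr; exact h.pq.compl.norm_le
      _ = _ := by ring
  · have : (1 - P) * q = (1 - P) * (q - ξ) := by
      have := h.rx
      simp only [mul_sub, sub_mul, one_mul]; grind
    rw [this]
    calc _ ≤ ‖1 - P‖ * ‖q - ξ‖ := norm_mul_le _ _
      _ ≤ 1 * δ := by rw [norm_sub_rev q]; gcongr; exact h.pr.compl.norm_le
      _ ≤ _ := by linarith

end cst
end UO

namespace UO

section cst
variable {A : Type*} [CStarAlgebra A]

/-- positive square roots -/
theorem exists_sqrt (x : A) : ∃ h : A, star h = h ∧ h * h = star x * x ∧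
    ∀ δ : ℝ, 0 < δ → IsUnit (h + δ • (1:A)) := by
  letI := CStarAlgebra.spectralOrder A
  letI := CStarAlgebra.spectralOrderedRing A
  have p0 : 0 ≤ star x * x := star_mul_self_nonneg x
  refine ⟨CFC.sqrt (star x * x), ?_, CFC.sqrt_mul_sqrt_self _ p0, ?_⟩
  · exact (IsSelfAdjoint.of_nonneg (CFC.sqrt_nonneg _)).star_eq
  · intro δ hδ
    apply unit_of_ge hδ
    rw [Algebra.algebraMap_eq_smul_one]
    exact le_add_of_nonneg_left (CFC.sqrt_nonneg _)

theorem PI.norm_le [VNR A] {v e f : A} (h : PI v e f) : ‖v‖ ≤ 1 := by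
  have := CStarRing.norm_star_mul_self (x := v)
  rw [h.src] at this
  have := h.pe.norm_le
  nlinarith [norm_nonneg v]

variable [VNR A]

theorem pert {e f x a b : A} (he : Pj e) (hf : Pj f) (hx1 : f * x = x) (hx2 : x * e = x) (ha : Supp x a)
    (hb : Supp (star x) b) (hab : Eqv (e - a) (f - b)) {δ : ℝ} (hδ : 0 < δ) :
    ∃ x' y', Iv e f x' y' ∧ ‖x' - x‖ ≤ δ := by
  obtain ⟨h, hs, hh, hu⟩ := exists_sqrt x
  obtain ⟨v, hv, vh, ah, hah⟩ := polar ha hb hs hh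
  obtain ⟨w, hw⟩ := hab
  have ea : e * a = a := ha.le he hx2
  have fb : f * b = b := hb.le hf (by have := st hx1; rwa [hf.sa] at this)
  have ae := ha.pj.swap he ea
  have bf := hb.pj.swap hf fb
  have hν : PI (v + w) e f := by
    have := hv.add hw (by rw [sub_mul, ea, ha.pj.idem, sub_self]) (by rw [sub_mul, fb, hb.pj.idem, sub_self])
    simpa using this
  have wh : w * h = 0 := by
    rw [← hw.vr, mul_assoc, sub_mul, ah, ← ah, ← mul_assoc e, ea, ah, sub_self, mul_zero]
  have eh : e * h = h := by rw [← ah, ← mul_assoc, ea]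
  have he' : h * e = h := by rw [← hah, mul_assoc, ae]
  obtain ⟨u, hu⟩ := hu δ hδ
  have ue : e * u = u * e := by
    rw [hu, mul_add, add_mul, eh, he']; simp
  have c1 : (↑u⁻¹ : A) * e = e * ↑u⁻¹ := by
    rw [Units.inv_mul_eq_iff_eq_mul, ← mul_assoc, ← ue, mul_assoc, Units.mul_inv, mul_one]
  have w1 := u.inv_mul
  have w2 := u.mul_inv
  have xx : (v + w) * u = x + δ • (v + w) := by
    rw [hu, mul_add, add_mul, vh, wh]; simp
  generalize v + w = ν at *
  refine ⟨ν * u, ↑u⁻¹ * star ν, ⟨he, hf, ?_, ?_, ?_, ?_, ?_, ?_⟩, ?_⟩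
  · rw [← mul_assoc, hν.vl]
  · rw [mul_assoc, ← ue, ← mul_assoc, hν.vr]
  · rw [← mul_assoc, ← c1, mul_assoc, hν.sl]
  · rw [mul_assoc, hν.sr]
  · calc _ = ↑u⁻¹ * ((star ν * ν) * u) := by simp only [mul_assoc]
      _ = e := by rw [hν.src, ue, ← mul_assoc, w1, one_mul]
  · calc _ = ν * (u * ↑u⁻¹) * star ν := by simp only [mul_assoc]
      _ = f := by rw [w2, mul_one, hν.tgt]
  · rw [xx, add_sub_cancel_left, norm_smul, Real.norm_of_nonneg hδ.le]
    nlinarith [hν.norm_le]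

theorem pert_proj {q r x a b z : A} (hq : Pj q) (hr : Pj r) (hx1 : r * x = x) (hx2 : x * q = x) (ha : Supp x a)
    (hb : Supp (star x) b) (hab : Eqv (q - a) (r - b)) {δ : ℝ} (hδ : 0 < δ) (hδ' : δ ≤ 1/4)
    (hx : ‖x - r * q‖ ≤ δ) (hz : Cn z) (hzq : z * q = q) :
    ∃ q', Pj q' ∧ z * q' = q' ∧ ‖q' - q‖ ≤ 4 * δ ∧ ‖r - q'‖ < 1 := by
  obtain ⟨x', y', h, hn⟩ := pert hq hr hx1 hx2 ha hb hab hδ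
  set ξ := q + (x' - r * q) with hξ
  have rξ : r * ξ = x' := by
    rw [hξ, mul_add, mul_sub, h.rx, ← mul_assoc, hr.idem]; abel
  have ξq : ξ * q = ξ := by
    rw [hξ, add_mul, sub_mul, h.xq, hq.idem, mul_assoc, hq.idem]
  obtain ⟨B, hB⟩ := PP_spec (L := y' * r) hq ξq (by rw [mul_assoc, rξ, h.yx])
  refine ⟨PP q ξ, hB.pr, ?_, ?_, ?_⟩
  · rw [← hB.xy, ← mul_assoc]
    congr 1
    rw [← ξq, ← mul_assoc, hz.c, mul_assoc, hzq]
  · have := hB.close (δ := 2 * δ) (by linarith) (by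
      rw [hξ, add_sub_cancel_left]
      calc _ = ‖(x' - x) + (x - r * q)‖ := by congr 1; abel
        _ ≤ _ := (norm_add_le _ _).trans (by linarith))
    linarith
  · exact near_of hB (y := y') (by rw [rξ]; exact h)

end cst
end UO

namespace UO

section alg6
variable {A : Type*} [Ring A] [StarRing A] [VNR A]

theorem cz {z x y : A} (hz : Cn z) (h : x * y = 0) : z * x * (z * y) = 0 := by
  rw [hz.c y, ← mul_assoc, mul_assoc z, h, mul_zero, zero_mul]

theorem sub_orth {m g : A} (hm : Pj m) (hg : Pj g) (h : g * m = m) : m * (g - m) = 0 := by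
  rw [mul_sub, hm.swap hg h, hm.idem, sub_self]

theorem halv_fact {a e f : A} (ha : Halv a) (he : Pj e) (hae : a * e = e) (hf : f = a - e) :
    ∃ z, Cn z ∧ Le (z * a) (z * f) ∧ Le ((1 - z) * a) ((1 - z) * e) := by
  have pa := ha.pj
  have pf : Pj f := hf ▸ he.sub pa hae
  have ea := he.swap pa hae
  have ia := pa.idem
  have ie := he.idem
  obtain ⟨g, ag, e1, e2⟩ := ha
  have pg := e1.pr
  have pg' := e2.pr
  have ga := pg.swap pa ag
  have ig := pg.idem
  have g'a : (a - g) * a = a - g := by rw [sub_mul, ia, ga]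
  have ag' : a * (a - g) = a - g := by rw [mul_sub, ia, ag]
  have fa : f * a = f := by rw [hf, sub_mul, ia, ea]
  have af : a * f = f := by rw [hf, mul_sub, ia, hae]
  obtain ⟨m, hm⟩ := exists_mt f pg
  obtain ⟨n, hn⟩ := exists_mt g pf
  have am : a * m = m := by rw [← hm.gm, ← mul_assoc, ag]
  have an : a * n = n := by rw [← hn.gm, ← mul_assoc, af]
  have em : e * m = m := by
    have := hm.hm
    rw [hf, sub_mul, am, sub_eq_zero] at this; exact this.symm
  have g'n : (a - g) * n = n := by rw [sub_mul, an, hn.hm, sub_zero]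
  have hn' : Mt (a - g) e n := by
    refine ⟨hn.pj, g'n, ?_, ?_⟩
    · rw [← hn.gm, hf, ← mul_assoc, mul_sub, ea, ie, sub_self, zero_mul]
    · intro b h1 h2
      have ab : a * b = b := by rw [← h1, ← mul_assoc, ag']
      apply hn.univ
      · rw [hf, sub_mul, h2, ab, sub_zero]
      · rw [sub_mul, ab] at h1; simpa using h1
  have hm' : Mt e (a - g) m := by
    refine ⟨hm.pj, em, ?_, ?_⟩
    · rw [sub_mul, am, hm.gm, sub_self]
    · intro b h1 h2
      have ab : a * b = b := by rw [← h1, ← mul_assoc, hae]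
      apply hm.univ
      · rw [sub_mul, ab, sub_eq_zero] at h2; exact h2.symm
      · rw [hf, sub_mul, ab, h1, sub_self]
  have p1 := parallelogram pg pf hm hn
  have p2 := parallelogram pg' he hn' hm'
  obtain ⟨z, hz, l1, l2⟩ := gc hm.pj hn.pj
  refine ⟨z, hz, ?_, ?_⟩
  · refine (e1.cut hz).le.trans ?_
    have := (p1.cut hz).le.add l1 (cz hz (sub_orth hm.pj pg hm.gm)) (cz hz (sub_orth hn.pj pf hn.gm))
    rwa [← mul_add, ← mul_add, sub_add_cancel, sub_add_cancel] at this
  · refine (e2.cut hz.compl).le.trans ?_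
    have := (p2.cut hz.compl).le.add l2 (cz hz.compl (sub_orth hn.pj pg' g'n))
      (cz hz.compl (sub_orth hm.pj he em))
    rwa [← mul_add, ← mul_add, sub_add_cancel, sub_add_cancel] at this

end alg6

section cst6
variable {A : Type*} [CStarAlgebra A]

theorem Iv.normB {q P ξ B : A} (h : Iv q P ξ B) (hx : ‖ξ - q‖ ≤ 1/2) : ‖B‖ ≤ 2 := by
  have e : B = P + (q - ξ) * B := by rw [sub_mul, h.qy, h.xy]; abel
  have : ‖B‖ ≤ 1 + 1/2 * ‖B‖ := by
    calc ‖B‖ = ‖P + (q - ξ) * B‖ := by rw [← e]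
      _ ≤ ‖P‖ + ‖(q - ξ)‖ * ‖B‖ := (norm_add_le _ _).trans (by gcongr; exact norm_mul_le _ _)
      _ ≤ _ := by rw [norm_sub_rev]; gcongr; exact h.pr.norm_le
  linarith

theorem posneg (a : A) (ha : star a = a) : ∃ P N : A, star P = P ∧ star N = N ∧ a = P - N ∧ P * N = 0 ∧
    (letI := CStarAlgebra.spectralOrder A; 0 ≤ P ∧ 0 ≤ N) := by
  letI := CStarAlgebra.spectralOrder A
  letI := CStarAlgebra.spectralOrderedRing A
  have hP : 0 ≤ a⁺ := CFC.posPart_nonneg a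
  have hN : 0 ≤ a⁻ := CFC.negPart_nonneg a
  exact ⟨a⁺, a⁻, (IsSelfAdjoint.of_nonneg hP).star_eq, (IsSelfAdjoint.of_nonneg hN).star_eq,
    (CFC.posPart_sub_negPart a ha).symm, CFC.posPart_mul_negPart a, hP, hN⟩

variable [VNR A]

theorem Iv.supp {q P ξ B : A} (h : Iv q P ξ B) : Supp ξ q := by
  refine ⟨h.pq, fun a => ⟨fun k => ?_, fun k => ?_⟩⟩
  · rw [← h.xq, mul_assoc, k, mul_zero]
  · rw [← h.yx, mul_assoc, k, mul_zero]

theorem Iv.star {q P ξ B : A} (h : Iv q P ξ B) : Iv P q (star ξ) (star B) := by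
  refine ⟨h.pr, h.pq, ?_, ?_, ?_, ?_, ?_, ?_⟩
  · have := st h.xq; rwa [h.pq.sa] at this
  · have := st h.rx; rwa [h.pr.sa] at this
  · have := st h.yr; rwa [h.pr.sa] at this
  · have := st h.qy; rwa [h.pq.sa] at this
  · have := st h.xy; rwa [h.pr.sa] at this
  · have := st h.yx; rwa [h.pq.sa] at this

theorem Iv.eqv {q P ξ B : A} (h : Iv q P ξ B) : Eqv q P := polar_eqv h.supp h.star.supp

theorem spec_cut {s t : A} (hs : Pj s) (ht : Pj t) {ε : ℝ} (hε : 0 < ε) :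
    ∃ e L, Pj e ∧ s * e = e ∧ ‖t * (s - e)‖ ≤ ε ∧ L * (t * e) = e := by
  have is := hs.idem
  have it := ht.idem
  have sa : star (s * t * s - (ε ^ 2) • s) = s * t * s - (ε ^ 2) • s := by
    simp [hs.sa, ht.sa, mul_assoc]
  obtain ⟨P, N, sP, sN, hPN, PN, P0, N0⟩ := posneg _ sa
  obtain ⟨e, he⟩ := exists_supp P
  have pe := he.pj
  have PP : P * P = P * (P - N) := by rw [mul_sub, PN, sub_zero]
  have as : (P - N) * (1 - s) = 0 := by
    rw [← hPN]; simp [sub_mul, mul_sub, mul_assoc, is]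
  have Ps : P * s = P := by
    have : P * (1 - s) = 0 := by
      apply VNR.proper
      rw [star_mul, sP]
      rw [mul_assoc, ← mul_assoc P, PP, mul_assoc P, as, mul_zero, mul_zero]
    rwa [hs.ks'] at this
  have se : s * e = e := he.le hs Ps
  have es := pe.swap hs se
  have eN : e * N = 0 := by rw [he.op]; exact PN
  have Ne : N * e = 0 := by
    have := st eN
    rwa [sN, pe.sa, star_zero] at this
  have Pe := he.mul_self
  letI := CStarAlgebra.spectralOrder A
  letI := CStarAlgebra.spectralOrderedRing A
  have k1 : (s - e) * t * (s - e) ≤ algebraMap ℝ A (ε ^ 2) := by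
    have h1 : (s - e) * (P - N) * (s - e) = (s - e) * t * (s - e) - (ε^2) • (s - e) := by
      rw [← hPN]
      have i1 : (s - e) * s = s - e := by rw [sub_mul, is, es]
      have i2 : s * (s - e) = s - e := by rw [mul_sub, is, se]
      have i3 : (s - e) * (s - e) = s - e := (pe.sub hs se).idem
      simp only [mul_sub (s - e) (s * t * s), sub_mul _ _ (s - e), mul_smul_comm, smul_mul_assoc]
      rw [mul_assoc (s - e) s (s - e), i2, i3]
      congr 1
      calc (s - e) * (s * t * s) * (s - e) = ((s - e) * s) * t * (s * (s - e)) := by simp only [mul_assoc]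
        _ = _ := by rw [i1, i2]
    have h2 : (s - e) * (P - N) * (s - e) = - (star (s - e) * N * (s - e)) := by
      rw [(pe.sub hs se).sa]
      have : P * (s - e) = 0 := by rw [mul_sub, Ps, Pe, sub_self]
      rw [mul_sub (s - e) P N, sub_mul, mul_assoc (s - e) P, this, mul_zero, zero_sub]
    have h3 : 0 ≤ star (s - e) * N * (s - e) := star_left_conjugate_nonneg N0 _
    rw [h1] at h2
    have h4 : (s - e) * t * (s - e) ≤ (ε^2) • (s - e) := by
      rw [← sub_nonpos, h2]; exact neg_nonpos.mpr h3
    refine h4.trans ?_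
    rw [Algebra.algebraMap_eq_smul_one]
    exact smul_le_smul_of_nonneg_left (pe.sub hs se).le_one (by positivity)
  have k2 : (ε ^ 2) • e ≤ e * t * e := by
    have h1 : e * (P - N) * e = e * t * e - (ε^2) • e := by
      rw [← hPN]
      simp only [mul_sub, sub_mul, mul_smul_comm, smul_mul_assoc]
      rw [es, pe.idem]
      congr 1
      calc e * (s * t * s) * e = (e * s) * t * (s * e) := by simp only [mul_assoc]
        _ = _ := by rw [es, se]
    have h2 : e * (P - N) * e = star e * P * e := by
      rw [pe.sa, mul_sub, eN, sub_zero]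
    have h3 : 0 ≤ star e * P * e := star_left_conjugate_nonneg P0 _
    rw [← h2, h1] at h3
    exact sub_nonneg.mp h3
  have un : IsUnit (KK e (t * e)) := by
    have e1 : KK e (t * e) = e * t * e + (1 - e) := by
      rw [KK, star_mul, pe.sa, ht.sa]
      congr 1
      rw [mul_assoc, ← mul_assoc t, it, mul_assoc]
    set c := min (ε ^ 2) 1 with hc
    have c0 : 0 < c := by positivity
    apply unit_of_ge c0
    rw [e1, Algebra.algebraMap_eq_smul_one]
    calc c • (1:A) = c • e + c • (1 - e) := by rw [← smul_add]; simp
      _ ≤ (ε^2) • e + (1:ℝ) • (1 - e) := by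
          apply add_le_add
          · exact smul_le_smul_of_nonneg_right (min_le_left _ _) pe.nonneg
          · exact smul_le_smul_of_nonneg_right (min_le_right _ _) pe.compl.nonneg
      _ ≤ _ := by rw [one_smul]; gcongr
  obtain ⟨u, hu⟩ := un
  refine ⟨e, ↑u⁻¹ * e, pe, se, ?_, ?_⟩
  · apply norm_of_sq_le hε.le
    rw [star_mul, (pe.sub hs se).sa, ht.sa, mul_assoc, ← mul_assoc t, it, ← mul_assoc]
    exact k1
  · have : e * (t * e) = u * e := by
      rw [hu, KK, add_mul, sub_mul, pe.idem, one_mul, sub_self, add_zero, star_mul, pe.sa, ht.sa]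
      rw [mul_assoc, mul_assoc, mul_assoc, pe.idem, ← mul_assoc t, it]
    rw [mul_assoc, this, ← mul_assoc, Units.inv_mul, one_mul]

end cst6
end UO

namespace UO

section cst7
variable {A : Type*} [CStarAlgebra A] [VNR A]

theorem half {e s t : A} (he : Halv e) (hs : Eqv e s) (ht : Eqv e t) {ε : ℝ} (hε : 0 < ε) :
    ∃ s' t', s * s' = s' ∧ t * t' = t' ∧ Eqv e s' ∧ Eqv e t' ∧ ‖t' * s'‖ ≤ ε := by
  obtain ⟨e1, L, pe1, se1, hn, hL⟩ := spec_cut hs.pr ht.pr hε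
  obtain ⟨z, hz, l1, l2⟩ := halv_fact (he.eqv hs) pe1 se1 rfl
  have hw := hz.compl
  have zw : z * (1 - z) = 0 := by rw [mul_sub, hz.pj.idem, mul_one, sub_self]
  have wz : (1 - z) * z = 0 := by rw [sub_mul, hz.pj.idem, one_mul, sub_self]
  have hzw : z + (1 - z) = 1 := by abel
  generalize hww : 1 - z = w at *
  have is := hs.pr.idem
  have it := ht.pr.idem
  have ie := pe1.idem
  have e1s := pe1.swap hs.pr se1
  -- the part over z
  obtain ⟨-, s1, a1, a2⟩ := l1
  have zs1 : z * s1 = s1 := by rw [← a2, ← mul_assoc, ← mul_assoc, hz.pj.idem]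
  have fs1 : (s - e1) * s1 = s1 := by
    have i3 : (s - e1) * (s - e1) = s - e1 := (pe1.sub hs.pr se1).idem
    rw [← a2, ← mul_assoc, ← mul_assoc, ← hz.c, mul_assoc z, i3]
  have ss1 : s * s1 = s1 := by
    rw [← fs1, ← mul_assoc, mul_sub, is, se1]
  -- the part over w
  obtain ⟨-, e2, b1, b2⟩ := l2
  have we2 : w * e2 = e2 := by rw [← b2, ← mul_assoc, ← mul_assoc, hw.pj.idem]
  have ee2 : e1 * e2 = e2 := by
    rw [← b2, ← mul_assoc, ← mul_assoc, ← hw.c, mul_assoc w, ie]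
  have h2 : Halv e2 := ((he.eqv hs).cut hw).eqv b1
  obtain ⟨e', c1, c2, c3⟩ := h2
  obtain ⟨e'', he''⟩ : ∃ x, x = e2 - e' := ⟨_, rfl⟩
  rw [← he''] at c3
  have pe' := c2.pr
  have pe'' := c3.pr
  have ie' := pe'.idem
  have ie'' := pe''.idem
  have e''e' : e'' * e' = 0 := by rw [he'', sub_mul, c1, ie', sub_self]
  have ie2 := c2.pl.idem
  have c1' : e2 * e'' = e'' := by rw [he'', mul_sub, ie2, c1]
  have ee' : e1 * e' = e' := by rw [← c1, ← mul_assoc, ee2]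
  have ee'' : e1 * e'' = e'' := by rw [← c1', ← mul_assoc, ee2]
  have we' : w * e' = e' := by rw [← c1, ← mul_assoc, we2]
  have we'' : w * e'' = e'' := by rw [← c1', ← mul_assoc, we2]
  have Lt : ∀ b, e1 * b = b → L * (t * b) = b := by
    intro b hb
    calc L * (t * b) = L * (t * e1) * b := by rw [mul_assoc, mul_assoc, hb]
      _ = b := by rw [hL, hb]
  obtain ⟨B, hB⟩ := PP_spec (q := e') (ξ := t * e') (L := L) pe' (by rw [mul_assoc, ie']) (Lt _ ee')
  set g := PP e' (t * e')
  have tg : t * g = g := by rw [← hB.xy, ← mul_assoc, ← mul_assoc, it]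
  have gt := hB.pr.swap ht.pr tg
  have key : e'' * L * ((t - g) * e'') = e'' := by
    have : (t - g) * e'' = t * e'' - t * (e' * B * (t * e'')) := by
      rw [sub_mul]; congr 1
      rw [← gt, ← hB.xy]; simp only [mul_assoc]
    rw [this, mul_sub, mul_assoc, Lt _ ee'', ie'', mul_assoc, Lt _ (by simp only [← mul_assoc, ee'])]
    simp only [← mul_assoc, e''e', zero_mul, sub_zero]
  obtain ⟨B', hB'⟩ := PP_spec (q := e'') (ξ := (t - g) * e'') (L := e'' * L) pe'' (by rw [mul_assoc, ie'']) key
  set t2 := PP e'' ((t - g) * e'')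
  have tt2 : t * t2 = t2 := by
    rw [← hB'.xy, ← mul_assoc, ← mul_assoc, mul_sub, it, tg]
  have t2e : t2 * e' = 0 := by
    have h0 : (t - g) * e' = 0 := by
      rw [sub_mul]
      conv_lhs => rw [← gt, mul_assoc g, hB.rx, sub_self]
    have := hB'.star.yx
    rw [← this, star_mul, star_sub, ht.pr.sa, hB.pr.sa, mul_assoc, mul_assoc, h0, mul_zero, mul_zero]
  have wt2 : w * t2 = t2 := by
    rw [← hB'.xy, ← mul_assoc, ← mul_assoc, hw.c, mul_assoc (t - g), we'']
  have s1e : s1 * e' = 0 := by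
    rw [← zs1, hz.c, mul_assoc, ← we', ← mul_assoc z, zw, zero_mul, mul_zero]
  have es1 : e' * s1 = 0 := by
    rw [← we', hw.c, mul_assoc, ← zs1, ← mul_assoc w, wz, zero_mul, mul_zero]
  have ez : z * e + w * e = e := by rw [← add_mul, hzw, one_mul]
  have oz : w * e * (z * e) = 0 := by
    rw [hz.c, ← mul_assoc, hw.c, mul_assoc e w, hw.c e, ← mul_assoc, mul_assoc, wz, mul_zero]
  refine ⟨s1 + e', z * t + t2, ?_, ?_, ?_, ?_, ?_⟩
  · rw [mul_add, ss1]; congr 1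
    rw [← ee', ← mul_assoc, se1]
  · rw [mul_add, tt2, ← mul_assoc, ← hz.c, mul_assoc, it]
  · have := ((hs.cut hz).trans a1).add (((hs.cut hw).trans b1).trans c2) oz es1
    rwa [ez] at this
  · have := (ht.cut hz).add ((((hs.cut hw).trans b1).trans c3).trans hB'.eqv) oz (by
      rw [← wt2, hw.c, mul_assoc, ← mul_assoc w, wz, zero_mul, mul_zero])
    rwa [ez] at this
  · have : (z * t + t2) * (s1 + e') = t * (s - e1) * s1 := by
      have x1 : z * t * e' = 0 := by
        rw [hz.c, mul_assoc, ← we', ← mul_assoc z, zw, zero_mul, mul_zero]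
      have x2 : t2 * s1 = 0 := by
        rw [← wt2, hw.c, mul_assoc, ← zs1, ← mul_assoc w, wz, zero_mul, mul_zero]
      rw [add_mul, mul_add, mul_add, x1, x2, t2e, mul_assoc t, fs1, hz.c, mul_assoc, zs1]
      simp
    rw [this]
    calc _ ≤ ‖t * (s - e1)‖ * ‖s1‖ := norm_mul_le _ _
      _ ≤ ε * 1 := by gcongr; exact a1.pr.norm_le
      _ = ε := mul_one _

theorem cut_norm {s t s' t' : A} (hs : Pj s') (ht : Pj t') (pt : Pj t) (h1 : s * s' = s') (h2 : t * t' = t') :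
    ‖t' * s'‖ ≤ ‖t * s‖ := by
  have : t' * s' = t' * (t * s) * s' := by
    calc t' * s' = (t' * t) * (s * s') := by rw [ht.swap pt h2, h1]
      _ = _ := by simp only [mul_assoc]
  rw [this]
  calc _ ≤ ‖t'‖ * ‖t * s‖ * ‖s'‖ := (norm_mul_le _ _).trans (by gcongr; exact norm_mul_le _ _)
    _ ≤ 1 * ‖t * s‖ * 1 := by gcongr; exacts [ht.norm_le, hs.norm_le]
    _ = _ := by ring

theorem shrink {κ : Type*} [DecidableEq κ] {e : A} (he : Halv e) (s : κ → A) (hs : ∀ k, Eqv e (s k))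
    {ε : ℝ} (hε : 0 < ε) (F : Finset (κ × κ)) (hF : ∀ c ∈ F, c.1 ≠ c.2) :
    ∃ s' : κ → A, (∀ k, s k * s' k = s' k) ∧ (∀ k, Eqv e (s' k)) ∧ ∀ c ∈ F, ‖s' c.2 * s' c.1‖ ≤ ε := by
  induction F using Finset.induction_on with
  | empty => exact ⟨s, fun k => (hs k).pr.idem, hs, by simp⟩
  | insert c F hc ih =>
    obtain ⟨s', h1, h2, h3⟩ := ih (fun d hd => hF d (Finset.mem_insert_of_mem hd))
    obtain ⟨k, l⟩ := c
    have hkl : k ≠ l := hF (k, l) (Finset.mem_insert_self _ _)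
    obtain ⟨a, b, ha, hb, ea, eb, hn⟩ := half he (h2 k) (h2 l) hε
    let s'' : κ → A := fun j => if j = k then a else if j = l then b else s' j
    have sk : s'' k = a := by simp [s'']
    have sl : s'' l = b := by simp [s'', hkl.symm]
    have g1 : ∀ j, s' j * s'' j = s'' j := by
      intro j
      by_cases hj : j = k
      · subst hj; rw [sk, ha]
      by_cases hj' : j = l
      · subst hj'; rw [sl, hb]
      · simp [s'', hj, hj', (h2 j).pr.idem]
    have g2 : ∀ j, Eqv e (s'' j) := by
      intro j
      by_cases hj : j = k
      · subst hj; rw [sk]; exact ea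
      by_cases hj' : j = l
      · subst hj'; rw [sl]; exact eb
      · simpa [s'', hj, hj'] using h2 j
    refine ⟨s'', fun j => ?_, g2, ?_⟩
    · rw [← g1, ← mul_assoc, h1]
    · intro d hd
      rw [Finset.mem_insert] at hd
      rcases hd with rfl | hd
      · simp only [sk, sl]; exact hn
      · exact (cut_norm (g2 _).pr (g2 _).pr (h2 _).pr (g1 _) (g1 _)).trans (h3 d hd)

theorem build {κ : Type*} [DecidableEq κ] {e : A} (he : Halv e) (s : κ → A) (hs : ∀ k, Eqv e (s k))
    {ε : ℝ} (hε : 0 < ε) (hp : ∀ k l, k ≠ l → ‖s l * s k‖ ≤ ε) (T : Finset κ)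
    (hT : 5 ^ T.card * ε ≤ 1/2) :
    ∃ r, Pj r ∧ Le r e ∧ (∀ z, Cn z → z * e = e → (∀ k, z * s k = s k) → z * r = r) ∧
      (∀ k ∈ T, r * s k = s k) ∧ ∀ k ∉ T, ‖r * s k‖ ≤ 5 ^ T.card * ε := by
  induction T using Finset.induction_on with
  | empty =>
    exact ⟨0, .zero, .of_le .zero he.pj (by simp), by simp, by simp, by intro k _; simp; positivity⟩
  | insert j T hj ih =>
    rw [Finset.card_insert_of_notMem hj] at hT ⊢
    have hc : (0:ℝ) < 5 ^ T.card * ε := by positivity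
    have hc1 : ε ≤ 5 ^ T.card * ε := by
      have : (1:ℝ) ≤ 5 ^ T.card := one_le_pow₀ (by norm_num)
      nlinarith
    have h5 : (5:ℝ) ^ (T.card + 1) * ε = 5 * (5 ^ T.card * ε) := by rw [pow_succ]; ring
    obtain ⟨r, pr, lr, zr, h1, h2⟩ := ih (by linarith)
    have ir := pr.idem
    have pb := (hs j).pr
    have ib := pb.idem
    set b := s j with hb
    set ξ := (1 - r) * b with hξ
    have rξ : r * ξ = 0 := by rw [hξ, ← mul_assoc, mul_sub, ir, mul_one, sub_self, zero_mul]
    have ξb : ξ * b = ξ := by rw [hξ, mul_assoc, ib]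
    have hn : ‖ξ - b‖ ≤ 1/2 := by
      rw [hξ, sub_mul, one_mul, sub_sub_cancel_left, norm_neg]
      have := h2 j hj
      linarith
    obtain ⟨L, hL⟩ := left_inv_of_close pb ξb (by linarith)
    obtain ⟨B, hB⟩ := PP_spec pb ξb hL
    set P := PP b ξ
    have hBn := hB.normB hn
    have rP : r * P = 0 := by rw [← hB.xy, ← mul_assoc, rξ, zero_mul]
    have Pr := hB.pr.swap0 pr rP
    refine ⟨r + P, pr.add hB.pr Pr, ?_, ?_, ?_, ?_⟩
    · exact he.le_add lr ((hs j).trans hB.eqv).symm.le Pr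
    · intro z hz hze hzs
      rw [mul_add, zr z hz hze hzs]; congr 1
      rw [← hB.xy, ← mul_assoc]; congr 1
      rw [hξ, ← mul_assoc, hz.c, mul_assoc, hb, hzs]
    · intro k hk
      rw [Finset.mem_insert] at hk
      rcases hk with rfl | hk
      · have : P * b = (1 - r) * b := by
          have := hB.rx
          rw [hξ, sub_mul, one_mul, mul_sub, ← mul_assoc P r, Pr, zero_mul, sub_zero] at this
          rw [this, sub_mul, one_mul]
        rw [add_mul, this, sub_mul, one_mul]; abel
      · have hPs : P * s k = 0 := by rw [← h1 k hk, ← mul_assoc, Pr, zero_mul]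
        rw [add_mul, h1 k hk, hPs, add_zero]
    · intro k hk
      rw [Finset.mem_insert, not_or] at hk
      have hkj : k ≠ j := hk.1
      have e1 : P * s k = star B * (b * s k - b * (r * s k)) := by
        have := hB.star.yx
        rw [← this, hξ, star_mul, star_sub, star_one, pr.sa, pb.sa]
        simp only [mul_sub, sub_mul, mul_one, one_mul, mul_assoc]
      have n1 : ‖b * s k‖ ≤ ε := hp k j hkj
      have n2 : ‖r * s k‖ ≤ 5 ^ T.card * ε := h2 k hk.2
      have n3 : ‖b * (r * s k)‖ ≤ 5 ^ T.card * ε :=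
        (norm_mul_le _ _).trans (by nlinarith [pb.norm_le, norm_nonneg (r * s k), norm_nonneg b])
      have n4 : ‖P * s k‖ ≤ 2 * (ε + 5 ^ T.card * ε) := by
        rw [e1]
        calc _ ≤ ‖star B‖ * ‖b * s k - b * (r * s k)‖ := norm_mul_le _ _
          _ ≤ 2 * (ε + 5 ^ T.card * ε) := by
            rw [norm_star]; gcongr
            exact (norm_sub_le _ _).trans (add_le_add n1 n3)
      rw [add_mul, h5]
      refine (norm_add_le _ _).trans ?_
      linarith

end cst7
end UO

namespace UO

section cst8
variable {A : Type*} [CStarAlgebra A] [VNR A] {ι : Type*}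

/-- local version of the general position statement -/
def Claim (z : A) (q : ι → A) (δ : ℝ) : Prop :=
  ∃ r, Pj r ∧ z * r = r ∧ ∀ i, ∃ q', Pj q' ∧ z * q' = q' ∧ ‖q' - z * q i‖ ≤ δ ∧ ‖r - q'‖ < 1

theorem Claim.compl {z : A} {q : ι → A} {δ : ℝ} (hz : Cn z) (h : Claim z (fun i => 1 - q i) δ) : Claim z q δ := by
  obtain ⟨r, pr, zr, h⟩ := h
  refine ⟨z - r, pr.sub hz.pj zr, by rw [mul_sub, zr, hz.pj.idem], fun i => ?_⟩
  obtain ⟨q', pq, zq, n1, n2⟩ := h i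
  refine ⟨z - q', pq.sub hz.pj zq, by rw [mul_sub, zq, hz.pj.idem], ?_, ?_⟩
  · have e : z - q' - z * q i = - (q' - z * (1 - q i)) := by rw [mul_sub, mul_one]; abel
    rw [e, norm_neg]; exact n1
  · have e : z - r - (z - q') = - (r - q') := by abel
    rw [e, norm_neg]; exact n2

theorem glue_norm {z w x y : A} {c : ℝ} (hc : 0 ≤ c) (hz : Cn z) (hw : Cn w) (h : w * z = 0)
    (hx : z * x = x) (hy : w * y = y) (n1 : ‖x‖ ≤ c) (n2 : ‖y‖ ≤ c) : ‖x + y‖ ≤ c := by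
  have yz : y * z = 0 := by rw [← hy, mul_assoc, ← hz.c, ← mul_assoc, h, zero_mul]
  have xz : x * z = x := by rw [← hz.c, hx]
  apply norm_split hc hz.pj (hz.c _)
  · rwa [add_mul, yz, xz, add_zero]
  · rwa [mul_sub, mul_one, add_mul x y z, yz, xz, add_zero, add_sub_cancel_left]

theorem Claim.glue {z w : A} {q : ι → A} {δ : ℝ} (hδ : 0 ≤ δ) (hz : Cn z) (hw : Cn w) (h : w * z = 0)
    (h1 : Claim z q δ) (h2 : Claim w q δ) : Claim (z + w) q δ := by
  obtain ⟨r, pr, zr, h1⟩ := h1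
  obtain ⟨r', pr', zr', h2⟩ := h2
  have orth : ∀ x y : A, z * x = x → w * y = y → y * x = 0 := by
    intro x y hx hy
    rw [← hy, ← hx, hw.c, mul_assoc, ← mul_assoc w, h, zero_mul, mul_zero]
  have zw : z * w = 0 := by rw [hz.c, h]
  have kz : ∀ x y : A, z * x = x → w * y = y → (z + w) * (x + y) = x + y := by
    intro x y hx hy
    have : z * y = 0 := by rw [← hy, ← mul_assoc, zw, zero_mul]
    have : w * x = 0 := by rw [← hx, ← mul_assoc, h, zero_mul]
    simp [add_mul, mul_add, *]
  refine ⟨r + r', pr.add pr' (orth _ _ zr zr'), kz _ _ zr zr', fun i => ?_⟩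
  obtain ⟨q1, a1, a2, a3, a4⟩ := h1 i
  obtain ⟨q2, b1, b2, b3, b4⟩ := h2 i
  refine ⟨q1 + q2, a1.add b1 (orth _ _ a2 b2), kz _ _ a2 b2, ?_, ?_⟩
  · have := glue_norm hδ hz hw h (x := q1 - z * q i) (y := q2 - w * q i)
      (by rw [mul_sub, a2, ← mul_assoc, hz.pj.idem]) (by rw [mul_sub, b2, ← mul_assoc, hw.pj.idem]) a3 b3
    convert this using 2
    rw [add_mul]; abel
  · have := glue_norm (c := max ‖r - q1‖ ‖r' - q2‖) (by positivity) hz hw h (x := r - q1) (y := r' - q2)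
      (by rw [mul_sub, a2, zr]) (by rw [mul_sub, b2, zr']) (le_max_left _ _) (le_max_right _ _)
    have e : r + r' - (q1 + q2) = r - q1 + (r' - q2) := by abel
    rw [e]
    exact this.trans_lt (max_lt a4 b4)

theorem claim_fin {z p : A} {q : ι → A} {δ : ℝ} (hδ : 0 < δ) (hδ' : δ ≤ 1) (hz : Cn z) (hp : Fin' (z * p))
    (hq : ∀ i, Eqv p (q i)) : Claim z q δ := by
  refine ⟨z * p, hp.1, by rw [← mul_assoc, hz.pj.idem], fun i => ?_⟩
  obtain ⟨u, hu⟩ := ((hq i).cut hz).symm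
  have zQ : z * (z * q i) = z * q i := by rw [← mul_assoc, hz.pj.idem]
  generalize z * q i = Q at *
  generalize z * p = e at *
  have pe := hp.1
  have pQ := hu.pe
  have x1 : e * (e * Q) = e * Q := by rw [← mul_assoc, pe.idem]
  have x2 : e * Q * Q = e * Q := by rw [mul_assoc, pQ.idem]
  obtain ⟨a, ha⟩ := exists_supp (e * Q)
  obtain ⟨b, hb⟩ := exists_supp (star (e * Q))
  have Qa := ha.le pQ x2
  have eb := hb.le pe (by have := st x1; rwa [pe.sa] at this)
  have aQ := ha.pj.swap pQ Qa
  have c1 := hu.conj ha.pj Qa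
  have c2 := hu.conj (ha.pj.sub pQ Qa) (by rw [mul_sub, pQ.idem, Qa])
  have e1 : u * (Q - a) * star u = e - u * a * star u := by
    rw [mul_sub, sub_mul, hu.vr, hu.tgt]
  rw [e1] at c2
  have c3 := fin_cancel hp (by rw [← mul_assoc, ← mul_assoc, hu.vl]) eb (c1.symm.trans (polar_eqv ha hb))
  have := pert_proj (δ := δ / 4) pQ pe x1 x2 ha hb (c2.trans c3) (by linarith) (by linarith) (by simp; linarith) hz zQ
  obtain ⟨q', h1, h2, h3, h4⟩ := this
  exact ⟨q', h1, h2, by linarith, h4⟩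

theorem claim_inf [Fintype ι] [Nonempty ι] {z p : A} {q : ι → A} {δ : ℝ} (hδ : 0 < δ) (hδ' : δ ≤ 1) (hz : Cn z)
    (hp : Halv (z * p)) (hle : Le (z * p) (z * (1 - p)))
    (hq : ∀ i, Eqv p (q i)) (hq' : ∀ i, Eqv (1 - p) (1 - q i)) : Claim z q δ := by
  classical
  have hQ : ∀ i, Eqv (z * p) (z * q i) := fun i => (hq i).cut hz
  have ex1 : ∀ i, ∃ a, Eqv (z * p) a ∧ z * q i * a = a := by
    intro i
    obtain ⟨f, h1, h2, h3⟩ := hp.eqv (hQ i)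
    exact ⟨f, (hQ i).trans h2, h1⟩
  have ex2 : ∀ i, ∃ b, Eqv (z * p) b ∧ z * (1 - q i) * b = b := by
    intro i
    obtain ⟨-, g, h1, h2⟩ := hle.trans ((hq' i).cut hz).le
    exact ⟨g, h1, h2⟩
  choose a ha1 ha2 using ex1
  choose b hb1 hb2 using ex2
  set N := Fintype.card ι with hN
  obtain ⟨ε, hε, hε'⟩ : ∃ ε : ℝ, 0 < ε ∧ 5 ^ N * ε ≤ δ / 4 :=
    ⟨δ / 4 / 5 ^ N, by positivity, by rw [mul_div_cancel₀]; positivity⟩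
  obtain ⟨s, s1, s2, s3⟩ := shrink hp (Sum.elim a b) (by rintro (i | i); exacts [ha1 i, hb1 i]) hε
    (Finset.univ.filter fun c => c.1 ≠ c.2) (by simp)
  have cardT : (Finset.univ.map (⟨Sum.inr, Sum.inr_injective⟩ : ι ↪ ι ⊕ ι)).card = N := by simp [hN]
  obtain ⟨r, pr, lr, zr, r1, r2⟩ := build hp s s2 hε (fun k l hkl => s3 (k, l) (by simpa using hkl))
    (Finset.univ.map (⟨Sum.inr, Sum.inr_injective⟩ : ι ↪ ι ⊕ ι)) (by rw [cardT]; linarith)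
  rw [cardT] at r2
  have qa : ∀ i, z * q i * s (Sum.inl i) = s (Sum.inl i) := fun i => by
    have := s1 (Sum.inl i)
    rw [← this, ← mul_assoc]; simp [ha2]
  have qb : ∀ i, z * (1 - q i) * s (Sum.inr i) = s (Sum.inr i) := fun i => by
    have := s1 (Sum.inr i)
    rw [← this, ← mul_assoc]; simp [hb2]
  have rb : ∀ i, r * s (Sum.inr i) = s (Sum.inr i) := fun i => r1 _ (by simp)
  have ra : ∀ i, ‖r * s (Sum.inl i)‖ ≤ 5 ^ N * ε := fun i => r2 _ (by simp)
  have zi := hz.pj.idem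
  have zr := zr z hz (by rw [← mul_assoc, zi]) (by
    rintro (i | i)
    · rw [← qa i]; simp only [← mul_assoc, zi]
    · rw [← qb i]; simp only [← mul_assoc, zi])
  refine ⟨r, pr, zr, fun i => ?_⟩
  have zQ : z * (z * q i) = z * q i := by rw [← mul_assoc, hz.pj.idem]
  have qa := qa i
  have ra := ra i
  have rb := rb i
  have ea := s2 (Sum.inl i)
  have eb := s2 (Sum.inr i)
  have qb : z * q i * s (Sum.inr i) = 0 := by
    have e : (z * q i) * (z * (1 - q i)) = 0 := by
      rw [hz.c (1 - q i), ← mul_assoc, mul_assoc z, mul_sub, (hq i).pr.idem, mul_one, sub_self, mul_zero, zero_mul]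
    rw [← qb i, ← mul_assoc, e, zero_mul]
  have eQ := hQ i
  generalize s (Sum.inl i) = a' at *
  generalize s (Sum.inr i) = b' at *
  generalize z * q i = Q at *
  generalize z * p = e at *
  have pQ := eQ.pr
  have aQ := ea.pr.swap pQ qa
  have pd := ea.pr.sub pQ qa
  have x1 : r * (r * (Q - a')) = r * (Q - a') := by rw [← mul_assoc, pr.idem]
  have x2 : r * (Q - a') * Q = r * (Q - a') := by rw [mul_assoc, sub_mul, pQ.idem, aQ]
  have xa : r * (Q - a') * a' = 0 := by rw [mul_assoc, sub_mul, qa, ea.pr.idem, sub_self, mul_zero]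
  have xb : star (r * (Q - a')) * b' = 0 := by
    rw [star_mul, pd.sa, pr.sa, mul_assoc, rb, sub_mul, qb, ← aQ, mul_assoc, qb, mul_zero, sub_zero]
  have xn : ‖r * (Q - a') - r * Q‖ ≤ δ / 4 := by
    rw [mul_sub, sub_sub_cancel_left, norm_neg]; linarith
  generalize r * (Q - a') = x at *
  obtain ⟨a1, ha⟩ := exists_supp x
  obtain ⟨b1, hb⟩ := exists_supp (star x)
  have Qa1 := ha.le pQ x2
  have rb1 := hb.le pr (by have := st x1; rwa [pr.sa] at this)
  rw [← ha.op] at xa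
  rw [← hb.op] at xb
  have e1 : Eqv (Q - a1) e := by
    apply sb
    · exact (Le.of_le (ha.pj.sub pQ Qa1) pQ (by rw [mul_sub, pQ.idem, Qa1])).trans eQ.symm.le
    · exact ea.le.trans (Le.of_le ea.pr (ha.pj.sub pQ Qa1) (by rw [sub_mul, qa, xa, sub_zero]))
  have e2 : Eqv (r - b1) e := by
    apply sb
    · exact (Le.of_le (hb.pj.sub pr rb1) pr (by rw [mul_sub, pr.idem, rb1])).trans lr
    · exact eb.le.trans (Le.of_le eb.pr (hb.pj.sub pr rb1) (by rw [sub_mul, rb, xb, sub_zero]))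
  obtain ⟨q', h1, h2, h3, h4⟩ := pert_proj (δ := δ / 4) pQ pr x1 x2 ha hb (e1.trans e2.symm)
    (by linarith) (by linarith) xn hz zQ
  exact ⟨q', h1, h2, by linarith, h4⟩

theorem claim_side [Fintype ι] [Nonempty ι] {z p : A} {q : ι → A} {δ : ℝ} (hδ : 0 < δ) (hδ' : δ ≤ 1) (hz : Cn z)
    (hp : Pj p) (hle : Le (z * p) (z * (1 - p)))
    (hq : ∀ i, Eqv p (q i)) (hq' : ∀ i, Eqv (1 - p) (1 - q i)) : Claim z q δ := by
  obtain ⟨w, hw, h1, h2⟩ := halv_fin_split hp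
  have c1 : Claim (w * z) q δ := by
    refine claim_inf (p := p) hδ hδ' (hw.mul hz) ?_ ?_ hq hq'
    · rw [hw.c, mul_assoc]; exact h1.cut hz
    · rw [mul_assoc, mul_assoc]; exact hle.cut hw
  have c2 : Claim ((1 - w) * z) q δ := by
    refine claim_fin (p := p) hδ hδ' (hw.compl.mul hz) ?_ hq
    have pz := hz.pjm (hw.compl.pjm hp)
    have e : (1 - w) * z * p = z * ((1 - w) * p) := by rw [← mul_assoc z, ← hw.compl.c z]
    rw [e]
    refine h2.sub pz ?_
    rw [← mul_assoc, ← hz.c, mul_assoc z, h2.1.idem]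
  have := c1.glue hδ.le (hw.mul hz) (hw.compl.mul hz) (by
    rw [hw.c z, mul_assoc, ← mul_assoc z, hz.pj.idem, hz.c, ← mul_assoc, sub_mul, hw.pj.idem, one_mul, sub_self,
      zero_mul]) c2
  rwa [← add_mul, add_sub_cancel, one_mul] at this

theorem claimA [Fintype ι] [Nonempty ι] {p : A} {q : ι → A} {δ : ℝ} (hδ : 0 < δ)
    (hp : Pj p) (hq : ∀ i, Eqv p (q i)) (hq' : ∀ i, Eqv (1 - p) (1 - q i)) :
    ∃ r, Pj r ∧ ∀ i, ∃ q', Pj q' ∧ ‖q' - q i‖ ≤ δ ∧ ‖r - q'‖ < 1 := by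
  have h0 : 0 < min δ 1 := by positivity
  obtain ⟨z, hz, l1, l2⟩ := gc hp hp.compl
  have c1 : Claim z q (min δ 1) := claim_side h0 (min_le_right _ _) hz hp l1 hq hq'
  have c2 : Claim (1 - z) q (min δ 1) := by
    apply Claim.compl hz.compl
    refine claim_side h0 (min_le_right _ _) hz.compl hp.compl ?_ hq' (by simpa using hq)
    simpa using l2
  have c3 := c1.glue h0.le hz hz.compl (by rw [sub_mul, hz.pj.idem, one_mul, sub_self]) c2
  rw [add_sub_cancel] at c3
  obtain ⟨r, pr, -, h⟩ := c3
  refine ⟨r, pr, fun i => ?_⟩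
  obtain ⟨q', h1, -, h3, h4⟩ := h i
  rw [one_mul] at h3
  exact ⟨q', h1, h3.trans (min_le_left _ _), h4⟩

end cst8
end UO

namespace UO

section cst9
variable {A : Type*} [CStarAlgebra A]

theorem Iv.refl {r : A} (hr : Pj r) : Iv r r r r :=
  ⟨hr, hr, hr.idem, hr.idem, hr.idem, hr.idem, hr.idem, hr.idem⟩

theorem iv_of_unit {r v : A} (hr : Pj r) (hv : IsUnit v) (h : r * v = v * r) :
    ∃ w, Iv r r (v * r) w := by
  obtain ⟨u, rfl⟩ := hv
  have c1 : (↑u⁻¹ : A) * r = r * ↑u⁻¹ := by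
    rw [Units.inv_mul_eq_iff_eq_mul, ← mul_assoc, ← h, mul_assoc, Units.mul_inv, mul_one]
  have i := hr.idem
  have w1 := u.inv_mul
  have w2 := u.mul_inv
  generalize (↑u⁻¹ : A) = k at *
  generalize (↑u : A) = v at *
  refine ⟨k * r, hr, hr, ?_, ?_, ?_, ?_, ?_, ?_⟩
  · rw [← mul_assoc, h, mul_assoc, i]
  · rw [mul_assoc, i]
  · rw [← mul_assoc, ← c1, mul_assoc, i]
  · rw [mul_assoc, i]
  · rw [← h, mul_assoc, ← mul_assoc r r, i, h, ← mul_assoc, w1, one_mul]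
  · rw [c1, mul_assoc, ← mul_assoc r r, i, ← c1, ← mul_assoc, w2, one_mul]

/-- straight line contraction -/
noncomputable def Ct (r q : A) (s : ℝ) : A := PP r ((1 - s) • r + s • (q * r))

theorem ct_spec {r q : A} {s : ℝ} (hr : Pj r) (hq : Pj q) (h : ‖r - q‖ < 1) (h0 : 0 ≤ s) (h1 : s ≤ 1) :
    ∃ L B, ((1 - s) • r + s • (q * r)) * r = ((1 - s) • r + s • (q * r)) ∧
      L * ((1 - s) • r + s • (q * r)) = r ∧ Iv r (Ct r q s) ((1 - s) • r + s • (q * r)) B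
      ∧ ‖r - Ct r q s‖ < 1 := by
  have i := hr.idem
  obtain ⟨d, hd⟩ : ∃ d, d = r * ((r - q) * r) := ⟨_, rfl⟩
  have nd : ‖d‖ < 1 := by
    rw [hd]
    calc _ ≤ ‖r‖ * (‖r - q‖ * ‖r‖) := (norm_mul_le _ _).trans (by gcongr; exact norm_mul_le _ _)
      _ ≤ 1 * (‖r - q‖ * 1) := by gcongr <;> exact hr.norm_le
      _ < 1 := by linarith
  have nd' : ‖s • d‖ < 1 := by
    rw [norm_smul, Real.norm_of_nonneg h0]
    nlinarith [norm_nonneg d]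
  have rd : r * d = d := by rw [hd, ← mul_assoc, i]
  have dr : d * r = d := by rw [hd]; simp only [mul_assoc, i]
  obtain ⟨w, hw⟩ := iv_of_unit hr (isUnit_one_sub_of_norm_lt_one nd') (by
    rw [mul_sub, sub_mul, mul_smul_comm, smul_mul_assoc, rd, dr]; simp)
  obtain ⟨ξ, hξ⟩ : ∃ ξ, ξ = ((1 - s) • r + s • (q * r)) := ⟨_, rfl⟩
  have e : (1 - s • d) * r = r * ξ := by
    rw [hξ, sub_mul, smul_mul_assoc, dr, hd]
    simp only [mul_add, mul_smul_comm, mul_sub, sub_mul, i, sub_smul, one_smul, one_mul, smul_sub]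
    abel
  have x1 : ξ * r = ξ := by
    rw [hξ, add_mul, smul_mul_assoc, smul_mul_assoc, i, mul_assoc, i]
  rw [e] at hw
  have x2 : (w * r) * ξ = r := by rw [mul_assoc, hw.yx]
  obtain ⟨B, hB⟩ := PP_spec hr x1 x2
  unfold Ct
  rw [← hξ]
  exact ⟨_, B, x1, x2, hB, near_of hB hw⟩

theorem ct_zero {r q : A} (hr : Pj r) : Ct r q 0 = r := by
  unfold Ct; simp only [sub_zero, one_smul, zero_smul, add_zero]
  exact PP_eq (Iv.refl hr)

theorem ct_one {r q : A} (hr : Pj r) (hq : Pj q) (h : ‖r - q‖ < 1) : Ct r q 1 = q := by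
  unfold Ct; simp only [sub_self, one_smul, zero_smul, zero_add]
  rw [norm_sub_rev] at h
  obtain ⟨y, hy⟩ := (near_iff hr hq).1 h
  exact PP_eq hy

theorem ct_close {r q : A} {s δ : ℝ} (hr : Pj r) (hq : Pj q) (hδ : δ ≤ 1/2) (h : ‖r - q‖ ≤ δ)
    (h0 : 0 ≤ s) (h1 : s ≤ 1) : ‖Ct r q s - r‖ ≤ 2 * δ := by
  obtain ⟨L, B, -, -, hB, -⟩ := ct_spec hr hq (by linarith : ‖r - q‖ < 1) h0 h1
  apply hB.close hδ
  have e : (1 - s) • r + s • (q * r) - r = s • ((q - r) * r) := by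
    rw [sub_mul, hr.idem, smul_sub, sub_smul, one_smul]; abel
  rw [e, norm_smul, Real.norm_of_nonneg h0]
  have : ‖(q - r) * r‖ ≤ ‖r - q‖ * 1 := by
    rw [norm_sub_rev]
    exact (norm_mul_le _ _).trans (by gcongr; exact hr.norm_le)
  nlinarith [norm_nonneg ((q - r) * r)]

theorem ct_cont {T : Type*} [TopologicalSpace T] {r : A} {q : T → A} {s : T → ℝ} (cq : Continuous q) (cs : Continuous s)
    (hr : Pj r) (hq : ∀ t, Pj (q t)) (h : ∀ t, ‖r - q t‖ < 1) (h0 : ∀ t, 0 ≤ s t) (h1 : ∀ t, s t ≤ 1) :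
    Continuous fun t => Ct r (q t) (s t) := by
  unfold Ct
  apply PP_cont (q := fun _ => r) continuous_const (by fun_prop)
  intro t
  obtain ⟨L, B, a, b, -⟩ := ct_spec hr (hq t) (h t) (h0 t) (h1 t)
  exact ⟨L, hr, a, b⟩

/-- unitary orbit -/
def Orb (p q : A) : Prop := ∃ u : A, star u * u = 1 ∧ u * star u = 1 ∧ q = u * p * star u

theorem Orb.eqv [VNR A] {p q : A} (hp : Pj p) (h : Orb p q) : Eqv p q ∧ Eqv (1 - p) (1 - q) := by
  obtain ⟨u, h1, h2, rfl⟩ := h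
  have P : PI u (1:A) 1 := PI.mk2 h1 (mul_one 1) h2
  refine ⟨⟨_, P.restr hp (one_mul _)⟩, ?_⟩
  have e : 1 - u * p * star u = u * (1 - p) * star u := by
    rw [mul_sub, sub_mul, mul_one, h2]
  rw [e]
  exact ⟨_, P.restr hp.compl (one_mul _)⟩

theorem Orb.pj [VNR A] {p q : A} (hp : Pj p) (h : Orb p q) : Pj q := (h.eqv hp).1.pr

theorem Orb.of_eqv [VNR A] {p q : A} (h : Eqv p q) (h' : Eqv (1 - p) (1 - q)) : Orb p q := by
  obtain ⟨v, hv⟩ := h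
  obtain ⟨w, hw⟩ := h'
  have k := hv.add hw (by rw [sub_mul, one_mul, hv.pe.idem, sub_self])
    (by rw [sub_mul, one_mul, hv.pf.idem, sub_self])
  refine ⟨v + w, ?_, ?_, ?_⟩
  · rw [k.src]; abel
  · rw [k.tgt]; abel
  · have e1 : (v + w) * p = v := by
      have : w * p = 0 := by rw [← hw.vr, mul_assoc, sub_mul, one_mul, hv.pe.idem, sub_self, mul_zero]
      rw [add_mul, hv.vr, this, add_zero]
    have e2 : v * star w = 0 := by
      rw [← hv.vr, ← hw.sl, mul_assoc, ← mul_assoc p, mul_sub, mul_one, hv.pe.idem, sub_self, zero_mul, mul_zero]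
    rw [e1, star_add, mul_add, e2, hv.tgt, add_zero]

theorem Orb.near [VNR A] {p q r : A} (hp : Pj p) (h : Orb p q) (hr : Pj r) (hn : ‖r - q‖ < 1) : Orb p r := by
  have k := h.eqv hp
  obtain ⟨y, hy⟩ := (near_iff k.1.pr hr).1 hn
  obtain ⟨y', hy'⟩ := (near_iff k.1.pr.compl hr.compl).1 (by
    have : (1 - r) - (1 - q) = -(r - q) := by abel
    rwa [this, norm_neg])
  exact Orb.of_eqv (k.1.trans hy.eqv) (k.2.trans hy'.eqv)

theorem Orb.self (p : A) : Orb p p := ⟨1, by simp, by simp, by simp⟩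

theorem orb_path [VNR A] {p : A} (hp : Pj p) {g : unitInterval → A} (hg : Continuous g) (hpj : ∀ t, Pj (g t))
    (h0 : Orb p (g 0)) (t) : Orb p (g t) := by
  have op : ∀ t, ∀ᶠ s in nhds t, ‖g s - g t‖ < 1 := fun t => by
    have : Continuous fun s => ‖g s - g t‖ := by fun_prop
    exact this.continuousAt.eventually_lt continuousAt_const (by simp)
  have : IsClopen {t | Orb p (g t)} := by
    constructor
    · rw [← isOpen_compl_iff, isOpen_iff_eventually]
      intro t ht
      filter_upwards [op t] with s hs hs'
      exact ht (Orb.near hp hs' (hpj t) (by rwa [norm_sub_rev]))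
    · rw [isOpen_iff_eventually]
      intro t ht
      filter_upwards [op t] with s hs
      exact Orb.near hp ht (hpj s) hs
  have := this.eq_univ ⟨0, h0⟩
  have k : t ∈ {t | Orb p (g t)} := by rw [this]; trivial
  exact k

end cst9
end UO

namespace UO

section cst10
variable {A : Type*} [CStarAlgebra A]

theorem posneg' (a : A) (ha : star a = a) : ∃ P N : A, star P = P ∧ star N = N ∧ a = P - N ∧ P * N = 0 ∧
    (∀ b, a * b = b * a → P * b = b * P) ∧
    (letI := CStarAlgebra.spectralOrder A; 0 ≤ P ∧ 0 ≤ N) := by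
  letI := CStarAlgebra.spectralOrder A
  letI := CStarAlgebra.spectralOrderedRing A
  have hP : 0 ≤ a⁺ := CFC.posPart_nonneg a
  have hN : 0 ≤ a⁻ := CFC.negPart_nonneg a
  refine ⟨a⁺, a⁻, (IsSelfAdjoint.of_nonneg hP).star_eq, (IsSelfAdjoint.of_nonneg hN).star_eq,
    (CFC.posPart_sub_negPart a ha).symm, CFC.posPart_mul_negPart a, ?_, hP, hN⟩
  intro b hb
  rw [CFC.posPart_def]
  exact Commute.cfcₙ_real (show Commute a b from hb) _

theorem norm_mul_le_of_le {e c x : A} (h : letI := CStarAlgebra.spectralOrder A; star e * e ≤ star c * c) :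
    ‖e * x‖ ≤ ‖c * x‖ := by
  letI := CStarAlgebra.spectralOrder A
  letI := CStarAlgebra.spectralOrderedRing A
  have k := star_left_conjugate_le_conjugate h x
  have e1 : star x * (star e * e) * x = star (e * x) * (e * x) := by simp only [star_mul, mul_assoc]
  have e2 : star x * (star c * c) * x = star (c * x) * (c * x) := by simp only [star_mul, mul_assoc]
  rw [e1, e2] at k
  have := CStarAlgebra.norm_le_norm_of_nonneg_of_le (star_mul_self_nonneg _) k
  rw [CStarRing.norm_star_mul_self, CStarRing.norm_star_mul_self] at this
  nlinarith [norm_nonneg (e * x), norm_nonneg (c * x)]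

variable [VNR A]

theorem Supp.comm {P e b : A} (h : Supp P e) (h1 : P * b = b * P) (h2 : P * star b = star b * P) : e * b = b * e := by
  have pe := h.pj
  have m := h.mul_self
  have k : ∀ b, P * b = b * P → e * b = e * b * e := by
    intro b hb
    have : e * (b * (1 - e)) = 0 := by
      rw [h.op, ← mul_assoc, hb, mul_assoc, mul_sub, mul_one, m, sub_self, mul_zero]
    rw [mul_sub, mul_sub, mul_one, sub_eq_zero, ← mul_assoc] at this
    exact this
  have k1 := k b h1
  have k2 := st (k _ h2)
  simp only [star_mul, star_star, pe.sa] at k2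
  rw [k1, k2, mul_assoc]

/-- data from the real part of a unitary -/
theorem unitary_data {u : A} (h1 : star u * u = 1) (h2 : u * star u = 1) :
    ∃ e : A, Pj e ∧ (∀ b, b * u = u * b → star b * u = u * star b → e * b = b * e) ∧
    (letI := CStarAlgebra.spectralOrder A; star e * e ≤ star (u - 1) * (u - 1)
      ∧ 0 ≤ (1 - (2:ℝ) • e) * (u + star u)) := by
  letI := CStarAlgebra.spectralOrder A
  letI := CStarAlgebra.spectralOrderedRing A
  obtain ⟨P, N, sP, sN, ha, hPN, hc, p0, n0⟩ := posneg' (u + star u) (by simp [add_comm])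
  obtain ⟨e0, he0⟩ := exists_supp P
  have pe := he0.pj
  have m1 := he0.mul_self
  have m2 : e0 * P = P := by have := st m1; rwa [sP, pe.sa] at this
  have eN : e0 * N = 0 := (he0.op N).2 hPN
  have Ne : N * e0 = 0 := by have := st eN; rwa [sN, pe.sa, star_zero] at this
  have cc : ∀ b, b * u = u * b → star b * u = u * star b → e0 * b = b * e0 := by
    intro b hb1 hb2
    have hb3 := st hb1
    have hb4 := st hb2
    simp only [star_mul, star_star] at hb3 hb4
    apply he0.comm
    · exact hc b (by rw [add_mul, mul_add, hb4, hb1])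
    · exact hc _ (by rw [add_mul, mul_add, hb3, hb2])
  refine ⟨1 - e0, pe.compl, ?_, ?_, ?_⟩
  · intro b hb1 hb2
    rw [sub_mul, mul_sub, cc b hb1 hb2, one_mul, mul_one]
  · rw [pe.compl.sa, pe.compl.idem]
    have q : 0 ≤ star (u - 1) * (u - 1) := star_mul_self_nonneg _
    have q1 := star_left_conjugate_nonneg q e0
    have e1 : star (u - 1) * (u - 1) = 2 - (u + star u) := by
      rw [star_sub, star_one, sub_mul, mul_sub, h1, mul_one, one_mul, ← one_add_one_eq_two]; abel
    rw [e1, ha, pe.sa] at q1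
    have e2 : e0 * (2 - (P - N)) * e0 = e0 + e0 - P := by
      have : (2:A) = 1 + 1 := one_add_one_eq_two.symm
      rw [this]
      simp only [mul_sub, mul_add, sub_mul, add_mul, mul_one, eN, zero_mul, m2, m1, pe.idem]; abel
    rw [e2] at q1
    rw [e1, ha, ← sub_nonneg]
    have e3 : 2 - (P - N) - (1 - e0) = (e0 + e0 - P) + (1 - e0) + N := by
      rw [← one_add_one_eq_two]; abel
    rw [e3]
    exact add_nonneg (add_nonneg q1 pe.compl.nonneg) n0
  · rw [ha]
    have e3 : (1 - (2:ℝ) • (1 - e0)) * (P - N) = P + N := by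
      rw [two_smul]
      simp only [mul_sub, sub_mul, add_mul, one_mul, eN, m2]; abel
    rw [e3]
    exact add_nonneg p0 n0

/-- admissible units between 1 and u -/
def SU (u : A) : Set A := {g | IsUnit g ∧ (∀ x, ‖(g - 1) * x‖ ≤ 3 * ‖(u - 1) * x‖) ∧
    ∀ b, b * u = u * b → star b * u = u * star b → g * b = b * g}

theorem unitary_joined {u : A} (h1 : star u * u = 1) (h2 : u * star u = 1) : JoinedIn (SU u) 1 u := by
  letI := CStarAlgebra.spectralOrder A
  letI := CStarAlgebra.spectralOrderedRing A
  obtain ⟨e, pe, hc, le, pos⟩ := unitary_data h1 h2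
  have i := pe.idem
  have ne : ∀ x, ‖e * x‖ ≤ ‖(u - 1) * x‖ := fun x => norm_mul_le_of_le le
  have A1 : JoinedIn (SU u) 1 (1 - (2:ℝ) • e) := by
    let c : ℝ → ℂ := fun s => Complex.exp (Real.pi * s * Complex.I)
    have nc : ∀ s, ‖c s‖ = 1 := fun s => by
      simp only [c]; rw [← Complex.ofReal_mul, Complex.norm_exp_ofReal_mul_I]
    refine ⟨⟨⟨fun s => 1 + (c s - 1) • e, by fun_prop⟩, ?_, ?_⟩, ?_⟩
    · simp [c]
    · simp only [c, Set.Icc.coe_one, Complex.ofReal_one, mul_one, Complex.exp_pi_mul_I]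
      rw [show ((-1:ℂ) - 1) = -2 by norm_num, neg_smul, ← sub_eq_add_neg]
      rw [two_smul, two_smul]
    · intro s
      refine ⟨?_, ?_, ?_⟩
      · have key : ∀ a b : ℂ, a * b = 1 → (1 + (a - 1) • e) * (1 + (b - 1) • e) = 1 := by
          intro a b hab
          simp only [mul_add, add_mul, one_mul, mul_one, smul_mul_assoc, mul_smul_comm, i, smul_smul]
          have e1 : a - 1 + (b - 1) + (a - 1) * (b - 1) = 0 := by linear_combination hab
          have e2 : 1 + (a - 1) • e + (b - 1) • (e + (a - 1) • e) = 1 + (a - 1 + (b - 1) + (a - 1) * (b - 1)) • e := by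
            module
          rw [e2, e1, zero_smul, add_zero]
        have c0 : c s ≠ 0 := by rw [← norm_ne_zero_iff, nc]; norm_num
        exact ⟨⟨_, 1 + ((c s)⁻¹ - 1) • e, key _ _ (mul_inv_cancel₀ c0), key _ _ (inv_mul_cancel₀ c0)⟩, rfl⟩
      · intro x
        show ‖(1 + (c s - 1) • e - 1) * x‖ ≤ _
        rw [add_sub_cancel_left, smul_mul_assoc, norm_smul]
        have : ‖c s - 1‖ ≤ 2 := by
          refine (norm_sub_le _ _).trans ?_
          rw [nc]; norm_num
        have := ne x
        nlinarith [norm_nonneg (e * x), norm_nonneg (c s - 1)]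
      · intro b hb1 hb2
        show (1 + (c s - 1) • e) * b = b * (1 + (c s - 1) • e)
        rw [add_mul, mul_add, smul_mul_assoc, mul_smul_comm, hc b hb1 hb2, one_mul, mul_one]
  refine A1.trans ?_
  have eu : e * u = u * e := hc u rfl (by rw [h1, h2])
  have eus : e * star u = star u * e := hc _ (by rw [h1, h2]) (by rw [star_star])
  obtain ⟨j, hj⟩ : ∃ j, j = 1 - (2:ℝ) • e := ⟨_, rfl⟩
  have jj : j * j = 1 := by
    rw [hj, two_smul]
    simp only [mul_sub, sub_mul, mul_add, add_mul, one_mul, mul_one, i]; abel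
  have js : star j = j := by rw [hj, two_smul]; simp [pe.sa]
  have ju : j * u = u * j := by rw [hj, sub_mul, mul_sub, smul_mul_assoc, mul_smul_comm, eu]; simp
  have jus : j * star u = star u * j := by rw [hj, sub_mul, mul_sub, smul_mul_assoc, mul_smul_comm, eus]; simp
  rw [← hj] at pos ⊢
  refine ⟨⟨⟨fun s => (1 - (s:ℝ)) • j + (s:ℝ) • u, by fun_prop⟩, ?_, ?_⟩, ?_⟩
  · simp
  · simp
  · intro s
    obtain ⟨s, s0, s1⟩ := s
    refine ⟨?_, ?_, ?_⟩
    · show IsUnit ((1 - s) • j + s • u)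
      obtain ⟨g, hg⟩ : ∃ g, g = (1 - s) • j + s • u := ⟨_, rfl⟩
      rw [← hg]
      have gs : star g = (1 - s) • j + s • star u := by rw [hg]; simp [js]
      have e1 : star g * g = ((1-s)^2 + s^2) • (1:A) + (s * (1-s)) • (j * (u + star u)) := by
        rw [gs, hg]
        simp only [mul_add, add_mul, smul_mul_assoc, mul_smul_comm, smul_smul, jj, h1, ← jus, smul_add]
        module
      have e2 : g * star g = star g * g := by
        rw [e1, gs, hg]
        simp only [mul_add, add_mul, smul_mul_assoc, mul_smul_comm, smul_smul, jj, h2, ← ju, smul_add]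
        module
      have un : IsUnit (star g * g) := by
        apply unit_of_ge (c := 1/2) (by norm_num)
        rw [e1, Algebra.algebraMap_eq_smul_one]
        have a1 : (0:A) ≤ (s * (1-s)) • (j * (u + star u)) := smul_nonneg (mul_nonneg s0 (by linarith)) pos
        have a2 : (1/2:ℝ) • (1:A) ≤ ((1-s)^2 + s^2) • (1:A) := by
          apply smul_le_smul_of_nonneg_right _ zero_le_one
          nlinarith [sq_nonneg (1 - 2 * s)]
        exact a2.trans (le_add_of_nonneg_right a1)
      exact ((show Commute (star g) g from e2.symm).isUnit_mul_iff.1 un).2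
    · intro x
      show ‖((1 - s) • j + s • u - 1) * x‖ ≤ _
      have : ((1 - s) • j + s • u - 1) * x = (-(2 * (1 - s))) • (e * x) + s • ((u - 1) * x) := by
        rw [← smul_mul_assoc, ← smul_mul_assoc, ← add_mul]; congr 1
        rw [hj]; module
      rw [this]
      refine (norm_add_le _ _).trans ?_
      rw [norm_smul, norm_smul, norm_neg, Real.norm_of_nonneg s0, Real.norm_of_nonneg (by linarith)]
      have := ne x
      nlinarith [norm_nonneg (e * x), norm_nonneg ((u - 1) * x)]
    · intro b hb1 hb2
      show ((1 - s) • j + s • u) * b = b * ((1 - s) • j + s • u)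
      have : j * b = b * j := by
        rw [hj, sub_mul, mul_sub, smul_mul_assoc, mul_smul_comm, hc b hb1 hb2]; simp
      rw [add_mul, mul_add, smul_mul_assoc, mul_smul_comm, smul_mul_assoc, mul_smul_comm, this, hb1]

end cst10
end UO

namespace UO

section ord11
variable {A : Type*} [CStarAlgebra A] [PartialOrder A] [StarOrderedRing A]

theorem norm_le_of_bounds {x : A} {c : ℝ} (hc : 0 ≤ c) (hx : star x = x) (h1 : x ≤ algebraMap ℝ A c)
    (h2 : -algebraMap ℝ A c ≤ x) : ‖x‖ ≤ c := by
  apply norm_of_sq_le hc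
  have a1 : 0 ≤ algebraMap ℝ A c - x := sub_nonneg.2 h1
  have a2 : 0 ≤ algebraMap ℝ A c + x := by
    have := sub_nonneg.2 h2
    rwa [sub_neg_eq_add, add_comm] at this
  have cm : algebraMap ℝ A c * x = x * algebraMap ℝ A c := Algebra.commutes c x
  have e : (algebraMap ℝ A c - x) * (algebraMap ℝ A c + x) = algebraMap ℝ A (c^2) - x * x := by
    rw [pow_two, map_mul, sub_mul, mul_add, mul_add, cm]; abel
  have e' : (algebraMap ℝ A c + x) * (algebraMap ℝ A c - x) = algebraMap ℝ A (c^2) - x * x := by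
    rw [pow_two, map_mul, add_mul, mul_sub, mul_sub, cm]; abel
  have := Commute.mul_nonneg a1 a2 (by rw [Commute, SemiconjBy, e, e'])
  rw [e] at this
  rw [hx]
  exact sub_nonneg.1 this

theorem sqrt_half {H K : A} {c : ℝ} (hc : 0 ≤ c) (hH : 0 ≤ H) (hK : 0 ≤ K) (h : ‖H * H - K * K‖ ≤ c ^ 2) :
    H ≤ K + algebraMap ℝ A c := by
  have c0 : 0 ≤ algebraMap ℝ A c := by
    rw [Algebra.algebraMap_eq_smul_one]; exact smul_nonneg hc zero_le_one
  have sH := (IsSelfAdjoint.of_nonneg hH).star_eq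
  have sK := (IsSelfAdjoint.of_nonneg hK).star_eq
  have k1 : H * H - K * K ≤ algebraMap ℝ A (c ^ 2) := by
    have : IsSelfAdjoint (H * H - K * K) := by
      rw [isSelfAdjoint_iff, star_sub, star_mul, star_mul, sH, sK]
    exact this.le_algebraMap_norm_self.trans (algebraMap_mono_ord h)
  have k2 : H * H ≤ (K + algebraMap ℝ A c) * (K + algebraMap ℝ A c) := by
    have e : (K + algebraMap ℝ A c) * (K + algebraMap ℝ A c) = (K * K + algebraMap ℝ A (c^2)) + (c • K + c • K) := by
      rw [pow_two, map_mul, Algebra.algebraMap_eq_smul_one]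
      simp only [add_mul, mul_add, smul_mul_assoc, mul_smul_comm, mul_one, one_mul, smul_add]; abel
    rw [e]
    refine le_add_of_le_of_nonneg ?_ (add_nonneg (smul_nonneg hc hK) (smul_nonneg hc hK))
    rw [add_comm]; exact sub_le_iff_le_add.1 k1
  have k3 := CFC.sqrt_le_sqrt _ _ k2
  rwa [CFC.sqrt_mul_self _ hH, CFC.sqrt_mul_self _ (add_nonneg hK c0)] at k3

theorem sqrt_norm {H K : A} {c : ℝ} (hc : 0 ≤ c) (hH : 0 ≤ H) (hK : 0 ≤ K) (h : ‖H * H - K * K‖ ≤ c ^ 2) :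
    ‖H - K‖ ≤ c := by
  have sH := (IsSelfAdjoint.of_nonneg hH).star_eq
  have sK := (IsSelfAdjoint.of_nonneg hK).star_eq
  apply norm_le_of_bounds hc
  · rw [star_sub, sH, sK]
  · rw [sub_le_iff_le_add, add_comm]; exact sqrt_half hc hH hK h
  · have := sqrt_half hc hK hH (by rwa [norm_sub_rev])
    rw [neg_le_sub_iff_le_add]; exact this

/-- polar decomposition of a unit -/
structure PU (X H U : A) : Prop where
  pos : 0 ≤ H
  sa : star H = H
  un : IsUnit H
  sq : H * H = star X * X
  eq : X = U * H
  u1 : star U * U = 1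
  u2 : U * star U = 1
  cm : ∀ q, star q = q → q * X = X * q → q * H = H * q ∧ q * U = U * q

theorem polar_unit {X : A} (hX : IsUnit X) : ∃ H U, PU X H U := by
  have p0 : 0 ≤ star X * X := star_mul_self_nonneg X
  have hX' : IsUnit (star X * X) := hX.star.mul hX
  obtain ⟨H, hH⟩ : ∃ H, H = CFC.sqrt (star X * X) := ⟨_, rfl⟩
  have h0 : 0 ≤ H := hH ▸ CFC.sqrt_nonneg _
  have sH := (IsSelfAdjoint.of_nonneg h0).star_eq
  have hh : H * H = star X * X := by rw [hH]; exact CFC.sqrt_mul_sqrt_self _ p0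
  have uH : IsUnit H := by
    rw [← hh] at hX'
    exact ((Commute.refl H).isUnit_mul_iff.1 hX').1
  have cH : ∀ q, star q = q → q * X = X * q → q * H = H * q := by
    intro q sq hq
    have hq' := st hq
    simp only [star_mul, sq] at hq'
    have : Commute (star X * X) q := by
      rw [Commute, SemiconjBy, mul_assoc, ← hq, ← mul_assoc, hq', mul_assoc]
    rw [hH, CFC.sqrt_eq_cfc]
    exact (this.cfc_nnreal _).symm
  obtain ⟨k, hk⟩ := uH
  obtain ⟨x, hx⟩ := hX
  have w1 := k.inv_mul
  have w2 := k.mul_inv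
  rw [hk] at w1 w2
  have sk : star (↑k⁻¹ : A) = ↑k⁻¹ := by
    have := st w2
    rw [star_one, sH] at this
    rw [← Units.mul_eq_one_iff_eq_inv, hk]; exact this
  have u1 : star (X * ↑k⁻¹) * (X * ↑k⁻¹) = 1 := by
    rw [star_mul, sk]
    calc _ = ↑k⁻¹ * (star X * X) * ↑k⁻¹ := by simp only [mul_assoc]
      _ = 1 := by rw [← hh, ← mul_assoc, w1, one_mul, w2]
  have uU : IsUnit (X * (↑k⁻¹ : A)) := by
    rw [← hx]; exact (x * k⁻¹).isUnit
  refine ⟨H, X * ↑k⁻¹, h0, sH, ⟨k, hk⟩, hh, ?_, u1, ?_, ?_⟩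
  · rw [mul_assoc, w1, mul_one]
  · obtain ⟨v, hv⟩ := uU
    rw [← hv] at u1 ⊢
    rw [Units.mul_eq_one_iff_eq_inv.1 u1, Units.mul_inv]
  · intro q sq hq
    have c := cH q sq hq
    refine ⟨c, ?_⟩
    have c1 : q * (↑k⁻¹ : A) = ↑k⁻¹ * q := by
      calc q * (↑k⁻¹ : A) = (↑k⁻¹ * H) * q * ↑k⁻¹ := by rw [w1, one_mul]
        _ = ↑k⁻¹ * (H * q) * ↑k⁻¹ := by simp only [mul_assoc]
        _ = _ := by rw [← c, mul_assoc, mul_assoc, w2, mul_one]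
    rw [← mul_assoc, hq, mul_assoc, c1, mul_assoc]

theorem unit_convex {H K : A} {s : ℝ} (h0 : 0 ≤ s) (h1 : s ≤ 1) (hH : 0 ≤ H) (hK : 0 ≤ K) (uH : IsUnit H)
    (uK : IsUnit K) : IsUnit ((1 - s) • H + s • K) := by
  rcases h1.eq_or_lt with rfl | h1
  · simpa using uK
  · have ne : (1 - s) ≠ 0 := by linarith
    have sp : IsStrictlyPositive ((1 - s) • H) := by
      rw [IsStrictlyPositive.iff_of_unital]
      exact ⟨smul_nonneg (by linarith) hH, (isUnit_smul_iff (Units.mk0 _ ne) H).2 uH⟩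
    exact CStarAlgebra.isUnit_of_le ((1 - s) • H) (le_add_of_nonneg_right (smul_nonneg h0 hK)) sp

end ord11

section cst11
variable {A : Type*} [CStarAlgebra A] [VNR A]

/-- units commuting with q close to X -/
def SX (q X : A) (κ : ℝ) : Set A := {Z | IsUnit Z ∧ q * Z = Z * q ∧ ‖Z - X‖ ≤ κ}

theorem norm_unitary_mul {U : A} (h : star U * U = 1) (x : A) : ‖U * x‖ ≤ ‖x‖ := by
  have h1 := CStarRing.norm_star_mul_self (x := U * x)
  have e : star (U * x) * (U * x) = star x * x := by
    rw [star_mul]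
    calc _ = star x * (star U * U) * x := by simp only [mul_assoc]
      _ = _ := by rw [h, mul_one]
  rw [e, CStarRing.norm_star_mul_self] at h1
  nlinarith [norm_nonneg x, norm_nonneg (U * x)]

theorem unit_join {q X Y : A} {η : ℝ} (h0 : 0 ≤ η) (h1 : η ≤ 1) (hq : Pj q) (uX : IsUnit X) (uY : IsUnit Y)
    (cX : q * X = X * q) (cY : q * Y = Y * q) (nX : ‖X‖ ≤ 2) (nY : ‖Y‖ ≤ 2) (hXY : ‖X - Y‖ ≤ η ^ 2) :
    JoinedIn (SX q X (9 * η)) X Y := by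
  letI := CStarAlgebra.spectralOrder A
  letI := CStarAlgebra.spectralOrderedRing A
  obtain ⟨H, U, P⟩ := polar_unit uX
  obtain ⟨K, V, Q⟩ := polar_unit uY
  obtain ⟨c1, c2⟩ := P.cm q hq.sa cX
  obtain ⟨d1, d2⟩ := Q.cm q hq.sa cY
  have c3 := st c2
  have d3 := st d2
  simp only [star_mul, hq.sa] at c3 d3
  have nHK : ‖H - K‖ ≤ 2 * η := by
    apply sqrt_norm (by positivity) P.pos Q.pos
    rw [P.sq, Q.sq]
    have e : star X * X - star Y * Y = star X * (X - Y) + star (X - Y) * Y := by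
      rw [star_sub, mul_sub, sub_mul]; abel
    rw [e]
    refine (norm_add_le _ _).trans ?_
    have a1 := norm_mul_le (star X) (X - Y)
    have a2 := norm_mul_le (star (X - Y)) Y
    rw [norm_star] at a1 a2
    nlinarith [norm_nonneg X, norm_nonneg Y, norm_nonneg (X - Y)]
  have nVH : ‖V * H - X‖ ≤ 3 * η := by
    have e : V * H - X = V * (H - K) + (Y - X) := by rw [mul_sub, ← Q.eq]; abel
    rw [e]
    refine (norm_add_le _ _).trans ?_
    have := norm_unitary_mul Q.u1 (H - K)
    rw [norm_sub_rev Y]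
    nlinarith
  obtain ⟨W, hW⟩ : ∃ W, W = V * star U := ⟨_, rfl⟩
  have w1 : star W * W = 1 := by
    rw [hW, star_mul, star_star]
    calc _ = U * (star V * V) * star U := by simp only [mul_assoc]
      _ = 1 := by rw [Q.u1, mul_one, P.u2]
  have w2 : W * star W = 1 := by
    rw [hW, star_mul, star_star]
    calc _ = V * (star U * U) * star V := by simp only [mul_assoc]
      _ = 1 := by rw [P.u1, mul_one, Q.u2]
  have wX : W * X = V * H := by
    rw [hW]; nth_rw 1 [P.eq]
    calc _ = V * (star U * U) * H := by simp only [mul_assoc]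
      _ = _ := by rw [P.u1, mul_one]
  have qW : q * W = W * q := by
    rw [hW, ← mul_assoc, d2, mul_assoc, ← c3, mul_assoc]
  have J1 : JoinedIn (SX q X (9 * η)) X (V * H) := by
    obtain ⟨γ, hγ⟩ := unitary_joined w1 w2
    refine ⟨⟨⟨fun s => γ s * X, by fun_prop⟩, by simp, by simp [wX]⟩, ?_⟩
    intro s
    obtain ⟨g1, g2, g3⟩ := hγ s
    refine ⟨g1.mul uX, ?_, ?_⟩
    · show q * (γ s * X) = γ s * X * q
      rw [← mul_assoc, ← g3 q qW (by rw [hq.sa, qW]), mul_assoc, cX, mul_assoc]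
    · show ‖γ s * X - X‖ ≤ _
      have := g2 X
      rw [sub_mul, sub_mul, one_mul, wX] at this
      linarith
  refine J1.trans ?_
  refine ⟨⟨⟨fun s => V * ((1 - (s:ℝ)) • H + (s:ℝ) • K), by fun_prop⟩, by simp, by simp [← Q.eq]⟩, ?_⟩
  rintro ⟨s, s0, s1⟩
  refine ⟨?_, ?_, ?_⟩
  · exact (show IsUnit V from ⟨⟨V, star V, Q.u2, Q.u1⟩, rfl⟩).mul (unit_convex s0 s1 P.pos Q.pos P.un Q.un)
  · show q * (V * ((1 - s) • H + s • K)) = V * ((1 - s) • H + s • K) * q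
    rw [← mul_assoc, d2, mul_assoc, mul_assoc]
    congr 1
    rw [mul_add, add_mul, mul_smul_comm, mul_smul_comm, smul_mul_assoc, smul_mul_assoc, c1, d1]
  · show ‖V * ((1 - s) • H + s • K) - X‖ ≤ _
    have e : V * ((1 - s) • H + s • K) - X = (V * H - X) - s • (V * (H - K)) := by
      rw [mul_add, mul_smul_comm, mul_smul_comm, mul_sub]; module
    rw [e]
    refine (norm_sub_le _ _).trans ?_
    rw [norm_smul, Real.norm_of_nonneg s0]
    have := norm_unitary_mul Q.u1 (H - K)
    nlinarith [norm_nonneg (V * (H - K))]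

end cst11
end UO

namespace UO

section cst12
variable {A : Type*} [CStarAlgebra A] [VNR A]

theorem iv_unit {q a b : A} (h : Iv q q a b) : IsUnit (a + (1 - q)) := by
  obtain ⟨a1, -, a3, a4, a5, a6, a7, a8⟩ := h
  have i := a1.idem
  refine ⟨⟨a + (1 - q), b + (1 - q), ?_, ?_⟩, rfl⟩
  · simp only [mul_sub, sub_mul, mul_add, add_mul, mul_one, one_mul, a3, a4, a5, a6, a7, a8, i]; abel
  · simp only [mul_sub, sub_mul, mul_add, add_mul, mul_one, one_mul, a3, a4, a5, a6, a7, a8, i]; abel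

theorem PI.iv {u q r : A} (h : PI u q r) : Iv q r u (star u) :=
  ⟨h.pe, h.pf, h.vl, h.vr, h.sl, h.sr, h.src, h.tgt⟩

theorem iv_two {r q a : A} (hr : Pj r) (hq : Pj q) (ha : Pj a) (h1 : ‖a - q‖ < 1) (h2 : ‖r - a‖ < 1) :
    ∃ y, Iv q r (r * a * q) y := by
  obtain ⟨y1, k1⟩ := (near_iff hq ha).1 h1
  obtain ⟨y2, k2⟩ := (near_iff ha hr).1 h2
  have := k1.trans k2
  have e : r * a * (a * q) = r * a * q := by
    rw [← mul_assoc, mul_assoc r a a, ha.idem]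
  rw [e] at this
  exact ⟨_, this⟩

/-- projections close to both r and q -/
def SR (r q : A) : Set A := {w | Pj w ∧ ‖r - w‖ < 1 ∧ ‖q - w‖ < 1}

theorem local_join {r q a b : A} (hr : Pj r) (hq : Pj q) (ha : Pj a) (hb : Pj b)
    (na : ‖a - q‖ ≤ 1/5000) (nb : ‖b - q‖ ≤ 1/5000) (ra : ‖r - a‖ < 1) (rb : ‖r - b‖ < 1) :
    JoinedIn (SR r q) a b := by
  obtain ⟨ya, ia⟩ := iv_two hr hq ha (by linarith) ra
  obtain ⟨yb, ib⟩ := iv_two hr hq hb (by linarith) rb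
  obtain ⟨u, hu⟩ := ia.eqv
  have iu := hu.iv
  have i := hq.idem
  have nu : ‖star u‖ ≤ 1 := hu.symm.norm_le
  have nu' : ‖u‖ ≤ 1 := hu.norm_le
  have nr := hr.norm_le
  have nq := hq.norm_le
  have nq' := hq.compl.norm_le
  have nr' := hr.compl.norm_le
  have na' := ha.norm_le
  have nb' := hb.norm_le
  have nab : ‖a - b‖ ≤ 1/2500 := by
    have : a - b = (a - q) - (b - q) := by abel
    rw [this]; refine (norm_sub_le _ _).trans ?_; linarith
  obtain ⟨X, hX⟩ : ∃ X, X = star u * (r * a * q) + (1 - q) := ⟨_, rfl⟩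
  obtain ⟨Y, hY⟩ : ∃ Y, Y = star u * (r * b * q) + (1 - q) := ⟨_, rfl⟩
  have uX : IsUnit X := hX ▸ iv_unit (ia.trans iu.symm)
  have uY : IsUnit Y := hY ▸ iv_unit (ib.trans iu.symm)
  have sl := hu.sl
  have cc : ∀ a, q * (star u * (r * a * q) + (1 - q)) = (star u * (r * a * q) + (1 - q)) * q := by
    intro a
    simp only [mul_sub, sub_mul, mul_add, add_mul, mul_one, one_mul, i, sub_self, add_zero]
    rw [← mul_assoc, sl]; simp only [mul_assoc, i]
  have n3 : ∀ x y z : A, ‖x‖ ≤ 1 → ‖z‖ ≤ 1 → ‖x * y * z‖ ≤ ‖y‖ := by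
    intro x y z hx hz
    calc _ ≤ ‖x‖ * ‖y‖ * ‖z‖ := (norm_mul_le _ _).trans (by gcongr; exact norm_mul_le _ _)
      _ ≤ 1 * ‖y‖ * 1 := by gcongr
      _ = _ := by ring
  have nn : ∀ a : A, ‖star u * (r * a * q)‖ ≤ ‖a‖ := by
    intro a
    calc _ ≤ ‖star u‖ * ‖r * a * q‖ := norm_mul_le _ _
      _ ≤ 1 * ‖a‖ := by gcongr; exact n3 _ _ _ nr nq
      _ = _ := one_mul _
  have J := unit_join (η := 1/50) (by norm_num) (by norm_num) hq uX uY (hX ▸ cc a) (hY ▸ cc b)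
    (by rw [hX]; refine (norm_add_le _ _).trans ?_; have := nn a; linarith)
    (by rw [hY]; refine (norm_add_le _ _).trans ?_; have := nn b; linarith)
    (by
      have e : X - Y = star u * (r * (a - b) * q) := by
        rw [hX, hY, mul_sub, sub_mul, mul_sub]; abel
      rw [e]; refine (nn _).trans ?_; linarith)
  obtain ⟨γ, hγ⟩ := J
  obtain ⟨ξ, hξ⟩ : ∃ ξ : unitInterval → A, ξ = fun s => u * (γ s * q) + (1 - r) * ((1 - (s:ℝ)) • a + (s:ℝ) • b) * q :=
    ⟨_, rfl⟩
  have cξ : Continuous ξ := by rw [hξ]; fun_prop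
  have tX : u * (X * q) = r * a * q := by
    rw [hX, add_mul, sub_mul, one_mul, i, sub_self, add_zero, ← mul_assoc, ← mul_assoc, hu.tgt,
      mul_assoc, mul_assoc (r * a), i, ← mul_assoc, ← mul_assoc, hr.idem]
  have tY : u * (Y * q) = r * b * q := by
    rw [hY, add_mul, sub_mul, one_mul, i, sub_self, add_zero, ← mul_assoc, ← mul_assoc, hu.tgt,
      mul_assoc, mul_assoc (r * b), i, ← mul_assoc, ← mul_assoc, hr.idem]
  have ξ0 : ξ 0 = a * q := by
    rw [hξ]; simp only [γ.source, tX, Set.Icc.coe_zero, sub_zero, one_smul, zero_smul, add_zero]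
    rw [← add_mul, ← add_mul]; simp
  have ξ1 : ξ 1 = b * q := by
    rw [hξ]; simp only [γ.target, tY, Set.Icc.coe_one, sub_self, one_smul, zero_smul, zero_add]
    rw [← add_mul, ← add_mul]; simp
  have ξq : ∀ s, ξ s * q = ξ s := by
    intro s; rw [hξ]; simp only [add_mul, mul_assoc, i]
  have rξ : ∀ s, r * ξ s = u * (γ s * q) := by
    intro s; rw [hξ]; simp only [mul_add, ← mul_assoc, hu.vl]
    rw [mul_sub, mul_one, hr.idem]; simp
  have ivs : ∀ s, ∃ y, Iv q r (r * ξ s) y := by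
    intro s
    rw [rξ]
    obtain ⟨w, hw⟩ := iv_of_unit hq (hγ s).1 (hγ s).2.1
    exact ⟨_, hw.trans iu⟩
  have Ls : ∀ s, ∃ L, L * ξ s = q := by
    intro s
    obtain ⟨y, hy⟩ := ivs s
    exact ⟨y * r, by rw [mul_assoc, hy.yx]⟩
  have nξ : ∀ s, ‖ξ s - q‖ ≤ 1/4 := by
    rintro s
    have s0 := s.2.1
    have s1 := s.2.2
    have e : ξ s - q = u * (γ s - X) * q + 1 * (a - q) * q - (s:ℝ) • ((1 - r) * (a - b) * q) := by
      have e1 : u * (γ s - X) * q = u * (γ s * q) - r * a * q := by rw [mul_assoc, sub_mul, mul_sub, tX]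
      rw [e1, hξ]
      simp only [mul_sub, sub_mul, mul_add, add_mul, one_mul, mul_smul_comm, smul_mul_assoc, i]
      module
    rw [e]
    have m1 := n3 u (γ s - X) q nu' nq
    have m2 := n3 1 (a - q) q (by simpa using Pj.norm_le (Pj.one (A := A))) nq
    have m3 := n3 (1 - r) (a - b) q nr' nq
    have m4 := (hγ s).2.2
    refine (norm_sub_le _ _).trans ?_
    rw [norm_smul, Real.norm_of_nonneg s0]
    have m5 := norm_add_le (u * (γ s - X) * q) (1 * (a - q) * q)
    nlinarith [norm_nonneg ((1 - r) * (a - b) * q)]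
  have cω : Continuous fun s => PP q (ξ s) := by
    apply PP_cont (q := fun _ => q) continuous_const cξ
    intro s
    obtain ⟨L, hL⟩ := Ls s
    exact ⟨L, hq, ξq s, hL⟩
  refine ⟨⟨⟨fun s => PP q (ξ s), cω⟩, ?_, ?_⟩, ?_⟩
  · show PP q (ξ 0) = a
    rw [ξ0]
    obtain ⟨y, hy⟩ := (near_iff hq ha).1 (by linarith)
    exact PP_eq hy
  · show PP q (ξ 1) = b
    rw [ξ1]
    obtain ⟨y, hy⟩ := (near_iff hq hb).1 (by linarith)
    exact PP_eq hy
  · intro s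
    obtain ⟨L, hL⟩ := Ls s
    obtain ⟨B, hB⟩ := PP_spec hq (ξq s) hL
    obtain ⟨y, hy⟩ := ivs s
    refine ⟨hB.pr, near_of hB hy, ?_⟩
    have := hB.close (by norm_num) (nξ s)
    show ‖q - PP q (ξ s)‖ < 1
    rw [norm_sub_rev]
    linarith

/-- path connectedness -/
theorem orb_joined {p q : A} (hp : Pj p) (h : Orb p q) : JoinedIn {w | Orb p w} p q := by
  obtain ⟨u, h1, h2, rfl⟩ := h
  obtain ⟨γ, hγ⟩ := unitary_joined h1 h2
  have i := hp.idem
  have ivs : ∀ s, ∃ L, L * (γ s * p) = p := by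
    intro s
    obtain ⟨k, hk⟩ := (hγ s).1
    exact ⟨↑k⁻¹, by rw [← hk, ← mul_assoc, Units.inv_mul, one_mul]⟩
  have cω : Continuous fun s => PP p (γ s * p) := by
    apply PP_cont (q := fun _ => p) continuous_const (by fun_prop)
    intro s
    obtain ⟨L, hL⟩ := ivs s
    exact ⟨L, hp, by rw [mul_assoc, i], hL⟩
  have e0 : PP p (γ 0 * p) = p := by
    rw [γ.source, one_mul]; exact PP_eq (Iv.refl hp)
  have e1 : PP p (γ 1 * p) = u * p * star u := by
    rw [γ.target]
    have P : PI u (1:A) 1 := PI.mk2 h1 (mul_one 1) h2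
    exact PP_eq (P.restr hp (one_mul _)).iv
  refine ⟨⟨⟨_, cω⟩, e0, e1⟩, ?_⟩
  intro s
  refine orb_path hp cω ?_ ?_ s
  · intro t
    obtain ⟨L, hL⟩ := ivs t
    obtain ⟨B, hB⟩ := PP_spec hp (by rw [mul_assoc, i]) hL
    exact hB.pr
  · rw [e0]; exact Orb.self p

end cst12
end UO

namespace UO

section top
variable {Y : Type*} [TopologicalSpace Y]

/-- paths in s with the same endpoints are homotopic in Y -/
def SC (s : Set Y) : Prop := ∀ ⦃a b : Y⦄ (γ δ : Path a b), (∀ t, γ t ∈ s) → (∀ t, δ t ∈ s) → γ.Homotopic δ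

theorem sc_of_contractible {s : Set Y} (h : s.Nonempty → ContractibleSpace s) : SC s := by
  intro a b γ δ hγ hδ
  have ha : a ∈ s := by simpa using hγ 0
  have hb : b ∈ s := by simpa using hγ 1
  haveI := h ⟨a, ha⟩
  let γ' : Path (⟨a, ha⟩ : s) ⟨b, hb⟩ := ⟨⟨fun t => ⟨γ t, hγ t⟩, by fun_prop⟩, by simp, by simp⟩
  let δ' : Path (⟨a, ha⟩ : s) ⟨b, hb⟩ := ⟨⟨fun t => ⟨δ t, hδ t⟩, by fun_prop⟩, by simp, by simp⟩
  have k := (SimplyConnectedSpace.paths_homotopic γ' δ').map ⟨Subtype.val, continuous_subtype_val⟩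
  exact k

theorem mem_trans {s : Set Y} {a b c : Y} {γ : Path a b} {δ : Path b c} (h1 : ∀ t, γ t ∈ s) (h2 : ∀ t, δ t ∈ s) (t) :
    (γ.trans δ) t ∈ s := by
  have : (γ.trans δ) t ∈ Set.range (γ.trans δ) := ⟨t, rfl⟩
  rw [Path.trans_range] at this
  rcases this with ⟨x, hx⟩ | ⟨x, hx⟩
  · rw [← hx]; exact h1 x
  · rw [← hx]; exact h2 x

theorem mem_symm {s : Set Y} {a b : Y} {γ : Path a b} (h1 : ∀ t, γ t ∈ s) (t) : γ.symm t ∈ s := h1 _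

open Path.Homotopic in
theorem chain_homotopy {a b : Y} (γ : Path a b) (t : ℕ → unitInterval) (y : ℕ → Y) (R : Set Y) (N : ℕ → Set Y)
    (τ : ∀ k, Path (γ (t k)) (y k)) (σ : ∀ k, Path (y k) (y (k + 1)))
    (hy : ∀ k, y k ∈ R) (hN : ∀ k, SC (N k)) (h1 : ∀ k s, γ.subpath (t k) (t (k + 1)) s ∈ N k)
    (h2 : ∀ k s, τ k s ∈ N k) (h3 : ∀ k s, τ (k + 1) s ∈ N k) (h4 : ∀ k s, σ k s ∈ R) (h5 : ∀ k s, σ k s ∈ N k) (k : ℕ) :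
    ∃ c : Path (y 0) (y k), (∀ s, c s ∈ R) ∧
      (γ.subpath (t 0) (t k)).Homotopic ((τ 0).trans (c.trans (τ k).symm)) := by
  induction k with
  | zero =>
    refine ⟨Path.refl _, fun s => by simpa using hy 0, ?_⟩
    rw [Path.subpath_self]
    rw [← Path.Homotopic.Quotient.eq]
    simp only [Quotient.mk_trans, Quotient.mk_symm, Quotient.mk_refl, Quotient.refl_trans, Quotient.trans_symm]
  | succ k ih =>
    obtain ⟨c, hc, hh⟩ := ih
    refine ⟨c.trans (σ k), mem_trans hc (h4 k), ?_⟩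
    have e1 : (γ.subpath (t k) (t (k+1))).Homotopic ((τ k).trans ((σ k).trans (τ (k+1)).symm)) :=
      hN k _ _ (h1 k) (mem_trans (h2 k) (mem_trans (h5 k) (mem_symm (h3 k))))
    have e2 : ((γ.subpath (t 0) (t k)).trans (γ.subpath (t k) (t (k+1)))).Homotopic (γ.subpath (t 0) (t (k+1))) :=
      ⟨Path.Homotopy.subpathTransSubpath γ _ _ _⟩
    rw [← Path.Homotopic.Quotient.eq] at hh e1 e2 ⊢
    rw [← e2, Quotient.mk_trans, hh, e1]
    simp only [Quotient.mk_trans, Quotient.mk_symm, Quotient.trans_assoc]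
    rw [← Path.Homotopic.Quotient.trans_assoc (Path.Homotopic.Quotient.symm _) (Path.Homotopic.Quotient.mk (τ k)), Path.Homotopic.Quotient.symm_trans, Path.Homotopic.Quotient.refl_trans]

open Path.Homotopic in
theorem final_homotopy {a b y z : Y} (hab : b = a) (g : Path a b) (τ : Path a y) (τ' : Path b z) (c σ : Path y z)
    {R N : Set Y} (hR : SC R) (hN : SC N) (hc : ∀ s, c s ∈ R) (h1 : ∀ s, σ s ∈ R) (h2 : ∀ s, σ s ∈ N)
    (h3 : ∀ s, τ s ∈ N) (h4 : ∀ s, τ' s ∈ N) (h : g.Homotopic (τ.trans (c.trans τ'.symm))) :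
    g.Homotopic ((Path.refl a).cast rfl hab) := by
  subst hab
  have e1 := hR c σ hc h1
  have e2 : (τ.trans (σ.trans τ'.symm)).Homotopic (Path.refl _) := by
    apply hN _ _ (mem_trans h3 (mem_trans h2 (mem_symm h4)))
    intro t
    have := h3 0
    simpa using this
  refine (h.trans ?_).trans e2
  exact Path.Homotopic.hcomp (Path.Homotopic.refl _) (Path.Homotopic.hcomp e1 (Path.Homotopic.refl _))

theorem loop_of_subpath {a : Y} (γ : Path a a) {s t : unitInterval} (hs : s = 0) (ht : t = 1) (hab : γ t = γ s)
    (h : (γ.subpath s t).Homotopic ((Path.refl (γ s)).cast rfl hab)) : γ.Homotopic (Path.refl a) := by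
  subst hs ht
  rw [Path.subpath_zero_one] at h
  have := h.pathCast γ.source.symm γ.target.symm
  convert this using 1
  · ext t
    simp
  · ext t
    simp
end top

section cst13
variable {A : Type*} [CStarAlgebra A] [VNR A]

/-- the part of the orbit near r -/
def CC (p r : A) : Set {q : A // Orb p q} := {q | ‖r - q.1‖ < 1}

theorem cc_sc {p r : A} (hp : Pj p) (hr : Pj r) : SC (CC p r) := by
  apply sc_of_contractible
  rintro ⟨q0, hq0⟩
  have or : Orb p r := q0.2.near hp hr hq0
  rw [contractible_iff_id_nullhomotopic]
  refine ⟨⟨⟨r, or⟩, by simp [CC]⟩, ⟨⟨⟨fun x => ⟨⟨Ct r x.2.1.1 (1 - (x.1:ℝ)), ?_⟩, ?_⟩, ?_⟩, ?_, ?_⟩⟩⟩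
  · obtain ⟨L, B, -, -, hB, hn⟩ := ct_spec (s := 1 - (x.1:ℝ)) hr (x.2.1.2.pj hp) x.2.2 (by linarith [x.1.2.2]) (by linarith [x.1.2.1])
    exact or.near hp hB.pr (by rwa [norm_sub_rev])
  · obtain ⟨L, B, -, -, hB, hn⟩ := ct_spec (s := 1 - (x.1:ℝ)) hr (x.2.1.2.pj hp) x.2.2 (by linarith [x.1.2.2]) (by linarith [x.1.2.1])
    exact hn
  · apply Continuous.subtype_mk
    apply Continuous.subtype_mk
    apply ct_cont (by fun_prop) (by fun_prop) hr
    · intro x; exact x.2.1.2.pj hp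
    · intro x; exact x.2.2
    · intro x; linarith [x.1.2.2]
    · intro x; linarith [x.1.2.1]
  · intro x
    ext
    simpa using ct_one hr (x.1.2.pj hp) x.2
  · intro x
    ext
    simpa using ct_zero hr

theorem short_path {p : A} (hp : Pj p) (x y : {q : A // Orb p q}) {δ : ℝ} (hδ : δ ≤ 1/2) (h : ‖y.1 - x.1‖ ≤ δ) :
    ∃ τ : Path x y, ∀ s, ‖(τ s).1 - x.1‖ ≤ 2 * δ := by
  have hx := x.2.pj hp
  have hy := y.2.pj hp
  have h' : ‖x.1 - y.1‖ ≤ δ := by rwa [norm_sub_rev]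
  have cl : ∀ s : unitInterval, ‖Ct x.1 y.1 s - x.1‖ ≤ 2 * δ := fun s => ct_close hx hy hδ h' s.2.1 s.2.2
  refine ⟨⟨⟨fun s => ⟨Ct x.1 y.1 s, ?_⟩, ?_⟩, ?_, ?_⟩, cl⟩
  · obtain ⟨L, B, -, -, hB, hn⟩ := ct_spec (s := (s:ℝ)) hx hy (by linarith) s.2.1 s.2.2
    exact x.2.near hp hB.pr (by rwa [norm_sub_rev])
  · apply Continuous.subtype_mk
    exact ct_cont continuous_const (by fun_prop) hx (fun _ => hy) (fun _ => by linarith) (fun s => s.2.1) (fun s => s.2.2)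
  · ext; simpa using ct_zero hx
  · ext; simpa using ct_one hx hy (by linarith)

theorem local_path {p r : A} (hp : Pj p) (hr : Pj r) (q a b : {q : A // Orb p q})
    (na : ‖a.1 - q.1‖ ≤ 1/5000) (nb : ‖b.1 - q.1‖ ≤ 1/5000) (ra : ‖r - a.1‖ < 1) (rb : ‖r - b.1‖ < 1) :
    ∃ σ : Path a b, (∀ s, σ s ∈ CC p r) ∧ ∀ s, σ s ∈ CC p q.1 := by
  obtain ⟨γ, hγ⟩ := local_join hr (q.2.pj hp) (a.2.pj hp) (b.2.pj hp) na nb ra rb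
  refine ⟨⟨⟨fun s => ⟨γ s, ?_⟩, ?_⟩, ?_, ?_⟩, fun s => (hγ s).2.1, fun s => (hγ s).2.2⟩
  · exact q.2.near hp (hγ s).1 (by rw [norm_sub_rev]; exact (hγ s).2.2)
  · apply Continuous.subtype_mk; fun_prop
  · ext; simp
  · ext; simp

theorem subdivide {p : A} {x : {q : A // Orb p q}} (γ : Path x x) {ε : ℝ} (hε : 0 < ε) :
    ∃ (t : ℕ → unitInterval) (n : ℕ), t 0 = 0 ∧ Monotone t ∧ (∀ m ≥ n, t m = 1) ∧
      ∀ k s, s ∈ Set.Icc (t k) (t (k + 1)) → ‖(γ s).1 - (γ (t k)).1‖ < ε := by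
  obtain ⟨t, t0, tm, ⟨n, hn⟩, ht⟩ := exists_monotone_Icc_subset_open_cover_unitInterval
    (c := fun s : unitInterval => {s' | ‖(γ s').1 - (γ s).1‖ < ε / 2}) (by
      intro s
      exact isOpen_lt (by fun_prop) continuous_const)
    (by intro s _; rw [Set.mem_iUnion]; exact ⟨s, by simp [hε]⟩)
  refine ⟨t, n, t0, tm, hn, ?_⟩
  intro k s hs
  obtain ⟨i, hi⟩ := ht k
  have a1 := hi hs
  have a2 := hi (Set.left_mem_Icc.2 (tm (Nat.le_succ k)))
  simp only [Set.mem_setOf_eq] at a1 a2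
  have : (γ s).1 - (γ (t k)).1 = ((γ s).1 - (γ i).1) - ((γ (t k)).1 - (γ i).1) := by abel
  rw [this]
  refine (norm_sub_le _ _).trans_lt ?_
  linarith

theorem orb_loop {p : A} (hp : Pj p) {x : {q : A // Orb p q}} (γ : Path x x) : γ.Homotopic (Path.refl x) := by
  obtain ⟨t, n, t0, tm, hn, ht⟩ := subdivide γ (ε := 1/10000) (by norm_num)
  obtain ⟨r, hr, hy⟩ := claimA (ι := Fin (n+1)) (q := fun i => (γ (t i)).1) (δ := 1/10000) (by norm_num) hp
    (fun i => ((γ (t i)).2.eqv hp).1) (fun i => ((γ (t i)).2.eqv hp).2)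
  have hy' : ∀ k : ℕ, ∃ y : {q : A // Orb p q}, ‖y.1 - (γ (t k)).1‖ ≤ 1/10000 ∧ ‖r - y.1‖ < 1 := by
    intro k
    obtain ⟨y, h1, h2, h3⟩ := hy ⟨min k n, by omega⟩
    have e : t (min k n) = t k := by
      rcases le_total k n with h | h
      · rw [min_eq_left h]
      · rw [min_eq_right h, hn n le_rfl, hn k h]
    simp only [e] at h2
    exact ⟨⟨y, (γ (t k)).2.near hp h1 (by linarith)⟩, h2, h3⟩
  choose y y1 y2 using hy'
  have hτ : ∀ k, ∃ τ : Path (γ (t k)) (y k), ∀ s, ‖(τ s).1 - (γ (t k)).1‖ ≤ 2 * (1/10000) :=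
    fun k => short_path hp _ _ (by norm_num) (y1 k)
  choose τ τ1 using hτ
  have step : ∀ k, ‖(γ (t (k+1))).1 - (γ (t k)).1‖ < 1/10000 := fun k =>
    ht k _ (Set.right_mem_Icc.2 (tm (Nat.le_succ k)))
  have hσ : ∀ k, ∃ σ : Path (y k) (y (k+1)), (∀ s, σ s ∈ CC p r) ∧ ∀ s, σ s ∈ CC p (γ (t k)).1 := by
    intro k
    apply local_path hp hr
    · have := y1 k; linarith
    · have e : (y (k+1)).1 - (γ (t k)).1 = ((y (k+1)).1 - (γ (t (k+1))).1) + ((γ (t (k+1))).1 - (γ (t k)).1) := by abel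
      rw [e]
      refine (norm_add_le _ _).trans ?_
      have := y1 (k+1); have := step k; linarith
    · exact y2 k
    · exact y2 (k+1)
  choose σ σ1 σ2 using hσ
  have mN : ∀ k (z : {q : A // Orb p q}), ‖z.1 - (γ (t k)).1‖ < 1 → z ∈ CC p (γ (t k)).1 := by
    intro k z hz; show ‖_ - _‖ < 1; rwa [norm_sub_rev]
  have N2 : ∀ k s, τ k s ∈ CC p (γ (t k)).1 := fun k s => mN _ _ (by have := τ1 k s; linarith)
  have hab : γ (t n) = γ (t 0) := by rw [t0, hn n le_rfl, γ.source, γ.target]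
  obtain ⟨c, c1, c2⟩ := chain_homotopy γ t y (CC p r) (fun k => CC p (γ (t k)).1) τ σ (fun k => y2 k)
    (fun k => cc_sc hp ((γ (t k)).2.pj hp))
    (by
      intro k s
      have : γ.subpath (t k) (t (k+1)) s ∈ Set.range (γ.subpath (t k) (t (k+1))) := ⟨s, rfl⟩
      rw [Path.range_subpath_of_le _ _ _ (tm (Nat.le_succ k))] at this
      obtain ⟨s', hs', e⟩ := this
      rw [← e]
      exact mN _ _ (by have := ht k s' hs'; linarith))
    N2
    (by
      intro k s
      apply mN
      have e : (τ (k+1) s).1 - (γ (t k)).1 = ((τ (k+1) s).1 - (γ (t (k+1))).1) + ((γ (t (k+1))).1 - (γ (t k)).1) := by abel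
      rw [e]
      refine (norm_add_le _ _).trans_lt ?_
      have := τ1 (k+1) s; have := step k; linarith)
    σ1 σ2 n
  obtain ⟨σ', s1, s2⟩ := local_path hp hr (γ (t 0)) (y 0) (y n) (by have := y1 0; linarith)
    (by have := y1 n; rw [hab] at this; linarith) (y2 0) (y2 n)
  exact loop_of_subpath γ t0 (hn n le_rfl) hab
    (final_homotopy hab _ (τ 0) (τ n) c σ' (cc_sc hp hr) (cc_sc hp ((γ (t 0)).2.pj hp)) c1 s1 s2 (N2 0)
      (by rw [← hab]; exact N2 n) c2)

theorem orb_simply_connected {p : A} (hp : Pj p) : SimplyConnectedSpace {q : A // Orb p q} := by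
  rw [simply_connected_iff_loops_nullhomotopic]
  refine ⟨?_, fun x γ => orb_loop hp γ⟩
  have : IsPathConnected {q : A | Orb p q} := ⟨p, Orb.self p, fun {q} hq => orb_joined hp hq⟩
  exact isPathConnected_iff_pathConnectedSpace.1 this

end cst13
end UO

namespace UO

section conc
variable {H : Type*} [NormedAddCommGroup H] [InnerProductSpace ℂ H] [CompleteSpace H]

/-- index type for chains, without any order instance -/
structure Ix {X : Type*} (S : Set X) where
  val : X
  prop : val ∈ S

set_option maxHeartbeats 400000 in
open Filter Topology in
theorem chain_lim (S : Set (H →L[ℂ] H)) (hne : S.Nonempty) (hS : ∀ v ∈ S, v * star v * v = v)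
    (hc : ∀ v ∈ S, ∀ w ∈ S, w * (star v * v) = v ∨ v * (star w * w) = w) :
    ∃ v : H →L[ℂ] H, (∀ w ∈ S, v * (star w * w) = w ∧ star w * v = star w * w) ∧
      ∀ a b : H →L[ℂ] H, (∀ w ∈ S, a * w = w * b) → a * v = v * b := by
  have key : ∀ v ∈ S, ∀ w ∈ S, w * (star v * v) = v → star v * w = star v * v := by
    intro v hv w hw h
    have pv : Pj (star v * v) := ⟨by rw [← mul_assoc, mul_assoc (star v), mul_assoc (star v), hS v hv], by simp⟩
    have pw : Pj (star w * w) := ⟨by rw [← mul_assoc, mul_assoc (star w), mul_assoc (star w), hS w hw], by simp⟩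
    have h1 : star v = star v * v * star w := by
      have := congrArg star h
      simpa using this.symm
    have h2 : star v * v * (star w * w) * (star v * v) = star v * v := by
      rw [← mul_assoc (star v * v), ← h1, mul_assoc, h]
    have h3 : (star w * w) * (star v * v) = star v * v := by
      have : star ((1 - star w * w) * (star v * v)) * ((1 - star w * w) * (star v * v)) = 0 := by
        have e : star ((1 - star w * w) * (star v * v)) = (star v * v) * (1 - star w * w) := by simp
        rw [e]
        have : (star v * v) * (1 - star w * w) * ((1 - star w * w) * (star v * v)) = (star v * v) * ((1 - star w * w) * (1 - star w * w)) * (star v * v) := by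
          simp only [mul_assoc]
        rw [this, pw.compl.idem, mul_sub, mul_one, sub_mul, h2, pv.idem, sub_self]
      rw [CStarRing.star_mul_self_eq_zero_iff, sub_mul, one_mul, sub_eq_zero] at this
      exact this.symm
    have h4 := congrArg star h3
    simp only [star_mul, star_star] at h4
    calc star v * w = star v * v * star w * w := by rw [← h1]
      _ = star v * v * (star w * w) := by rw [mul_assoc (star v * v)]
      _ = star v * v := h4
  letI : Preorder (Ix S) :=
    { le := fun v w => w.val * (star v.val * v.val) = v.val
      le_refl := fun v => by rw [← mul_assoc]; exact hS v.val v.prop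
      le_trans := by
        intro u v w h1 h2
        change w.val * (star u.val * u.val) = u.val
        have h1 : v.val * (star u.val * u.val) = u.val := h1
        have h2 : w.val * (star v.val * v.val) = v.val := h2
        have h3 := congrArg star (key u.val u.prop v.val v.prop h1)
        simp only [star_mul, star_star] at h3
        calc w.val * (star u.val * u.val) = w.val * (star v.val * (v.val * (star u.val * u.val))) := by rw [h1, h3]
          _ = w.val * (star v.val * v.val) * (star u.val * u.val) := by simp only [mul_assoc]
          _ = u.val := by rw [h2, h1] }
  have le_def : ∀ v w : Ix S, v ≤ w ↔ w.val * (star v.val * v.val) = v.val := fun v w => Iff.rfl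
  haveI : Nonempty (Ix S) := ⟨⟨hne.some, hne.some_mem⟩⟩
  haveI : IsDirectedOrder (Ix S) := ⟨fun v w => by
    rcases hc v.val v.prop w.val w.prop with h | h
    · exact ⟨w, h, le_refl w⟩
    · exact ⟨v, le_refl v, h⟩⟩
  have nrm : ∀ w ∈ S, ‖w‖ ≤ 1 := by
    intro w hw
    by_contra hlt
    push Not at hlt
    have h1 : ‖w‖ * ‖w‖ = ‖star w * w‖ := (CStarRing.norm_star_mul_self).symm
    have h2 : ‖star w * w‖ * ‖star w * w‖ = ‖star w * w‖ := by
      rw [← CStarRing.norm_star_mul_self (x := star w * w)]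
      congr 1
      simp only [star_mul, star_star]
      rw [← mul_assoc, mul_assoc (star w), mul_assoc (star w), hS w hw]
    rw [← h1] at h2
    have h3 : 1 < ‖w‖ * ‖w‖ := by nlinarith
    nlinarith
  have pyth : ∀ v w : Ix S, v ≤ w → ∀ ξ, ‖w.val ξ - v.val ξ‖ ^ 2 = ‖w.val ξ‖ ^ 2 - ‖v.val ξ‖ ^ 2 := by
    intro v w h ξ
    have h1 := key v.val v.prop w.val w.prop h
    have h2 : inner ℂ (v.val ξ) (w.val ξ - v.val ξ) = 0 := by
      rw [← ContinuousLinearMap.adjoint_inner_right, ← ContinuousLinearMap.star_eq_adjoint, map_sub]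
      have := congrArg (fun T => T ξ) h1
      simp only [ContinuousLinearMap.mul_apply] at this
      rw [this]; simp
    have h3 := norm_add_sq_eq_norm_sq_add_norm_sq_of_inner_eq_zero (v.val ξ) (w.val ξ - v.val ξ) h2
    rw [add_sub_cancel] at h3
    nlinarith
  have conv : ∀ ξ, ∃ y, Tendsto (fun w : Ix S => w.val ξ) atTop (𝓝 y) := by
    intro ξ
    apply cauchySeq_tendsto_of_complete
    have bdd : BddAbove (Set.range fun w : Ix S => ‖w.val ξ‖ ^ 2) := by
      refine ⟨‖ξ‖ ^ 2, ?_⟩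
      rintro _ ⟨w, rfl⟩
      have := w.1.le_of_opNorm_le (nrm w.val w.prop) ξ
      rw [one_mul] at this
      exact pow_le_pow_left₀ (norm_nonneg _) this 2
    refine Metric.cauchy_iff.2 ⟨inferInstance, fun ε' hε' => ?_⟩
    obtain ⟨ε, hε, rfl⟩ : ∃ ε, 0 < ε ∧ ε' = ε + ε := ⟨ε' / 2, by linarith, by ring⟩
    obtain ⟨w0, hw0⟩ := exists_lt_of_lt_ciSup (show (⨆ w : Ix S, ‖w.val ξ‖ ^ 2) - ε ^ 2 < ⨆ w : Ix S, ‖w.val ξ‖ ^ 2 by nlinarith [pow_pos hε 2])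
    have cl : ∀ w, w0 ≤ w → dist (w.val ξ) (w0.val ξ) < ε := by
      intro w hw
      rw [dist_eq_norm]
      have h1 := pyth w0 w hw ξ
      have h2 := le_ciSup bdd w
      exact lt_of_pow_lt_pow_left₀ 2 hε.le (by linarith)
    refine ⟨_, image_mem_map (Ici_mem_atTop w0), ?_⟩
    rintro _ ⟨w, hw, rfl⟩ _ ⟨w', hw', rfl⟩
    exact (dist_triangle_right _ _ (w0.val ξ)).trans_lt (add_lt_add (cl w hw) (cl w' hw'))
  choose f hf using conv
  obtain ⟨v, hv⟩ : ∃ v : H →L[ℂ] H, ∀ ξ, Tendsto (fun w : Ix S => w.val ξ) atTop (𝓝 (v ξ)) :=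
    ⟨ContinuousLinearMap.ofTendstoOfBoundedRange f (fun w : Ix S => w.val) (l := atTop)
      (tendsto_pi_nhds.2 hf) ((Metric.isBounded_iff_subset_closedBall 0).2 ⟨1, by
        rintro _ ⟨w, rfl⟩
        simpa using nrm w.val w.prop⟩), hf⟩
  have lim : ∀ (a : H →L[ℂ] H) ξ, Tendsto (fun w : Ix S => a (w.val ξ)) atTop (𝓝 (a (v ξ))) :=
    fun a ξ => (a.continuous.tendsto _).comp (hv ξ)
  refine ⟨v, fun w0 hw0 => ⟨?_, ?_⟩, fun a b hab => ?_⟩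
  · refine ContinuousLinearMap.ext fun ξ => ?_
    refine tendsto_nhds_unique (hv ((star w0 * w0) ξ)) (tendsto_const_nhds.congr' ?_)
    filter_upwards [eventually_ge_atTop (⟨w0, hw0⟩ : Ix S)] with w hw
    have := (le_def _ _).1 hw
    exact (DFunLike.congr_fun this ξ).symm
  · refine ContinuousLinearMap.ext fun ξ => ?_
    rw [ContinuousLinearMap.mul_apply, ContinuousLinearMap.mul_apply]
    refine tendsto_nhds_unique (lim (star w0) ξ) (Tendsto.congr' (f₁ := fun _ : Ix S => (star w0) (w0 ξ)) ?_ tendsto_const_nhds)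
    filter_upwards [eventually_ge_atTop (⟨w0, hw0⟩ : Ix S)] with w hw
    have h0 := (le_def (⟨w0, hw0⟩ : Ix S) w).1 hw
    have := DFunLike.congr_fun (key w0 hw0 w.val w.prop h0) ξ
    rw [ContinuousLinearMap.mul_apply, ContinuousLinearMap.mul_apply] at this
    exact this.symm
  · refine ContinuousLinearMap.ext fun ξ => ?_
    refine tendsto_nhds_unique (lim a ξ) ((hv (b ξ)).congr ?_)
    intro w
    exact (DFunLike.congr_fun (hab w.val w.prop) ξ).symm

theorem polar_op (x h : H →L[ℂ] H) (hh : star h = h) (hx : h * h = star x * x) :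
    ∃ v : H →L[ℂ] H, v * h = x ∧ (∀ ξ, h ξ = 0 → v ξ = 0) ∧
      ∀ m, m * h = h * m → m * x = x * m → m * v = v * m := by
  have hn : ∀ ξ, ‖x ξ‖ = ‖h ξ‖ := by
    intro ξ
    have e : inner ℂ (x ξ) (x ξ) = inner ℂ (h ξ) (h ξ) := by
      rw [← ContinuousLinearMap.adjoint_inner_right, ← ContinuousLinearMap.adjoint_inner_right h,
        ← ContinuousLinearMap.star_eq_adjoint, ← ContinuousLinearMap.star_eq_adjoint, hh]
      have := congrArg (fun T => T ξ) hx
      simp only [ContinuousLinearMap.mul_apply] at this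
      rw [this]
    rw [inner_self_eq_norm_sq_to_K, inner_self_eq_norm_sq_to_K] at e
    have e2 : ‖x ξ‖ ^ 2 = ‖h ξ‖ ^ 2 := by exact_mod_cast e
    exact (pow_left_inj₀ (norm_nonneg _) (norm_nonneg _) two_ne_zero).1 e2
  let K : Submodule ℂ H := (LinearMap.range h.toLinearMap).topologicalClosure
  haveI : CompleteSpace K := (Submodule.isClosed_topologicalClosure _).completeSpace_coe
  have hK : ∀ ξ, h ξ ∈ K := fun ξ => Submodule.le_topologicalClosure _ ⟨ξ, rfl⟩
  let e : H →ₗ[ℂ] K := h.toLinearMap.codRestrict K hK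
  have he : DenseRange e := by
    intro y
    rw [Metric.mem_closure_iff]
    intro ε hε
    have hy : y.1 ∈ closure (Set.range h) := by
      have := y.2
      exact this
    obtain ⟨_, ⟨ξ, rfl⟩, hb⟩ := Metric.mem_closure_iff.1 hy ε hε
    exact ⟨e ξ, ⟨ξ, rfl⟩, hb⟩
  have hC : ∃ C, ∀ ξ, ‖x.toLinearMap ξ‖ ≤ C * ‖e ξ‖ := ⟨1, fun ξ => by rw [one_mul]; exact (hn ξ).le⟩
  let v0 : K →L[ℂ] H := x.toLinearMap.extendOfNorm e
  have hv0 : ∀ ξ, v0 (e ξ) = x ξ := LinearMap.extendOfNorm_eq he hC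
  let v : H →L[ℂ] H := v0 ∘L K.orthogonalProjection
  have v1 : ∀ ξ, v (h ξ) = x ξ := by
    intro ξ
    rw [← hv0]
    change v0 (K.orthogonalProjection (h ξ)) = _
    congr 1
    exact Submodule.orthogonalProjection_mem_subspace_eq_self (e ξ)
  have hker : ∀ ξ, h ξ = 0 ↔ ξ ∈ Kᗮ := by
    intro ξ
    have : Kᗮ = (LinearMap.range h.toLinearMap)ᗮ := Submodule.orthogonal_closure _
    rw [this, Submodule.mem_orthogonal]
    have sw : ∀ η, inner ℂ (h η) ξ = inner ℂ η (h ξ) := by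
      intro η
      rw [← ContinuousLinearMap.adjoint_inner_right, ← ContinuousLinearMap.star_eq_adjoint, hh]
    constructor
    · rintro h0 _ ⟨η, rfl⟩
      change inner ℂ (h η) ξ = 0
      rw [sw, h0, inner_zero_right]
    · intro h0
      have := h0 (h (h ξ)) ⟨h ξ, rfl⟩
      rw [sw, inner_self_eq_zero] at this
      exact this
  have v2 : ∀ ξ, h ξ = 0 → v ξ = 0 := by
    intro ξ h0
    change v0 (K.orthogonalProjection ξ) = 0
    rw [Submodule.orthogonalProjection_mem_subspace_orthogonalComplement_eq_zero ((hker ξ).1 h0), map_zero]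
  refine ⟨v, ContinuousLinearMap.ext v1, v2, fun m mh mx => ?_⟩
  have mh' : ∀ ξ, m (h ξ) = h (m ξ) := fun ξ => congrArg (fun T => T ξ) mh
  have mx' : ∀ ξ, m (x ξ) = x (m ξ) := fun ξ => congrArg (fun T => T ξ) mx
  have onK : ∀ y ∈ K, m (v y) = v (m y) := by
    intro y hy
    have hy : y ∈ closure (Set.range h) := by
      exact hy
    have hcl : IsClosed {y | m (v y) = v (m y)} := isClosed_eq (by fun_prop) (by fun_prop)
    refine closure_minimal ?_ hcl hy
    rintro _ ⟨ξ, rfl⟩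
    change m (v (h ξ)) = v (m (h ξ))
    rw [v1, mh', v1, mx']
  ext ξ
  change m (v ξ) = v (m ξ)
  have dec := K.starProjection_add_starProjection_orthogonal ξ
  rw [← dec]
  simp only [map_add]
  have k0 : h (Kᗮ.starProjection ξ) = 0 := (hker _).2 (Submodule.starProjection_apply_mem _ _)
  rw [onK _ (Submodule.starProjection_apply_mem _ _), v2 _ k0, v2 (m (Kᗮ.starProjection ξ)) (by rw [← mh', k0, map_zero]), map_zero]

end conc
end UO

namespace UO

section vn
variable {H : Type*} [NormedAddCommGroup H] [InnerProductSpace ℂ H] [CompleteSpace H]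
variable {M : VonNeumannAlgebra H}

theorem mem_of_comm {x : H →L[ℂ] H} (h : ∀ m ∈ M.commutant, m * x = x * m) : x ∈ M := by
  rw [← M.commutant_commutant, VonNeumannAlgebra.mem_commutant_iff]
  exact h

theorem comm_of_mem {x m : H →L[ℂ] H} (hx : x ∈ M) (hm : m ∈ M.commutant) : m * x = x * m := by
  rw [VonNeumannAlgebra.mem_commutant_iff] at hm
  exact (hm x hx).symm

theorem exists_proj (K : Submodule ℂ H) (hc : IsClosed (K : Set H))
    (hinv : ∀ m ∈ M.commutant, ∀ η ∈ K, m η ∈ K) :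
    ∃ e ∈ M, e * e = e ∧ star e = e ∧ ∀ η, e η = η ↔ η ∈ K := by
  haveI : CompleteSpace K := hc.completeSpace_coe
  have hp : IsStarProjection K.starProjection := isStarProjection_starProjection
  refine ⟨K.starProjection, ?_, hp.isIdempotentElem, hp.isSelfAdjoint,
    fun η => Submodule.starProjection_eq_self_iff⟩
  rw [VonNeumannAlgebra.IsStarProjection.mem_iff hp]
  intro y hy
  rw [Module.End.mem_invtSubmodule]
  intro η hη
  have : η ∈ K := by simpa using hη
  have := hinv y hy η this
  simpa using this

theorem vn_closed (M : VonNeumannAlgebra H) : IsClosed (M : Set (H →L[ℂ] H)) := by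
  have : (M : Set (H →L[ℂ] H)) = ⋂ m ∈ M.commutant, {x | m * x = x * m} := by
    ext x
    simp only [Set.mem_iInter, Set.mem_setOf_eq, SetLike.mem_coe]
    exact ⟨fun hx m hm => comm_of_mem hx hm, mem_of_comm⟩
  rw [this]
  exact isClosed_biInter fun m _ => isClosed_eq (by fun_prop) (by fun_prop)

/-- the norm closed star algebra structure -/
@[reducible] noncomputable def vnC (M : VonNeumannAlgebra H) : CStarAlgebra M :=
  haveI : IsClosed (M : Set (H →L[ℂ] H)) := vn_closed M
  haveI : IsClosed (M.toStarSubalgebra : Set (H →L[ℂ] H)) := this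
  inferInstanceAs (CStarAlgebra M.toStarSubalgebra)

theorem co_mul (a b : M) : ((a * b : M) : H →L[ℂ] H) = a * b := rfl
theorem co_star (a : M) : ((star a : M) : H →L[ℂ] H) = star (a : H →L[ℂ] H) := rfl
theorem co_zero : ((0 : M) : H →L[ℂ] H) = 0 := rfl
theorem co_one : ((1 : M) : H →L[ℂ] H) = 1 := rfl
theorem co_sub (a b : M) : ((a - b : M) : H →L[ℂ] H) = a - b := rfl

theorem vn_ker (S : Set (H →L[ℂ] H)) (hS : ∀ s ∈ S, s ∈ M) :
    ∃ e ∈ M, e * e = e ∧ star e = e ∧ ∀ η, e η = η ↔ ∀ s ∈ S, s η = 0 := by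
  let K : Submodule ℂ H := ⨅ s ∈ S, LinearMap.ker s.toLinearMap
  have memK : ∀ η, η ∈ K ↔ ∀ s ∈ S, s η = 0 := by
    intro η
    simp only [K, Submodule.mem_iInf, LinearMap.mem_ker, ContinuousLinearMap.coe_coe]
  have hK : IsClosed (K : Set H) := by
    have : (K : Set H) = ⋂ s ∈ S, {η | s η = 0} := by
      ext η
      simp only [SetLike.mem_coe, memK, Set.mem_iInter, Set.mem_setOf_eq]
    rw [this]
    exact isClosed_biInter fun s _ => isClosed_eq s.continuous continuous_const
  have hinv : ∀ m ∈ M.commutant, ∀ η ∈ K, m η ∈ K := by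
    intro m hm η hη
    rw [memK] at hη ⊢
    intro s hs
    have := DFunLike.congr_fun (comm_of_mem (hS s hs) hm) η
    rw [ContinuousLinearMap.mul_apply, ContinuousLinearMap.mul_apply, hη s hs, map_zero] at this
    exact this.symm
  obtain ⟨e, eM, e1, e2, e3⟩ := exists_proj (M := M) K hK hinv
  exact ⟨e, eM, e1, e2, fun η => (e3 η).trans (memK η)⟩

theorem baer_aux_a (e : H →L[ℂ] H) (eM : e ∈ M) (e1 : e * e = e) (e2 : star e = e) : Pj (⟨e, eM⟩ : M) := ⟨Subtype.ext e1, Subtype.ext e2⟩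

theorem baer_aux_b (e : M) (pj : Pj e) : ∃ e : M, e * e = e ∧ star e = e :=  ⟨1 - e, pj.compl.idem, pj.compl.sa⟩

theorem baer_aux_c (e a : M) : (1 - e) * a = 0 ↔ ∀ ξ, e.1 (a.1 ξ) = a.1 ξ := by
    rw [sub_mul, one_mul, sub_eq_zero]
    constructor
    · intro h ξ
      have h' : (a : H →L[ℂ] H) = e * a := congrArg Subtype.val h
      have h'' := DFunLike.congr_fun h' ξ
      rw [ContinuousLinearMap.mul_apply] at h''
      exact h''.symm
    · intro h
      have h' : (a : H →L[ℂ] H) = e * a := ContinuousLinearMap.ext fun ξ => by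
        rw [ContinuousLinearMap.mul_apply, h ξ]
      exact Subtype.ext h'

theorem baer_aux_d (a : M) (S : Set M) : (∀ ξ, ∀ s ∈ S, s.1 (a.1 ξ) = 0) ↔ ∀ s ∈ S, s * a = 0 := by
  constructor
  · intro h s hs
    have h' : (s : H →L[ℂ] H) * (a : H →L[ℂ] H) = 0 := ContinuousLinearMap.ext fun ξ => h ξ s hs
    exact Subtype.ext h'
  · intro h ξ s hs
    have h' : (s : H →L[ℂ] H) * (a : H →L[ℂ] H) = 0 := congrArg Subtype.val (h s hs)
    have h'' := DFunLike.congr_fun h' ξ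
    rw [ContinuousLinearMap.mul_apply] at h''
    exact h''

theorem baer_aux_e (S : Set M) (e : H →L[ℂ] H) (e3 : ∀ η, e η = η ↔ ∀ s ∈ Subtype.val '' S, s η = 0) (η) :
  e η = η ↔ ∀ s ∈ S, s.1 η = 0 := by
  rw [e3]
  exact Set.forall_mem_image

theorem vn_baer (S : Set M) : ∃ e : M, e * e = e ∧ star e = e ∧ ∀ a, e * a = 0 ↔ ∀ s ∈ S, s * a = 0 := by
  obtain ⟨e, eM, e1, e2, e3⟩ := vn_ker (M := M) (Subtype.val '' S) (by
    rintro _ ⟨s, hs, rfl⟩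
    exact s.2)
  have pj := baer_aux_a e eM e1 e2
  have e4 := baer_aux_e S e e3
  obtain ⟨E, rfl⟩ : ∃ E : M, E.1 = e := ⟨⟨e, eM⟩, rfl⟩
  have pj : Pj E := pj
  clear e3
  refine ⟨1 - E, pj.compl.idem, pj.compl.sa, fun a => ?_⟩
  exact (baer_aux_c E a).trans ((forall_congr' fun ξ => e4 (a.1 ξ)).trans (baer_aux_d a S))

theorem vn_polar (x h : M) (h1 : star h = h) (h2 : h * h = star x * x) :
    ∃ v : M, v * h = x ∧ ∀ a, h * a = 0 → v * a = 0 := by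
  obtain ⟨v, v1, v2, v3⟩ := polar_op (x : H →L[ℂ] H) h (congrArg Subtype.val h1) (congrArg Subtype.val h2)
  refine ⟨⟨v, mem_of_comm fun m hm => v3 m (comm_of_mem h.2 hm) (comm_of_mem x.2 hm)⟩, Subtype.ext v1,
    fun a ha => Subtype.ext (ContinuousLinearMap.ext fun ξ => ?_)⟩
  exact v2 _ (DFunLike.congr_fun (congrArg Subtype.val ha) ξ)

theorem vn_chain (S : Set M) (hne : S.Nonempty) (hS : ∀ v ∈ S, v * star v * v = v)
    (hc : ∀ v ∈ S, ∀ w ∈ S, w * (star v * v) = v ∨ v * (star w * w) = w) :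
    ∃ v : M, v * star v * v = v ∧ (∀ w ∈ S, v * (star w * w) = w) ∧
      (∀ a, (∀ w ∈ S, a * w = 0) → a * v = 0) ∧ (∀ a, (∀ w ∈ S, w * a = 0) → v * a = 0) := by
  obtain ⟨v, v1, v2⟩ := chain_lim (Subtype.val '' S) (hne.image _) (by
    rintro _ ⟨v, hv, rfl⟩
    exact congrArg Subtype.val (hS v hv)) (by
    rintro _ ⟨v, hv, rfl⟩ _ ⟨w, hw, rfl⟩
    exact (hc v hv w hw).imp (fun h => congrArg Subtype.val h) (fun h => congrArg Subtype.val h))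
  have vM : v ∈ M := mem_of_comm fun m hm => v2 m m (by
    rintro _ ⟨w, hw, rfl⟩
    exact comm_of_mem w.2 hm)
  obtain ⟨V, rfl⟩ : ∃ V : M, V.1 = v := ⟨⟨v, vM⟩, rfl⟩
  have A1 : ∀ w ∈ S, V * (star w * w) = w := fun w hw => Subtype.ext (v1 _ ⟨w, hw, rfl⟩).1
  have A2 : ∀ w ∈ S, star w * V = star w * w := fun w hw => Subtype.ext (v1 _ ⟨w, hw, rfl⟩).2
  have A3 : ∀ a, (∀ w ∈ S, a * w = 0) → a * V = 0 := by
    intro a ha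
    have := v2 a.1 0 (by
      rintro _ ⟨w, hw, rfl⟩
      rw [mul_zero]
      exact congrArg Subtype.val (ha w hw))
    rw [mul_zero] at this
    exact Subtype.ext this
  have A4 : ∀ a, (∀ w ∈ S, w * a = 0) → V * a = 0 := by
    intro a ha
    have := v2 0 a.1 (by
      rintro _ ⟨w, hw, rfl⟩
      rw [zero_mul]
      exact (congrArg Subtype.val (ha w hw)).symm)
    rw [zero_mul] at this
    exact Subtype.ext this.symm
  refine ⟨V, ?_, A1, A3, A4⟩
  have B1 : ∀ w ∈ S, w * star (V * star V * V - V) = 0 := by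
    intro w hw
    have h1 : star V * w = star w * w := by
      have := st (A2 w hw)
      simpa using this
    have h2 : (V * star V * V - V) * (star w * w) = 0 := by
      rw [sub_mul, mul_assoc (V * star V), A1 w hw, mul_assoc, h1, A1 w hw, sub_self]
    have h3 : (V * star V * V - V) * star w = 0 := by
      have e : star w = star w * w * star w := by
        have := congrArg star (hS w hw)
        simp only [star_mul, star_star] at this
        rw [mul_assoc]; exact this.symm
      rw [e, ← mul_assoc, h2, zero_mul]
    have := st h3
    simpa using this
  have B2 := A4 _ B1
  have B3 : (V * star V * V - V) * star V = 0 := by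
    have := st B2
    rwa [star_star, star_zero] at this
  have B4 : (V * star V * V - V) * star (V * star V * V - V) = 0 := by
    have : star (V * star V * V - V) = star V * (V * star V - 1) := by
      simp [mul_sub, mul_assoc]
    rw [this, ← mul_assoc, B3, zero_mul]
  have B5 := (CStarRing.mul_star_self_eq_zero_iff (V * star V * V - V : M).1).1 (congrArg Subtype.val B4)
  exact sub_eq_zero.1 (Subtype.ext B5)

instance vnV (M : VonNeumannAlgebra H) : VNR M where
  proper x h := Subtype.ext ((CStarRing.star_mul_self_eq_zero_iff x.1).1 (congrArg Subtype.val h))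
  baer := vn_baer
  sqrt x := by
    letI := vnC M
    obtain ⟨h, h1, h2, -⟩ := exists_sqrt x
    exact ⟨h, h1, h2⟩
  polar := vn_polar
  chain := vn_chain

/-- the orbit in the algebra is the orbit in the statement -/
def orbHomeo (M : VonNeumannAlgebra H) (p : H →L[ℂ] H) (hpM : p ∈ M) :
    {q : H →L[ℂ] H // ∃ u ∈ M, star u * u = 1 ∧ u * star u = 1 ∧ q = u * p * star u} ≃ₜ
      {q : M // ∃ u : M, star u * u = 1 ∧ u * star u = 1 ∧ q = u * ⟨p, hpM⟩ * star u} where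
  toFun q := ⟨⟨q.1, by
      obtain ⟨u, hu, -, -, h⟩ := q.2
      rw [h]
      exact mul_mem (mul_mem hu hpM) (star_mem hu)⟩, by
      obtain ⟨u, hu, h1, h2, h⟩ := q.2
      exact ⟨⟨u, hu⟩, Subtype.ext h1, Subtype.ext h2, Subtype.ext h⟩⟩
  invFun q := ⟨q.1.1, by
      obtain ⟨u, h1, h2, h⟩ := q.2
      exact ⟨u.1, u.2, congrArg Subtype.val h1, congrArg Subtype.val h2, congrArg Subtype.val h⟩⟩
  left_inv q := rfl
  right_inv q := rfl
  continuous_toFun := by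
    apply Continuous.subtype_mk
    apply Continuous.subtype_mk
    exact continuous_subtype_val
  continuous_invFun := by
    apply Continuous.subtype_mk
    exact continuous_subtype_val.comp continuous_subtype_val

end vn
end UO

/-- **Theorem 5.5.** The unitary orbit `U_M(p) = {u p u* : u ∈ U_M}` of a projection
`p` in a von Neumann algebra `M`, with the operator-norm topology, is simply
connected. -/
theorem unitary_orbit_simply_connected {H : Type*} [NormedAddCommGroup H]
    [InnerProductSpace ℂ H] [CompleteSpace H]
    (M : VonNeumannAlgebra H) (p : H →L[ℂ] H) (hpM : p ∈ M)
    (hp : p * p = p) (hps : star p = p) :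
    SimplyConnectedSpace
      {q : H →L[ℂ] H // ∃ u ∈ M, star u * u = 1 ∧ u * star u = 1 ∧ q = u * p * star u} := by
  haveI : SimplyConnectedSpace {q : M // ∃ u : M, star u * u = 1 ∧ u * star u = 1 ∧ q = u * ⟨p, hpM⟩ * star u} :=
    letI := UO.vnC M
    UO.orb_simply_connected (A := M) (p := ⟨p, hpM⟩) ⟨Subtype.ext hp, Subtype.ext hps⟩
  exact (UO.orbHomeo M p hpM).toHomotopyEquiv.simplyConnectedSpace
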